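/- Fix an integer t ≥ 2. For a tree T chosen uniformly at random among all canonical t-ary trees with n internal vertices, the height h(T) is asymptotically normally distributed as n → ∞, and a local limit theorem holds. The mean of h(T) is μ_h·n + O(1) and the variance is σ_h²·n + O(1), where μ_h = (∂b/∂w(q_0,1,1,w)|_{w=1})/(q_0·∂b/∂q(q,1,1,1)|_{q=q_0}), and these constants satisfy |μ_h − (1/2 + (t−2)/2^{t+3} + (2t²+3t−8)/2^{2t+5} + (9t³+45t²+2t−88)/2^{3t+8})| ≤ 0.55 t⁴/2^{4t} and |σ_h² − (1/4 + (−t²+5t−2)/2^{t+4} + (−4t³+4t²+27t−14)/2^{2t+6})| ≤ 0.26 t⁴/2^{3t} for all t ≥ 2. -/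

import Mathlib

open scoped BigOperators
open Filter MeasureTheory

noncomputable section

/-- `hp t j = 1 + t + ⋯ + t^(j-1) = (t^j - 1)/(t-1)`. -/
def hp (t j : ℕ) : ℕ := ∑ i ∈ Finset.range j, t ^ i

/-- The series `b(q,u,v,w)`
`b = Σ_{j≥1} v q^{h_j} u^{t^j} w^j/(1−q^{h_j} u^{t^j}) ∏_{i=1}^{j−1} (1−v−q^{h_i}u^{t^i})/(1−q^{h_i}u^{t^i})`. -/
def bGF (t : ℕ) (q u v w : ℂ) : ℂ :=
  ∑' j : ℕ,
    v * q ^ hp t (j + 1) * u ^ t ^ (j + 1) * w ^ (j + 1) /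
        (1 - q ^ hp t (j + 1) * u ^ t ^ (j + 1)) *
      ∏ i ∈ Finset.Icc 1 j,
        (1 - v - q ^ hp t i * u ^ t ^ i) / (1 - q ^ hp t i * u ^ t ^ i)

/-- The series `a(q,u,v,w)` (for canonical forests with `r` roots)
`a = Σ_{j≥0} v q^{r h_j} u^{r t^j} w^j ∏_{i=1}^{j} (1−v−q^{h_i}u^{t^i})/(1−q^{h_i}u^{t^i})`. -/
def aGF (t r : ℕ) (q u v w : ℂ) : ℂ :=
  ∑' j : ℕ,
    v * q ^ (r * hp t j) * u ^ (r * t ^ j) * w ^ j *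
      ∏ i ∈ Finset.Icc 1 j,
        (1 - v - q ^ hp t i * u ^ t ^ i) / (1 - q ^ hp t i * u ^ t ^ i)

/-- A canonical `t`-ary forest with `r` (ordered) roots, encoded by its sequence of
numbers of internal vertices on each level (a canonical forest is uniquely determined
by this sequence: on each level the leaves come first, since outdegrees read from left
to right are non-decreasing).  The number `c_0` of internal vertices on level `0` is at
most `r`, each level's internal-vertex count satisfies `1 ≤ c_{k+1} ≤ t·c_k`, and the
list stops at the last level containing internal vertices. -/
structure CanonicalForest (t r : ℕ) where
  levels : List ℕ
  pos : ∀ c ∈ levels, 0 < c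
  head_le : ∀ c ∈ levels.head?, c ≤ r
  chain : levels.Chain' fun a b => b ≤ t * a

namespace CanonicalForest

variable {t r : ℕ} (T : CanonicalForest t r)

/-- the number `n(T)` of internal vertices -/
def size : ℕ := T.levels.sum

/-- the height `h(T)`: the maximal distance of a leaf from the root level -/
def height : ℕ := T.levels.length

/-- the number of internal vertices at depth `k` -/
def internAt (k : ℕ) : ℕ := T.levels.getD k 0

/-- the number of vertices at depth `k` -/
def vertsAt (k : ℕ) : ℕ := if k = 0 then r else t * T.internAt (k - 1)

/-- the number of leaves at depth `k` -/
def leavesAt (k : ℕ) : ℕ := T.vertsAt k - T.internAt k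

/-- the number `m(T)` of leaves at maximal depth -/
def lastLeaves : ℕ := T.vertsAt T.height

/-- the number `d(T)` of distinct depths at which leaves occur -/
def distinctDepths : ℕ :=
  ((Finset.range (T.height + 1)).filter fun k => 0 < T.leavesAt k).card

/-- the (leaf-)width `w(T)`: the maximal number of leaves on one level -/
def width : ℕ := (Finset.range (T.height + 1)).sup fun k => T.leavesAt k

/-- the total path length `ℓ(T)`: the sum of the depths of all vertices -/
def pathLength : ℕ := ∑ k ∈ Finset.range (T.height + 1), k * T.vertsAt k

end CanonicalForest

/-- the number of canonical `t`-ary forests with `r` roots and `n` internal vertices -/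
def forestCount (t r n : ℕ) : ℕ := Nat.card {T : CanonicalForest t r // T.size = n}

/-- the probability of an event under the uniform distribution on canonical `t`-ary
forests with `r` roots and `n` internal vertices -/
def forestProb (t r n : ℕ) (s : Set (CanonicalForest t r)) : ℝ :=
  (Nat.card {T : CanonicalForest t r // T.size = n ∧ T ∈ s} : ℝ) / forestCount t r n

/-- the expectation of a random variable under the uniform distribution on canonical
`t`-ary forests with `r` roots and `n` internal vertices -/
def forestExp (t r n : ℕ) (f : CanonicalForest t r → ℝ) : ℝ :=
  (∑ᶠ T : {T : CanonicalForest t r // T.size = n}, f T.1) / forestCount t r n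

/-- the variance of a random variable under the uniform distribution on canonical
`t`-ary forests with `r` roots and `n` internal vertices -/
def forestVar (t r n : ℕ) (f : CanonicalForest t r → ℝ) : ℝ :=
  forestExp t r n (fun T => f T ^ 2) - forestExp t r n f ^ 2

/-- the distribution function of the standard normal distribution -/
def stdGaussCDF (x : ℝ) : ℝ :=
  (Real.sqrt (2 * Real.pi))⁻¹ * ∫ u in Set.Iic x, Real.exp (-u ^ 2 / 2)

/-- the density of the standard normal distribution -/
def stdGaussPDF (x : ℝ) : ℝ :=
  (Real.sqrt (2 * Real.pi))⁻¹ * Real.exp (-x ^ 2 / 2)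


/-- number of admissible level sequences of length `k`, entries at least `l`, sum `n`, first entry
at most `m`. -/
def Nl (l t : ℕ) : ℕ → ℕ → ℕ → ℕ
  | 0, _, n => if n = 0 then 1 else 0
  | k + 1, m, n => ∑ c ∈ Finset.Icc l m, if c ≤ n then Nl l t k (t * c) (n - c) else 0

lemma Nl_eq_zero (l t : ℕ) (hl : 1 ≤ l) : ∀ k m n, n < k → Nl l t k m n = 0 := by
  intro k
  induction k with
  | zero => intro m n h; omega
  | succ k ih =>
    intro m n h
    rw [Nl]
    apply Finset.sum_eq_zero
    intro c hc
    rw [Finset.mem_Icc] at hc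
    split_ifs with h1
    · apply ih; omega
    · rfl

/-- the list predicate underlying canonical forests -/
def LV (t m : ℕ) (L : List ℕ) : Prop :=
  (∀ c ∈ L, 0 < c) ∧ (∀ c ∈ L.head?, c ≤ m) ∧ L.IsChain fun a b => b ≤ t * a

lemma LV_nil (t m : ℕ) : LV t m [] := by simp [LV]

lemma LV_cons (t m c : ℕ) (L : List ℕ) :
    LV t m (c :: L) ↔ (1 ≤ c ∧ c ≤ m) ∧ LV t (t * c) L := by
  unfold LV
  cases L with
  | nil => simp; omega
  | cons d L =>
    simp [List.isChain_cons_cons]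
    constructor
    · rintro ⟨⟨h1, h2, h3⟩, h4, h5, h6⟩
      exact ⟨⟨h1, h4⟩, ⟨h2, h3⟩, h5, h6⟩
    · rintro ⟨⟨h1, h4⟩, ⟨h2, h3⟩, h5, h6⟩
      exact ⟨⟨h1, h2, h3⟩, h4, h5, h6⟩

/-- the finite set of lists of length `k` -/
def LS (t : ℕ) : ℕ → ℕ → ℕ → Finset (List ℕ)
  | 0, _, n => if n = 0 then {[]} else ∅
  | k + 1, m, n => (Finset.Icc 1 m).biUnion fun c =>
      if c ≤ n then (LS t k (t * c) (n - c)).image (List.cons c) else ∅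

lemma mem_LS (t : ℕ) : ∀ k m n L, L ∈ LS t k m n ↔ LV t m L ∧ L.sum = n ∧ L.length = k := by
  intro k
  induction k with
  | zero =>
    intro m n L
    rw [LS]
    split_ifs with h
    · subst h
      constructor
      · intro hL
        rw [Finset.mem_singleton] at hL
        subst hL
        simp [LV_nil]
      · rintro ⟨-, -, h⟩
        simpa using h
    · constructor
      · intro h; simp at h
      · rintro ⟨-, h1, h2⟩
        have : L = [] := by simpa using h2
        subst this
        simp at h1; omega
  | succ k ih =>
    intro m n L
    rw [LS, Finset.mem_biUnion]
    constructor
    · rintro ⟨c, hc, hL⟩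
      split_ifs at hL with h
      · rw [Finset.mem_image] at hL
        obtain ⟨L', hL', rfl⟩ := hL
        rw [ih] at hL'
        rw [Finset.mem_Icc] at hc
        obtain ⟨h1, h2, h3⟩ := hL'
        refine ⟨(LV_cons _ _ _ _).2 ⟨hc, h1⟩, ?_, ?_⟩
        · simp; omega
        · simp [h3]
      · simp at hL
    · rintro ⟨h1, h2, h3⟩
      cases L with
      | nil => simp at h3
      | cons c L =>
        rw [LV_cons] at h1
        simp at h2 h3
        refine ⟨c, Finset.mem_Icc.2 h1.1, ?_⟩
        rw [if_pos (by omega), Finset.mem_image]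
        exact ⟨L, (ih _ _ _).2 ⟨h1.2, by omega, h3⟩, rfl⟩

lemma card_LS (t : ℕ) : ∀ k m n, (LS t k m n).card = Nl 1 t k m n := by
  intro k
  induction k with
  | zero => intro m n; rw [LS, Nl]; split_ifs <;> simp
  | succ k ih =>
    intro m n
    rw [LS, Nl, Finset.card_biUnion]
    · apply Finset.sum_congr rfl
      intro c hc
      split_ifs with h
      · rw [Finset.card_image_of_injective _ (List.cons_injective), ih]
      · simp
    · intro a _ b _ hab
      rw [Function.onFun, Finset.disjoint_left]
      intro L hL hL'
      split_ifs at hL hL' <;> simp at hL hL'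
      obtain ⟨x, _, rfl⟩ := hL
      obtain ⟨y, _, hy⟩ := hL'
      simp at hy
      exact hab hy.1.symm

/-- all lists of sum `n` -/
def LA (t m n : ℕ) : Finset (List ℕ) := (Finset.range (n + 1)).biUnion fun k => LS t k m n

lemma length_le_sum (L : List ℕ) (h : ∀ c ∈ L, 0 < c) : L.length ≤ L.sum := by
  induction L with
  | nil => simp
  | cons a L ih =>
    have h1 := h a (by simp)
    have := ih (fun c hc => h c (by simp [hc]))
    simp; omega

lemma mem_LA (t m n : ℕ) (L : List ℕ) : L ∈ LA t m n ↔ LV t m L ∧ L.sum = n := by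
  unfold LA
  rw [Finset.mem_biUnion]
  constructor
  · rintro ⟨k, _, hk⟩
    rw [mem_LS] at hk
    exact ⟨hk.1, hk.2.1⟩
  · rintro ⟨h1, h2⟩
    refine ⟨L.length, ?_, (mem_LS _ _ _ _ _).2 ⟨h1, h2, rfl⟩⟩
    have := length_le_sum L h1.1
    rw [Finset.mem_range]; omega

lemma forest_valid {t r : ℕ} (T : CanonicalForest t r) : LV t r T.levels :=
  ⟨T.pos, T.head_le, T.chain⟩

/-- the equivalence between trees of a given size and lists -/
def forestEquiv (t r n : ℕ) : {T : CanonicalForest t r // T.size = n} ≃ LA t r n where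
  toFun T := ⟨T.1.levels, (mem_LA _ _ _ _).2 ⟨forest_valid T.1, T.2⟩⟩
  invFun L := ⟨⟨L.1, ((mem_LA _ _ _ _).1 L.2).1.1, ((mem_LA _ _ _ _).1 L.2).1.2.1,
    ((mem_LA _ _ _ _).1 L.2).1.2.2⟩, ((mem_LA _ _ _ _).1 L.2).2⟩
  left_inv T := rfl
  right_inv L := rfl

lemma sum_LA {M : Type*} [AddCommMonoid M] (t m n : ℕ) (f : ℕ → M) :
    ∑ L ∈ LA t m n, f L.length = ∑ k ∈ Finset.range (n + 1), Nl 1 t k m n • f k := by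
  unfold LA
  rw [Finset.sum_biUnion]
  · apply Finset.sum_congr rfl
    intro k _
    rw [← card_LS, ← Finset.sum_const]
    apply Finset.sum_congr rfl
    intro L hL
    rw [((mem_LS _ _ _ _ _).1 hL).2.2]
  · intro a _ b _ hab
    rw [Function.onFun, Finset.disjoint_left]
    intro L hL hL'
    rw [mem_LS] at hL hL'
    exact hab (hL.2.2.symm.trans hL'.2.2)

lemma forestCount_eq (t r n : ℕ) :
    forestCount t r n = ∑ k ∈ Finset.range (n + 1), Nl 1 t k r n := by
  unfold forestCount
  rw [Nat.card_congr (forestEquiv t r n)]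
  rw [Nat.card_eq_fintype_card, Fintype.card_coe, Finset.card_eq_sum_ones]
  have := sum_LA t r n (fun _ => 1)
  simpa using this

lemma forestExp_eq (t r n : ℕ) (f : ℕ → ℝ) :
    forestExp t r n (fun T => f T.height) =
      (∑ k ∈ Finset.range (n + 1), (Nl 1 t k r n : ℝ) * f k) / forestCount t r n := by
  unfold forestExp
  congr 1
  have h := sum_LA t r n f
  simp only [nsmul_eq_mul] at h
  rw [← h, ← Finset.sum_coe_sort, ← finsum_eq_sum_of_fintype]
  rw [← finsum_comp_equiv (forestEquiv t r n)]
  rfl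

open Classical in
lemma forestProb_eq (t r n : ℕ) (S : Set ℕ) :
    forestProb t r n {T | T.height ∈ S} =
      (∑ k ∈ Finset.range (n + 1), if k ∈ S then (Nl 1 t k r n : ℝ) else 0) /
        forestCount t r n := by
  unfold forestProb
  congr 1
  have e : {T : CanonicalForest t r // T.size = n ∧ T ∈ {T : CanonicalForest t r | T.height ∈ S}} ≃
      ((LA t r n).filter fun L => L.length ∈ S) := by
    refine ⟨fun T => ⟨T.1.levels, Finset.mem_filter.2 ⟨(mem_LA _ _ _ _).2
      ⟨forest_valid T.1, T.2.1⟩, T.2.2⟩⟩, fun L =>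
      ⟨⟨L.1, ((mem_LA _ _ _ _).1 (Finset.mem_filter.1 L.2).1).1.1,
        ((mem_LA _ _ _ _).1 (Finset.mem_filter.1 L.2).1).1.2.1,
        ((mem_LA _ _ _ _).1 (Finset.mem_filter.1 L.2).1).1.2.2⟩,
        ((mem_LA _ _ _ _).1 (Finset.mem_filter.1 L.2).1).2, (Finset.mem_filter.1 L.2).2⟩,
      fun T => rfl, fun L => rfl⟩
  rw [Nat.card_congr e, Nat.card_eq_fintype_card, Fintype.card_coe, Finset.card_filter]
  push_cast
  have h := sum_LA t r n (fun k => if k ∈ S then (1 : ℝ) else 0)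
  rw [h]
  apply Finset.sum_congr rfl
  intro k _
  split_ifs <;> simp

lemma Nl_one_pos (t : ℕ) (ht : 1 ≤ t) : ∀ n m, 1 ≤ m → 0 < Nl 1 t n m n := by
  intro n
  induction n with
  | zero => intro m _; simp [Nl]
  | succ n ih =>
    intro m hm
    rw [Nl]
    apply Finset.sum_pos'
    · intro i _; omega
    · refine ⟨1, by simp [hm], ?_⟩
      rw [if_pos (by omega)]
      exact ih _ (by omega)

/-- generating polynomial in `w` -/
def Pw (l t m n : ℕ) (w : ℂ) : ℂ := ∑ k ∈ Finset.range (n + 1), (Nl l t k m n : ℂ) * w ^ k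

lemma Pw_zero (l t m : ℕ) (w : ℂ) : Pw l t m 0 w = 1 := by
  simp [Pw, Nl]

lemma Pw_succ (l t m n : ℕ) (hl : 1 ≤ l) (hn : 1 ≤ n) (w : ℂ) :
    Pw l t m n w =
      w * ∑ c ∈ Finset.Icc l m, if c ≤ n then Pw l t (t * c) (n - c) w else 0 := by
  unfold Pw
  rw [Finset.sum_range_succ']
  simp only [Nl, Nat.cast_sum, pow_succ]
  rw [if_neg (by omega)]
  simp only [Nat.cast_zero, zero_mul, add_zero]
  simp_rw [Finset.sum_mul]
  rw [Finset.sum_comm, Finset.mul_sum]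
  apply Finset.sum_congr rfl
  intro c hc
  rw [Finset.mem_Icc] at hc
  split_ifs with h
  · rw [Finset.mul_sum]
    have hsub : Finset.range (n - c + 1) ⊆ Finset.range n := by
      apply Finset.range_subset_range.2; omega
    rw [← Finset.sum_subset hsub]
    · apply Finset.sum_congr rfl
      intro k _
      ring
    · intro k _ hk
      rw [Finset.mem_range] at hk
      rw [Nl_eq_zero l t hl k _ _ (by omega)]
      simp
  · simp

lemma norm_Pw_le (l t m n : ℕ) (w : ℂ) (hw : ‖w‖ = 1) :
    ‖Pw l t m n w‖ ≤ ∑ k ∈ Finset.range (n + 1), (Nl l t k m n : ℝ) := by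
  unfold Pw
  refine (norm_sum_le _ _).trans (Finset.sum_le_sum fun k _ => ?_)
  simp [hw]

lemma Pw_one (l t m n : ℕ) :
    Pw l t m n 1 = ((∑ k ∈ Finset.range (n + 1), (Nl l t k m n : ℝ) : ℝ) : ℂ) := by
  unfold Pw
  simp

/-- A class of two variable series `∑ w^j β_j(q)`, `|q| < R`, entire in `w`. -/
def SC (β : ℕ → ℂ → ℂ) (R : ℝ) : Prop :=
  ∃ C : ℕ → ℝ, (∀ j, DifferentiableOn ℂ (β j) (Metric.ball 0 R)) ∧
    (∀ j, ∀ q ∈ Metric.ball (0 : ℂ) R, ‖β j q‖ ≤ C j) ∧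
    (∀ j, 0 ≤ C j) ∧ ∀ M : ℝ, 0 ≤ M → Summable fun j => C j * M ^ j

def SF (β : ℕ → ℂ → ℂ) (w q : ℂ) : ℂ := ∑' j, w ^ j * β j q

/-- shift for the `w` derivative -/
def dW (β : ℕ → ℂ → ℂ) : ℕ → ℂ → ℂ := fun j q => ((j : ℂ) + 1) * β (j + 1) q

def dQ (β : ℕ → ℂ → ℂ) : ℕ → ℂ → ℂ := fun j q => deriv (β j) q

lemma SC.summable {β : ℕ → ℂ → ℂ} {R : ℝ} (h : SC β R) (w : ℂ) {q : ℂ}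
    (hq : q ∈ Metric.ball (0 : ℂ) R) : Summable fun j => w ^ j * β j q := by
  obtain ⟨C, _, h2, h3, h4⟩ := h
  refine Summable.of_norm_bounded (h4 ‖w‖ (norm_nonneg _)) fun j => ?_
  rw [norm_mul, norm_pow, mul_comm]
  exact mul_le_mul_of_nonneg_right (h2 j q hq) (by positivity)

lemma SC.mono {β : ℕ → ℂ → ℂ} {R R' : ℝ} (h : SC β R) (hR : R' ≤ R) : SC β R' := by
  obtain ⟨C, h1, h2, h3, h4⟩ := h
  exact ⟨C, fun j => (h1 j).mono (Metric.ball_subset_ball hR),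
    fun j q hq => h2 j q (Metric.ball_subset_ball hR hq), h3, h4⟩

lemma SC.dW {β : ℕ → ℂ → ℂ} {R : ℝ} (h : SC β R) : SC (dW β) R := by
  obtain ⟨C, h1, h2, h3, h4⟩ := h
  refine ⟨fun j => (j + 1) * C (j + 1), fun j => ?_, fun j q hq => ?_, fun j => ?_, fun M hM => ?_⟩
  · exact (h1 (j + 1)).const_mul _
  · unfold _root_.dW
    rw [norm_mul]
    have : ‖(j : ℂ) + 1‖ = j + 1 := by
      have : ((j : ℂ) + 1) = ((j + 1 : ℕ) : ℂ) := by push_cast; rfl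
      rw [this, Complex.norm_natCast]; push_cast; rfl
    rw [this]
    exact mul_le_mul_of_nonneg_left (h2 _ _ hq) (by positivity)
  · exact mul_nonneg (by positivity) (h3 _)
  · have := (summable_nat_add_iff 1).2 (h4 (2 * (M + 1)) (by positivity))
    refine Summable.of_nonneg_of_le (fun j => mul_nonneg (mul_nonneg (by positivity) (h3 _))
      (by positivity)) (fun j => ?_) this
    have a1 : ((j : ℝ) + 1) ≤ 2 ^ (j + 1) := by
      have := (Nat.lt_two_pow_self (n := j + 1)).le
      exact_mod_cast this
    have a2 : M ^ j ≤ (M + 1) ^ (j + 1) := by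
      calc M ^ j ≤ (M + 1) ^ j := by gcongr; linarith
        _ ≤ (M + 1) ^ (j + 1) := by apply pow_le_pow_right₀ <;> linarith
    rw [mul_pow]
    have := mul_le_mul a1 a2 (by positivity) (by positivity)
    nlinarith [h3 (j + 1)]

lemma SC.dQ {β : ℕ → ℂ → ℂ} {R R' : ℝ} (h : SC β R) (hR : R' < R) : SC (dQ β) R' := by
  obtain ⟨C, h1, h2, h3, h4⟩ := h
  have hd : 0 < R - R' := by linarith
  refine ⟨fun j => C j / ((R - R') / 2), fun j => ?_, fun j q hq => ?_, fun j => ?_, fun M hM => ?_⟩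
  · exact ((h1 j).deriv Metric.isOpen_ball).mono (Metric.ball_subset_ball hR.le)
  · have hsub : Metric.closedBall q ((R - R') / 2) ⊆ Metric.ball 0 R := by
      intro z hz
      rw [Metric.mem_closedBall, dist_eq_norm] at hz
      rw [mem_ball_zero_iff] at hq ⊢
      have : ‖z‖ ≤ ‖z - q‖ + ‖q‖ := by simpa using norm_add_le (z - q) q
      linarith
    apply Complex.norm_deriv_le_of_forall_mem_sphere_norm_le (by linarith)
    · apply DifferentiableOn.diffContOnCl
      rw [closure_ball _ (by linarith)]
      exact (h1 j).mono hsub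
    · intro z hz
      exact h2 j z (hsub (Metric.sphere_subset_closedBall hz))
  · exact div_nonneg (h3 j) (by linarith)
  · have := (h4 M hM).div_const ((R - R') / 2)
    refine this.congr fun j => ?_
    ring

lemma norm_fst_snd_le (a b : ℂ) :
    ‖a • ContinuousLinearMap.fst ℂ ℂ ℂ + b • ContinuousLinearMap.snd ℂ ℂ ℂ‖ ≤ ‖a‖ + ‖b‖ := by
  refine (norm_add_le _ _).trans (add_le_add ?_ ?_)
  · rw [norm_smul]
    exact mul_le_of_le_one_right (norm_nonneg _) (ContinuousLinearMap.norm_fst_le ..)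
  · rw [norm_smul]
    exact mul_le_of_le_one_right (norm_nonneg _) (ContinuousLinearMap.norm_snd_le ..)

lemma SC.hasFDerivAt {β : ℕ → ℂ → ℂ} {R : ℝ} (h : SC β R) {w q : ℂ}
    (hq : q ∈ Metric.ball (0 : ℂ) R) :
    HasFDerivAt (fun x : ℂ × ℂ => SF β x.1 x.2)
      (SF (_root_.dW β) w q • ContinuousLinearMap.fst ℂ ℂ ℂ +
        SF (_root_.dQ β) w q • ContinuousLinearMap.snd ℂ ℂ ℂ) (w, q) := by
  have hq' := hq
  rw [mem_ball_zero_iff] at hq'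
  obtain ⟨R', hR1, hR2⟩ := exists_between hq'
  have hqR' : q ∈ Metric.ball (0 : ℂ) R' := by rwa [mem_ball_zero_iff]
  have hW := h.dW
  have hQ := h.dQ hR2
  obtain ⟨CW, -, w2, w3, w4⟩ := hW
  obtain ⟨CQ, -, q2, q3, q4⟩ := hQ
  set M := ‖w‖ + 1 with hM
  have hM0 : 0 ≤ M := by positivity
  have hM1 : 1 ≤ M := by rw [hM]; linarith [norm_nonneg w]
  set s : Set (ℂ × ℂ) := Metric.ball 0 M ×ˢ Metric.ball 0 R' with hs
  have hso : IsOpen s := Metric.isOpen_ball.prod Metric.isOpen_ball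
  have hsp : IsPreconnected s :=
    ((convex_ball _ _).isPreconnected).prod ((convex_ball _ _).isPreconnected)
  have hmem : (w, q) ∈ s := ⟨by rw [mem_ball_zero_iff]; linarith, hqR'⟩
  have hws : Summable fun j : ℕ => (if j = 0 then 0 else CW (j - 1) * M ^ (j - 1)) + CQ j * M ^ j := by
    refine Summable.add ?_ (q4 M hM0)
    rw [← summable_nat_add_iff 1]
    simpa using w4 M hM0
  have key := hasFDerivAt_tsum_of_isPreconnected (𝕜 := ℂ) (f := fun j (x : ℂ × ℂ) => x.1 ^ j * β j x.2)
    (f' := fun j x => ((j : ℂ) * x.1 ^ (j - 1) * β j x.2) • ContinuousLinearMap.fst ℂ ℂ ℂ +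
      (x.1 ^ j * deriv (β j) x.2) • ContinuousLinearMap.snd ℂ ℂ ℂ) (s := s) hws hso hsp
    (fun j x hx => ?_) (fun j x hx => ?_) hmem (h.summable w hq) hmem
  · convert! key using 1
    have hA : Summable fun j : ℕ => ((j : ℂ) * w ^ (j - 1) * β j q) := by
      rw [← summable_nat_add_iff 1]
      refine (h.dW.summable w hq).congr fun j => ?_
      simp [_root_.dW]; ring
    have hB : Summable fun j : ℕ => w ^ j * deriv (β j) q := (h.dQ hR2).summable w hqR'
    rw [Summable.tsum_add (hA.smul_const _) (hB.smul_const _), hA.tsum_smul_const, hB.tsum_smul_const]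
    congr 2
    unfold SF
    rw [hA.tsum_eq_zero_add]
    simp only [Nat.cast_zero, zero_mul, zero_add]
    congr 1
    ext j
    simp [_root_.dW]; ring
  · have d1 : HasDerivAt (β j) (deriv (β j) x.2) x.2 := by
      obtain ⟨C, h1, -⟩ := h
      have : x.2 ∈ Metric.ball (0 : ℂ) R := Metric.ball_subset_ball hR2.le hx.2
      exact ((h1 j).differentiableAt (Metric.isOpen_ball.mem_nhds this)).hasDerivAt
    have d2 : HasDerivAt (fun z : ℂ => z ^ j) ((j : ℂ) * x.1 ^ (j - 1)) x.1 := hasDerivAt_pow j x.1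
    have e1 := d1.hasFDerivAt.comp x (hasFDerivAt_snd (𝕜 := ℂ))
    have e2 := d2.hasFDerivAt.comp x (hasFDerivAt_fst (𝕜 := ℂ))
    convert! e2.mul e1 using 1
    ext <;> simp <;> ring
  · refine (norm_fst_snd_le _ _).trans (add_le_add ?_ ?_)
    · split_ifs with hj
      · subst hj; simp
      · obtain ⟨i, rfl⟩ := Nat.exists_eq_succ_of_ne_zero hj
        have hx1 : ‖x.1‖ ≤ M := (mem_ball_zero_iff.1 hx.1).le
        have := w2 i x.2 (Metric.ball_subset_ball hR2.le hx.2)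
        simp only [_root_.dW] at this
        rw [Nat.succ_eq_add_one, Nat.add_sub_cancel]
        push_cast
        rw [mul_right_comm, norm_mul, norm_pow]
        exact mul_le_mul this (by gcongr) (by positivity) (w3 i)
    · have hx1 : ‖x.1‖ ≤ M := (mem_ball_zero_iff.1 hx.1).le
      have := q2 j x.2 hx.2
      simp only [_root_.dQ] at this
      rw [mul_comm, norm_mul, norm_pow]
      exact mul_le_mul this (by gcongr) (by positivity) (q3 j)

lemma SC.continuousAt {β : ℕ → ℂ → ℂ} {R : ℝ} (h : SC β R) {w q : ℂ}
    (hq : q ∈ Metric.ball (0 : ℂ) R) : ContinuousAt (fun x : ℂ × ℂ => SF β x.1 x.2) (w, q) :=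
  (h.hasFDerivAt hq).continuousAt

lemma SC.contDiffAt {β : ℕ → ℂ → ℂ} {R : ℝ} (h : SC β R) {w q : ℂ}
    (hq : q ∈ Metric.ball (0 : ℂ) R) : ContDiffAt ℂ 1 (fun x : ℂ × ℂ => SF β x.1 x.2) (w, q) := by
  have hq' := hq
  rw [mem_ball_zero_iff] at hq'
  obtain ⟨R', hR1, hR2⟩ := exists_between hq'
  rw [contDiffAt_one_iff]
  refine ⟨fun x => SF (_root_.dW β) x.1 x.2 • ContinuousLinearMap.fst ℂ ℂ ℂ +
        SF (_root_.dQ β) x.1 x.2 • ContinuousLinearMap.snd ℂ ℂ ℂ, Set.univ ×ˢ Metric.ball 0 R', ?_, ?_, ?_⟩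
  · exact (isOpen_univ.prod Metric.isOpen_ball).mem_nhds ⟨trivial, by rwa [mem_ball_zero_iff]⟩
  · intro x hx
    apply ContinuousAt.continuousWithinAt
    apply ContinuousAt.add
    · exact (h.dW.continuousAt (w := x.1) (q := x.2)
        (Metric.ball_subset_ball hR2.le hx.2)).smul continuousAt_const
    · exact ((h.dQ hR2).continuousAt (w := x.1) (q := x.2) hx.2).smul continuousAt_const
  · intro x hx
    exact h.hasFDerivAt (w := x.1) (q := x.2) (Metric.ball_subset_ball hR2.le hx.2)

/-- chain rule along a curve -/
lemma SC.hasDerivAt_comp {β : ℕ → ℂ → ℂ} {R : ℝ} (h : SC β R) {W Q : ℂ → ℂ} {W' Q' s : ℂ}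
    (hq : Q s ∈ Metric.ball (0 : ℂ) R) (hW : HasDerivAt W W' s) (hQ : HasDerivAt Q Q' s) :
    HasDerivAt (fun s => SF β (W s) (Q s))
      (SF (_root_.dW β) (W s) (Q s) * W' + SF (_root_.dQ β) (W s) (Q s) * Q') s := by
  have := (h.hasFDerivAt (w := W s) hq).comp_hasDerivAt s (hW.prodMk hQ)
  convert! this using 1

lemma SC.hasDerivAt_q {β : ℕ → ℂ → ℂ} {R : ℝ} (h : SC β R) {w q : ℂ}
    (hq : q ∈ Metric.ball (0 : ℂ) R) :
    HasDerivAt (fun q => SF β w q) (SF (_root_.dQ β) w q) q := by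
  have := h.hasDerivAt_comp (W := fun _ => w) (Q := fun q => q) (s := q) hq
    (hasDerivAt_const _ _) (hasDerivAt_id' _)
  simpa using this

lemma SC.hasDerivAt_w {β : ℕ → ℂ → ℂ} {R : ℝ} (h : SC β R) {w q : ℂ}
    (hq : q ∈ Metric.ball (0 : ℂ) R) :
    HasDerivAt (fun w => SF β w q) (SF (_root_.dW β) w q) w := by
  have := h.hasDerivAt_comp (W := fun w => w) (Q := fun _ => q) (s := w) hq
    (hasDerivAt_id' _) (hasDerivAt_const _ _)
  simpa using this

lemma hp_zero (t : ℕ) : hp t 0 = 0 := by simp [hp]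

lemma hp_succ (t j : ℕ) : hp t (j + 1) = 1 + t * hp t j := by
  unfold hp
  rw [Finset.sum_range_succ', Finset.mul_sum, add_comm]
  simp [pow_succ, mul_comm]

lemma hp_one (t : ℕ) : hp t 1 = 1 := by simp [hp]

lemma hp_two (t : ℕ) : hp t 2 = 1 + t := by rw [hp_succ, hp_one]; ring

lemma hp_three (t : ℕ) : hp t 3 = 1 + t + t ^ 2 := by rw [hp_succ, hp_two]; ring

lemma hp_ge (t : ℕ) (ht : 1 ≤ t) (j : ℕ) : j ≤ hp t j := by
  induction j with
  | zero => simp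
  | succ j ih => rw [hp_succ]; nlinarith

lemma hp_mono (t : ℕ) {i j : ℕ} (h : i ≤ j) : hp t i ≤ hp t j := by
  unfold hp
  exact Finset.sum_le_sum_of_subset (Finset.range_subset_range.2 h)

/-- `q^{h_i}/(1-q^{h_i})` -/
def phi (t i : ℕ) (q : ℂ) : ℂ := q ^ hp t i / (1 - q ^ hp t i)

def PP (t j : ℕ) (q : ℂ) : ℂ := ∏ i ∈ Finset.range j, phi t (i + 1) q

def bet (t m j : ℕ) (q : ℂ) : ℂ := (-1) ^ j * q ^ (m * hp t j) * PP t j q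

/-- the series `a` for forests with `m` roots; `1 - b` is the case `m = 0` -/
def aS (t m : ℕ) (w q : ℂ) : ℂ := SF (bet t m) w q

lemma one_sub_pow_ne {q : ℂ} (hq : ‖q‖ < 1) {n : ℕ} (hn : 1 ≤ n) : 1 - q ^ n ≠ 0 := by
  intro h
  have h1 : q ^ n = 1 := by linear_combination -h
  have h2 : ‖q‖ ^ n = 1 := by rw [← norm_pow, h1, norm_one]
  have h3 : ‖q‖ ^ n < 1 := pow_lt_one₀ (norm_nonneg _) hq (by omega)
  linarith

lemma norm_phi_le {t i k : ℕ} {r : ℝ} {q : ℂ} (hr : r < 1) (hq : ‖q‖ ≤ r) (hk : 1 ≤ k)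
    (hki : k ≤ hp t i) : ‖phi t i q‖ ≤ r ^ k / (1 - r ^ k) := by
  have hr0 : 0 ≤ r := (norm_nonneg _).trans hq
  have h1 : ‖q ^ hp t i‖ ≤ r ^ k := by
    rw [norm_pow]
    calc ‖q‖ ^ hp t i ≤ r ^ hp t i := by gcongr
      _ ≤ r ^ k := pow_le_pow_of_le_one hr0 hr.le hki
  have h2 : r ^ k < 1 := pow_lt_one₀ hr0 hr (by omega)
  have h3 : 1 - r ^ k ≤ ‖1 - q ^ hp t i‖ := by
    have := norm_sub_norm_le (1 : ℂ) (q ^ hp t i)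
    rw [norm_one] at this
    linarith
  unfold phi
  rw [norm_div]
  exact div_le_div₀ (by positivity) h1 (by linarith) h3

lemma phi_diffOn (t i : ℕ) (ht : 1 ≤ t) (hi : 1 ≤ i) {R : ℝ} (hR : R ≤ 1) :
    DifferentiableOn ℂ (phi t i) (Metric.ball 0 R) := by
  unfold phi
  have : 1 ≤ hp t i := hi.trans (hp_ge t ht i)
  apply DifferentiableOn.div (by fun_prop) (by fun_prop)
  intro q hq
  rw [mem_ball_zero_iff] at hq
  exact one_sub_pow_ne (hq.trans_le hR) this

lemma phiR_tendsto {R : ℝ} (h0 : 0 ≤ R) (h1 : R < 1) :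
    Tendsto (fun n : ℕ => R ^ n / (1 - R ^ n)) atTop (nhds 0) := by
  have := tendsto_pow_atTop_nhds_zero_of_lt_one h0 h1
  have h2 : Tendsto (fun n : ℕ => R ^ n / (1 - R ^ n)) atTop (nhds (0 / (1 - 0))) :=
    this.div (tendsto_const_nhds.sub this) (by norm_num : (1 : ℝ) - 0 ≠ 0)
  rwa [zero_div] at h2

lemma summable_prod {R : ℝ} (h0 : 0 < R) (h1 : R < 1) (k : ℕ) (hk : 1 ≤ k) (M : ℝ) (hM : 0 ≤ M) :
    Summable fun j : ℕ => (∏ i ∈ Finset.range j, R ^ (i + k) / (1 - R ^ (i + k))) * M ^ j := by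
  rcases hM.eq_or_lt with rfl | hM
  · apply summable_of_ne_finset_zero (s := {0})
    intro j hj
    rw [zero_pow (by simpa using hj), mul_zero]
  have hpos : ∀ n : ℕ, 1 ≤ n → 0 < R ^ n / (1 - R ^ n) := by
    intro n hn
    have : R ^ n < 1 := pow_lt_one₀ h0.le h1 (by omega)
    exact div_pos (by positivity) (by linarith)
  have hne : ∀ j : ℕ, (∏ i ∈ Finset.range j, R ^ (i + k) / (1 - R ^ (i + k))) * M ^ j ≠ 0 := by
    intro j
    have : 0 < ∏ i ∈ Finset.range j, R ^ (i + k) / (1 - R ^ (i + k)) :=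
      Finset.prod_pos fun i _ => hpos _ (by omega)
    positivity
  apply summable_of_ratio_test_tendsto_lt_one (l := 0) (by norm_num)
  · exact Eventually.of_forall hne
  · have : Tendsto (fun j : ℕ => R ^ (j + k) / (1 - R ^ (j + k)) * M) atTop (nhds 0) := by
      have := ((phiR_tendsto h0.le h1).comp (tendsto_add_atTop_nat k)).mul_const M
      simpa using this
    refine this.congr fun j => ?_
    have hj := hne j
    rw [← norm_div, Finset.prod_range_succ, pow_succ]
    have : ∀ A x B : ℝ, A * B ≠ 0 → A * x * (B * M) / (A * B) = x * M := by
      intro A x B hAB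
      have := left_ne_zero_of_mul hAB
      have := right_ne_zero_of_mul hAB
      field_simp
    rw [this _ _ _ hj, Real.norm_eq_abs, abs_of_nonneg]
    exact mul_nonneg (hpos _ (by omega)).le hM.le

lemma SC_bet (t m : ℕ) (ht : 1 ≤ t) {R : ℝ} (h0 : 0 < R) (h1 : R < 1) : SC (bet t m) R := by
  refine ⟨fun j => ∏ i ∈ Finset.range j, R ^ (i + 1) / (1 - R ^ (i + 1)), fun j => ?_,
    fun j q hq => ?_, fun j => ?_, summable_prod h0 h1 1 le_rfl⟩
  · unfold bet PP
    apply DifferentiableOn.mul (by fun_prop)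
    apply DifferentiableOn.fun_finsetProd
    intro i _
    exact phi_diffOn t (i + 1) ht (by omega) h1.le
  · rw [mem_ball_zero_iff] at hq
    unfold bet PP
    rw [norm_mul, norm_mul, norm_pow, norm_neg, norm_one, one_pow, one_mul, norm_prod, norm_pow]
    have e1 : ‖q‖ ^ (m * hp t j) ≤ 1 := pow_le_one₀ (norm_nonneg _) (hq.le.trans h1.le)
    refine (mul_le_of_le_one_left (Finset.prod_nonneg fun i _ => norm_nonneg _) e1).trans ?_
    apply Finset.prod_le_prod (fun i _ => norm_nonneg _)
    intro i _
    exact norm_phi_le h1 hq.le (by omega) (hp_ge t ht _)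
  · apply Finset.prod_nonneg
    intro i _
    have : R ^ (i + 1) < 1 := pow_lt_one₀ h0.le h1 (by omega)
    exact div_nonneg (by positivity) (by linarith)

lemma aS_succ (t m : ℕ) (ht : 1 ≤ t) (w q : ℂ) (hq : ‖q‖ < 1) :
    aS t (m + 1) w q = aS t m w q + w * q ^ (m + 1) * aS t (t * (m + 1)) w q := by
  obtain ⟨R, hR1, hR2⟩ := exists_between hq
  have hR0 : 0 < R := (norm_nonneg _).trans_lt hR1
  have hqm : q ∈ Metric.ball (0 : ℂ) R := by rwa [mem_ball_zero_iff]
  have s1 := (SC_bet t (m + 1) ht hR0 hR2).summable w hqm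
  have s2 := (SC_bet t m ht hR0 hR2).summable w hqm
  have s3 := (SC_bet t (t * (m + 1)) ht hR0 hR2).summable w hqm
  unfold aS SF
  rw [s1.tsum_eq_zero_add, s2.tsum_eq_zero_add, ← tsum_mul_left, add_assoc,
    ← Summable.tsum_add ((summable_nat_add_iff 1).2 s2) (s3.mul_left _)]
  have e0 : w ^ 0 * bet t (m + 1) 0 q = w ^ 0 * bet t m 0 q := by simp [bet, hp_zero]
  rw [e0]
  refine congrArg _ ?_
  · apply tsum_congr
    intro j
    unfold bet PP
    rw [Finset.prod_range_succ]
    have hne := one_sub_pow_ne hq (n := hp t (j + 1)) (by rw [hp_succ]; omega)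
    have hh : q ^ ((m + 1) * hp t (j + 1)) = q ^ (m * hp t (j + 1)) * q ^ hp t (j + 1) := by
      rw [← pow_add]; ring_nf
    have hh2 : q ^ (t * (m + 1) * hp t j) * q ^ (m + 1) = q ^ ((m + 1) * hp t (j + 1)) := by
      rw [← pow_add, hp_succ]; ring_nf
    have e : (phi t (j + 1) q) * (1 - q ^ hp t (j + 1)) = q ^ hp t (j + 1) := by
      unfold phi; field_simp
    generalize (∏ i ∈ Finset.range j, phi t (i + 1) q) = X at *
    generalize phi t (j + 1) q = f at *
    rw [hh] at hh2 ⊢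
    have : w ^ (j + 1) * ((-1) ^ j * (q ^ (t * (m + 1) * hp t j) * q ^ (m + 1)) * X)
      = w * q ^ (m + 1) * (w ^ j * ((-1) ^ j * q ^ (t * (m + 1) * hp t j) * X)) := by ring
    rw [← this, hh2]
    rw [pow_succ (-1 : ℂ) j]
    linear_combination (w ^ (j + 1) * (-1) ^ j * q ^ (m * hp t (j + 1)) * X) * e

lemma aS_sum (t m l : ℕ) (ht : 1 ≤ t) (hl : 1 ≤ l) (hm : l - 1 ≤ m) (w q : ℂ) (hq : ‖q‖ < 1) :
    aS t m w q = aS t (l - 1) w q + w * ∑ c ∈ Finset.Icc l m, q ^ c * aS t (t * c) w q := by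
  obtain ⟨l, rfl⟩ : ∃ k, l = k + 1 := ⟨l - 1, by omega⟩
  simp only [Nat.add_sub_cancel] at *
  induction m, hm using Nat.le_induction with
  | base => simp
  | succ m hm ih =>
    rw [aS_succ t m ht w q hq, ih, Finset.sum_Icc_succ_top (by omega)]
    ring

/-- Taylor coefficient at `0` -/
def coef (f : ℂ → ℂ) (n : ℕ) : ℂ := iteratedDeriv n f 0 / (n.factorial : ℂ)

lemma coef_pow_mul {f : ℂ → ℂ} (hf : AnalyticAt ℂ f 0) (c n : ℕ) :
    coef (fun q => q ^ c * f q) n = if c ≤ n then coef f (n - c) else 0 := by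
  unfold coef
  have h1 : ContDiffAt ℂ n f 0 := hf.contDiffAt
  have h2 : ContDiffAt ℂ n (fun q : ℂ => q ^ c) 0 := by fun_prop
  have := iteratedDeriv_mul h2 h1
  have e : ((fun q : ℂ => q ^ c) * f) = fun q => q ^ c * f q := rfl
  rw [e] at this
  rw [this]
  simp only [iteratedDeriv_fun_pow_zero]
  split_ifs with h
  · rw [Finset.sum_eq_single c]
    · simp
      have h3 := Nat.choose_mul_factorial_mul_factorial h
      have h4 : (n.factorial : ℂ) = n.choose c * c.factorial * (n - c).factorial := by
        rw [← h3]; push_cast; ring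
      have h5 : (n.factorial : ℂ) ≠ 0 := by exact_mod_cast n.factorial_ne_zero
      have h6 : ((n - c).factorial : ℂ) ≠ 0 := by exact_mod_cast (n - c).factorial_ne_zero
      rw [div_eq_div_iff h5 h6, h4]; ring
    · intro b _ hb
      simp [hb]
    · intro hc
      simp at hc; omega
  · rw [Finset.sum_eq_zero, zero_div]
    intro b hb
    rw [Finset.mem_range] at hb
    have : b ≠ c := by omega
    simp [this]

lemma coef_add {f g : ℂ → ℂ} (hf : AnalyticAt ℂ f 0) (hg : AnalyticAt ℂ g 0) (n : ℕ) :
    coef (fun q => f q + g q) n = coef f n + coef g n := by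
  unfold coef
  have h1 : ContDiffAt ℂ n f 0 := hf.contDiffAt
  have h2 : ContDiffAt ℂ n g 0 := hg.contDiffAt
  have := iteratedDeriv_add h1 h2
  rw [show (fun q => f q + g q) = f + g from rfl, this, add_div]

lemma coef_const_mul {f : ℂ → ℂ} (c : ℂ) (n : ℕ) :
    coef (fun q => c * f q) n = c * coef f n := by
  unfold coef
  rw [iteratedDeriv_const_mul_field, mul_div_assoc]

lemma coef_sum {ι : Type*} (s : Finset ι) {f : ι → ℂ → ℂ} (hf : ∀ i ∈ s, AnalyticAt ℂ (f i) 0)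
    (n : ℕ) : coef (fun q => ∑ i ∈ s, f i q) n = ∑ i ∈ s, coef (f i) n := by
  unfold coef
  rw [iteratedDeriv_fun_sum (fun i hi => (hf i hi).contDiffAt), Finset.sum_div]

lemma coef_congr {f g : ℂ → ℂ} (h : f =ᶠ[nhds 0] g) (n : ℕ) : coef f n = coef g n := by
  unfold coef
  rw [h.iteratedDeriv_eq]

lemma coef_one (n : ℕ) : coef (fun _ => 1) n = if n = 0 then 1 else 0 := by
  unfold coef
  rw [iteratedDeriv_const]
  split_ifs with h
  · simp [h]
  · simp

lemma coef_bound {f : ℂ → ℂ} {r M : ℝ} (hr : 0 < r) (hf : DifferentiableOn ℂ f (Metric.closedBall 0 r))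
    (hM : ∀ z ∈ Metric.sphere (0 : ℂ) r, ‖f z‖ ≤ M) (n : ℕ) : ‖coef f n‖ ≤ M / r ^ n := by
  unfold coef
  have h1 : DiffContOnCl ℂ f (Metric.ball 0 r) := by
    apply DifferentiableOn.diffContOnCl
    rwa [closure_ball _ hr.ne']
  have := Complex.norm_iteratedDeriv_le_of_forall_mem_sphere_norm_le n hr h1 hM
  have h5 : (0 : ℝ) < n.factorial := by exact_mod_cast n.factorial_pos
  rw [norm_div, Complex.norm_natCast, div_le_iff₀ h5]
  calc _ ≤ _ := this
    _ = _ := by ring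

lemma coef_hasSum {f : ℂ → ℂ} {r : ℝ} (hf : DifferentiableOn ℂ f (Metric.ball 0 r)) {z : ℂ}
    (hz : z ∈ Metric.ball 0 r) : HasSum (fun n => coef f n * z ^ n) (f z) := by
  have := Complex.hasSum_taylorSeries_on_ball hf hz
  have e : (fun n => coef f n * z ^ n) =
      fun n => ((n.factorial : ℂ))⁻¹ • (z - 0) ^ n • iteratedDeriv n f 0 := by
    funext n
    simp only [coef, smul_eq_mul, sub_zero]; ring
  rw [e]; exact this

lemma aS_at_zero (t m : ℕ) (w : ℂ) : aS t m w 0 = 1 := by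
  unfold aS SF
  rw [tsum_eq_single 0]
  · simp [bet, hp_zero, PP]
  · intro j hj
    obtain ⟨j, rfl⟩ := Nat.exists_eq_succ_of_ne_zero hj
    have : phi t 1 0 = 0 := by simp [phi, hp_one]
    simp [bet, PP, Finset.prod_range_succ', this]

lemma aS_diffAt (t m : ℕ) (ht : 1 ≤ t) (w q : ℂ) (hq : ‖q‖ < 1) :
    DifferentiableAt ℂ (fun q => aS t m w q) q := by
  obtain ⟨R, hR1, hR2⟩ := exists_between hq
  have hR0 : 0 < R := (norm_nonneg _).trans_lt hR1
  have hqm : q ∈ Metric.ball (0 : ℂ) R := by rwa [mem_ball_zero_iff]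
  exact ((SC_bet t m ht hR0 hR2).hasDerivAt_q hqm).differentiableAt

lemma aS_contAt (t m : ℕ) (ht : 1 ≤ t) (w q : ℂ) (hq : ‖q‖ < 1) :
    ContinuousAt (fun x : ℂ × ℂ => aS t m x.1 x.2) (w, q) := by
  obtain ⟨R, hR1, hR2⟩ := exists_between hq
  have hR0 : 0 < R := (norm_nonneg _).trans_lt hR1
  have hqm : q ∈ Metric.ball (0 : ℂ) R := by rwa [mem_ball_zero_iff]
  exact (SC_bet t m ht hR0 hR2).continuousAt hqm

lemma aS_analyticAt (t m : ℕ) (ht : 1 ≤ t) (w q : ℂ) (hq : ‖q‖ < 1) :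
    AnalyticAt ℂ (fun q => aS t m w q) q := by
  have : DifferentiableOn ℂ (fun q => aS t m w q) (Metric.ball 0 1) := by
    intro z hz
    rw [mem_ball_zero_iff] at hz
    exact (aS_diffAt t m ht w z hz).differentiableWithinAt
  exact this.analyticAt (Metric.isOpen_ball.mem_nhds (by rwa [mem_ball_zero_iff]))

lemma aS_div_analyticAt (t m k : ℕ) (ht : 1 ≤ t) (w : ℂ) :
    AnalyticAt ℂ (fun q => aS t m w q / aS t k w q) 0 := by
  apply (aS_analyticAt t m ht w 0 (by simp)).div (aS_analyticAt t k ht w 0 (by simp))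
  rw [aS_at_zero]; exact one_ne_zero

lemma coef_aS_div (t l : ℕ) (ht : 1 ≤ t) (hl : 1 ≤ l) (w : ℂ) : ∀ n m, l - 1 ≤ m →
    coef (fun q => aS t m w q / aS t (l - 1) w q) n = Pw l t m n w := by
  intro n
  induction n using Nat.strong_induction_on with
  | _ n ih =>
  intro m hm
  have hne : ∀ᶠ q in nhds (0 : ℂ), aS t (l - 1) w q ≠ 0 := by
    apply (aS_diffAt t (l - 1) ht w 0 (by simp)).continuousAt.eventually_ne
    rw [aS_at_zero]; exact one_ne_zero
  have hb : ∀ᶠ q in nhds (0 : ℂ), ‖q‖ < 1 := by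
    have := Metric.ball_mem_nhds (0 : ℂ) one_pos
    filter_upwards [this] with q hq
    rwa [mem_ball_zero_iff] at hq
  have e : (fun q => aS t m w q / aS t (l - 1) w q) =ᶠ[nhds 0]
      fun q => 1 + w * ∑ c ∈ Finset.Icc l m, q ^ c * (aS t (t * c) w q / aS t (l - 1) w q) := by
    filter_upwards [hne, hb] with q h1 h2
    rw [aS_sum t m l ht hl hm w q h2, add_div, div_self h1, mul_div_assoc, Finset.sum_div]
    simp only [mul_div_assoc]
  have an : ∀ c, AnalyticAt ℂ (fun q => q ^ c * (aS t (t * c) w q / aS t (l - 1) w q)) 0 :=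
    fun c => (by fun_prop : AnalyticAt ℂ (fun q : ℂ => q ^ c) 0).mul (aS_div_analyticAt t _ _ ht w)
  have an2 : AnalyticAt ℂ (fun q => ∑ c ∈ Finset.Icc l m,
      q ^ c * (aS t (t * c) w q / aS t (l - 1) w q)) 0 := by
    apply Finset.analyticAt_fun_sum
    intro c _
    exact an c
  have an3 : AnalyticAt ℂ (fun q => w * ∑ c ∈ Finset.Icc l m,
      q ^ c * (aS t (t * c) w q / aS t (l - 1) w q)) 0 := analyticAt_const.mul an2
  rw [coef_congr e, coef_add (f := fun _ => 1) analyticAt_const an3, coef_one, coef_const_mul,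
    coef_sum _ (fun c _ => an c)]
  simp only [coef_pow_mul (aS_div_analyticAt t _ _ ht w)]
  rcases Nat.eq_zero_or_pos n with rfl | hn
  · rw [Pw_zero, Finset.sum_eq_zero]
    · simp
    · intro c hc
      rw [Finset.mem_Icc] at hc
      rw [if_neg (by omega)]
  · rw [if_neg (by omega), zero_add, Pw_succ l t m n hl hn]
    congr 1
    apply Finset.sum_congr rfl
    intro c hc
    rw [Finset.mem_Icc] at hc
    split_ifs with h
    · apply ih _ (by omega)
      have := Nat.le_mul_of_pos_left c ht
      omega
    · rfl

lemma norm_PP_le (t : ℕ) (ht : 2 ≤ t) {q : ℂ} (hq : ‖q‖ ≤ 0.58) (j : ℕ) :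
    ‖PP t (j + 1) q‖ ≤ 1.38096 * 0.2425 ^ j := by
  unfold PP
  rw [Finset.prod_range_succ', norm_mul, norm_prod, mul_comm]
  apply mul_le_mul
  · refine (norm_phi_le (k := 1) (by norm_num) hq le_rfl (by simp [hp_one])).trans (by norm_num)
  · calc _ ≤ ∏ i ∈ Finset.range j, (0.2425 : ℝ) := by
          apply Finset.prod_le_prod (fun i _ => norm_nonneg _)
          intro i _
          refine (norm_phi_le (k := 3) (by norm_num) hq (by norm_num) ?_).trans (by norm_num)
          have := hp_mono t (show 2 ≤ i + 1 + 1 by omega)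
          rw [hp_two] at this
          omega
      _ = _ := by simp
  · positivity
  · norm_num

lemma aS_one_ne (t : ℕ) (ht : 2 ≤ t) {w q : ℂ} (hw : ‖w‖ = 1) (hq : ‖q‖ ≤ 0.58) :
    aS t 1 w q ≠ 0 := by
  have hqm : q ∈ Metric.ball (0 : ℂ) 0.6 := by rw [mem_ball_zero_iff]; linarith
  have s := (SC_bet t 1 (by omega) (R := 0.6) (by norm_num) (by norm_num)).summable w hqm
  intro h
  unfold aS SF at h
  rw [s.tsum_eq_zero_add] at h
  have h0 : w ^ 0 * bet t 1 0 q = 1 := by simp [bet, hp_zero, PP]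
  rw [h0] at h
  have hb : ∀ j, ‖w ^ (j + 1) * bet t 1 (j + 1) q‖ ≤ 0.80096 * 0.14066 ^ j := by
    intro j
    unfold bet
    rw [norm_mul, norm_mul, norm_mul, norm_pow, hw, norm_pow, norm_neg, norm_one, one_pow,
      one_mul, one_mul, norm_pow]
    have h1 : ‖q‖ ^ (1 * hp t (j + 1)) ≤ 0.58 ^ (j + 1) := by
      calc _ ≤ (0.58 : ℝ) ^ (1 * hp t (j + 1)) := by gcongr
        _ ≤ _ := by
          apply pow_le_pow_of_le_one (by norm_num) (by norm_num)
          rw [one_mul]; exact hp_ge t (by omega) _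
    calc _ ≤ (0.58 : ℝ) ^ (j + 1) * (1.38096 * 0.2425 ^ j) :=
          mul_le_mul h1 (norm_PP_le t ht hq j) (norm_nonneg _) (by positivity)
      _ = (0.58 * 1.38096) * (0.58 * 0.2425) ^ j := by rw [mul_pow]; ring
      _ ≤ _ := by gcongr <;> norm_num
  have hg : HasSum (fun j : ℕ => (0.80096 : ℝ) * 0.14066 ^ j) (0.80096 * (1 - 0.14066)⁻¹) :=
    (hasSum_geometric_of_lt_one (by norm_num) (by norm_num)).mul_left _
  have := tsum_of_norm_bounded hg hb
  have h2 : (∑' j, w ^ (j + 1) * bet t 1 (j + 1) q) = -1 := by linear_combination h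
  rw [h2, norm_neg, norm_one] at this
  norm_num at this

lemma aS_zero_eq (t : ℕ) (ht : 1 ≤ t) (w q : ℂ) (hq : ‖q‖ < 1) :
    aS t 0 w q = aS t 1 w q - w * q * aS t t w q := by
  have := aS_succ t 0 ht w q hq
  simp at this
  linear_combination -this

lemma E_hasSum (t : ℕ) (ht : 2 ≤ t) {w q : ℂ} (hw : ‖w‖ = 1) (hq : ‖q‖ < 0.58) :
    HasSum (fun n => Pw 2 t t n w * q ^ n) (aS t t w q / aS t 1 w q) := by
  have hd : DifferentiableOn ℂ (fun q => aS t t w q / aS t 1 w q) (Metric.ball 0 0.58) := by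
    intro z hz
    rw [mem_ball_zero_iff] at hz
    exact ((aS_diffAt t t (by omega) w z (by linarith)).div
      (aS_diffAt t 1 (by omega) w z (by linarith))
      (aS_one_ne t ht hw hz.le)).differentiableWithinAt
  have := coef_hasSum hd (z := q) (by rwa [mem_ball_zero_iff])
  have e := coef_aS_div t 2 (by omega) (by omega) w
  simp only [show 2 - 1 = 1 from rfl] at e
  simp only [e _ t (by omega)] at this
  exact this

lemma Pw_two_two (t : ℕ) (ht : 2 ≤ t) (w : ℂ) : Pw 2 t t 2 w = w := by
  rw [Pw_succ 2 t t 2 (by omega) (by omega), Finset.sum_eq_single 2]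
  · simp [Pw_zero]
  · intro c hc h
    rw [Finset.mem_Icc] at hc
    rw [if_neg (by omega)]
  · intro h
    simp [ht] at h

lemma eq_of_re_eq {z : ℂ} {x : ℝ} (h1 : ‖z‖ ≤ x) (h2 : z.re = x) : z = x := by
  have h3 := Complex.sq_norm z
  rw [Complex.normSq_apply] at h3
  have h4 : ‖z‖ ^ 2 ≤ x ^ 2 := by gcongr
  have : z.im = 0 := by
    rw [h2] at h3
    have : z.im * z.im ≤ 0 := by nlinarith
    nlinarith [mul_self_nonneg z.im]
  apply Complex.ext <;> simp [h2, this]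

/-- the only zero of `a_0` with `‖q‖ ≤ q₀`, `‖w‖ = 1` -/
lemma aS_zero_strict (t : ℕ) (ht : 2 ≤ t) {q₀ : ℝ} (h0 : 0 < q₀) (h1 : q₀ < 0.58)
    (hr : aS t 0 1 q₀ = 0) {w q : ℂ} (hw : ‖w‖ = 1) (hq : ‖q‖ ≤ q₀) (hz : aS t 0 w q = 0) :
    q = q₀ ∧ w = 1 := by
  have hq0 : ‖(q₀ : ℂ)‖ = q₀ := by rw [Complex.norm_real, Real.norm_of_nonneg h0.le]
  have key : ∀ w q : ℂ, ‖w‖ = 1 → ‖q‖ ≤ q₀ → aS t 0 w q = 0 →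
      HasSum (fun n => w * q * (Pw 2 t t n w * q ^ n)) 1 := by
    intro w q hw hq hz
    have := (E_hasSum t ht hw (q := q) (by linarith)).mul_left (w * q)
    rw [aS_zero_eq t (by omega) w q (by linarith)] at hz
    have hne := aS_one_ne t ht hw (q := q) (by linarith)
    have e : w * q * (aS t t w q / aS t 1 w q) = 1 := by
      field_simp
      linear_combination -hz
    rwa [e] at this
  have k1 := key w q hw hq hz
  have k2 := key 1 q₀ norm_one hq0.le hr
  have k3 := k2.sub k1
  rw [sub_self] at k3
  have k4 := Complex.hasSum_re k3
  have hbd : ∀ n, ‖w * q * (Pw 2 t t n w * q ^ n)‖ ≤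
      ((1 : ℂ) * q₀ * (Pw 2 t t n 1 * (q₀ : ℂ) ^ n)).re := by
    intro n
    rw [Pw_one]
    have : ((1 : ℂ) * q₀ * (((∑ k ∈ Finset.range (n + 1), (Nl 2 t k t n : ℝ) : ℝ) : ℂ) * (q₀ : ℂ) ^ n)).re
        = q₀ * ((∑ k ∈ Finset.range (n + 1), (Nl 2 t k t n : ℝ)) * q₀ ^ n) := by
      rw [one_mul]
      norm_cast
    rw [this, norm_mul, norm_mul, norm_mul, norm_pow, hw, one_mul]
    have := norm_Pw_le 2 t t n w hw
    gcongr
  have k5 : ∀ n, ((1 : ℂ) * q₀ * (Pw 2 t t n 1 * (q₀ : ℂ) ^ n)).re =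
      (w * q * (Pw 2 t t n w * q ^ n)).re := by
    rw [Complex.zero_re] at k4
    rw [hasSum_zero_iff_of_nonneg] at k4
    · intro n
      have := congrFun k4 n
      simp only [Complex.sub_re, Pi.zero_apply] at this
      linarith
    · intro n
      simp only [Complex.sub_re, Pi.zero_apply]
      have := hbd n
      have := Complex.re_le_norm (w * q * (Pw 2 t t n w * q ^ n))
      linarith
  have e0 := k5 0
  rw [Pw_zero, Pw_zero] at e0
  simp only [pow_zero, one_mul, mul_one, Complex.ofReal_re] at e0
  have f0 : w * q = q₀ := by
    apply eq_of_re_eq _ e0.symm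
    rw [norm_mul, hw, one_mul]; exact hq
  have e2 := k5 2
  rw [Pw_two_two t ht, Pw_two_two t ht, f0] at e2
  have f2 : w * q ^ 2 = ((q₀ ^ 2 : ℝ) : ℂ) := by
    apply eq_of_re_eq
    · rw [norm_mul, hw, one_mul, norm_pow]; gcongr
    · rw [Complex.re_ofReal_mul] at e2
      have : ((1 : ℂ) * (q₀ : ℂ) * (1 * (q₀ : ℂ) ^ 2)).re = q₀ * q₀ ^ 2 := by
        rw [one_mul, one_mul]; norm_cast
      rw [this] at e2
      exact (mul_left_cancel₀ h0.ne' e2).symm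
  have hne : (q₀ : ℂ) ≠ 0 := by exact_mod_cast h0.ne'
  have g : (q₀ : ℂ) * q = q₀ * q₀ := by
    push_cast at f2
    rw [← sq (q₀ : ℂ), ← f2, ← f0]; ring
  have gq := mul_left_cancel₀ hne g
  refine ⟨gq, ?_⟩
  rw [gq] at f0
  exact mul_right_cancel₀ hne (f0.trans (one_mul _).symm)

lemma bGF_eq (t : ℕ) (ht : 1 ≤ t) (q w : ℂ) (hq : ‖q‖ < 1) :
    bGF t q 1 1 w = 1 - aS t 0 w q := by
  obtain ⟨R, hR1, hR2⟩ := exists_between hq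
  have hR0 : 0 < R := (norm_nonneg _).trans_lt hR1
  have hqm : q ∈ Metric.ball (0 : ℂ) R := by rwa [mem_ball_zero_iff]
  have s := (SC_bet t 0 ht hR0 hR2).summable w hqm
  unfold aS SF bGF
  rw [s.tsum_eq_zero_add]
  have h0 : w ^ 0 * bet t 0 0 q = 1 := by simp [bet, hp_zero, PP]
  rw [h0, sub_add_cancel_left, ← tsum_neg]
  apply tsum_congr
  intro j
  have hprod : ∏ i ∈ Finset.Icc 1 j, (1 - 1 - q ^ hp t i * 1 ^ t ^ i) / (1 - q ^ hp t i * 1 ^ t ^ i)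
      = (-1) ^ j * PP t j q := by
    induction j with
    | zero => simp [PP]
    | succ j ih =>
      rw [Finset.prod_Icc_succ_top (by omega), ih,
        show PP t (j + 1) q = PP t j q * phi t (j + 1) q from Finset.prod_range_succ _ _]
      unfold phi
      simp only [one_pow, mul_one]
      ring
  rw [hprod]
  unfold bet
  rw [show PP t (j + 1) q = PP t j q * phi t (j + 1) q from Finset.prod_range_succ _ _]
  unfold phi
  simp only [one_pow, mul_one, one_mul, zero_mul, pow_zero]
  ring

lemma coef_inv_sub {ρ : ℂ} (h : ρ ≠ 0) (n : ℕ) :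
    coef (fun q => (q - ρ)⁻¹) n = - (ρ ^ (n + 1))⁻¹ := by
  have an : AnalyticAt ℂ (fun q : ℂ => (q - ρ)⁻¹) 0 := by
    apply AnalyticAt.inv (by fun_prop)
    simpa using h
  have e : (fun q : ℂ => q ^ 1 * (q - ρ)⁻¹ + (-ρ) * (q - ρ)⁻¹) =ᶠ[nhds 0] fun _ => (1 : ℂ) := by
    filter_upwards [isOpen_ne.mem_nhds (Ne.symm h : (0 : ℂ) ≠ ρ)] with q hq
    have : q - ρ ≠ 0 := sub_ne_zero.2 hq
    field_simp
    ring
  have hrec : ∀ n : ℕ, (if 1 ≤ n then coef (fun q => (q - ρ)⁻¹) (n - 1) else 0) +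
      (-ρ) * coef (fun q => (q - ρ)⁻¹) n = (if n = 0 then 1 else 0) := by
    intro n
    have a1 : AnalyticAt ℂ (fun q : ℂ => q ^ 1 * (q - ρ)⁻¹) 0 :=
      (by fun_prop : AnalyticAt ℂ (fun q : ℂ => q ^ 1) 0).mul an
    have a2 : AnalyticAt ℂ (fun q : ℂ => (-ρ) * (q - ρ)⁻¹) 0 := analyticAt_const.mul an
    have := coef_congr e n
    rw [coef_add a1 a2, coef_pow_mul an, coef_const_mul, coef_one] at this
    exact this
  induction n with
  | zero =>
    have := hrec 0
    simp at this
    simp only [zero_add, pow_one]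
    rw [← mul_right_inj' h, mul_neg, mul_inv_cancel₀ h]
    linear_combination -this
  | succ n ih =>
    have := hrec (n + 1)
    simp at this
    rw [ih] at this
    rw [pow_succ ρ (n + 1), mul_inv]
    have hp : ρ ^ (n + 1) ≠ 0 := pow_ne_zero _ h
    have h2 : ρ * coef (fun q => (q - ρ)⁻¹) (n + 1) = -(ρ ^ (n + 1))⁻¹ := by
      linear_combination -this
    rw [← mul_right_inj' h, h2]
    field_simp

lemma coef_pole {f g : ℂ → ℂ} {ρ : ℂ} {r R M : ℝ} (hrR : r < R) (hρ0 : ρ ≠ 0)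
    (hρ : ‖ρ‖ < r) (hf : DifferentiableOn ℂ f (Metric.ball 0 R))
    (hg : DifferentiableOn ℂ g (Metric.ball 0 R)) (hfρ : f ρ = 0) (hd : deriv f ρ ≠ 0)
    (hz : ∀ q, ‖q‖ ≤ r → f q = 0 → q = ρ) (hM : ∀ q, ‖q‖ = r → ‖g q / f q‖ ≤ M) (n : ℕ) :
    ‖coef (fun q => g q / f q) n + g ρ / deriv f ρ * (ρ ^ (n + 1))⁻¹‖ ≤
      (M + ‖g ρ / deriv f ρ‖ / (r - ‖ρ‖)) / r ^ n := by
  have hr : 0 < r := (norm_nonneg _).trans_lt hρ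
  set k := dslope f ρ with hk
  have hbR : Metric.ball (0 : ℂ) R ∈ nhds ρ :=
    Metric.isOpen_ball.mem_nhds (by rw [mem_ball_zero_iff]; linarith)
  have hbr : Metric.closedBall (0 : ℂ) r ∈ nhds ρ :=
    mem_of_superset (Metric.isOpen_ball.mem_nhds (by rwa [mem_ball_zero_iff]))
      Metric.ball_subset_closedBall
  have hsub : Metric.closedBall (0 : ℂ) r ⊆ Metric.ball 0 R := Metric.closedBall_subset_ball hrR
  have hkd : DifferentiableOn ℂ k (Metric.ball 0 R) := (Complex.differentiableOn_dslope hbR).2 hf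
  have hfk : ∀ q, f q = (q - ρ) * k q := by
    intro q
    have := sub_smul_dslope f ρ q
    rw [smul_eq_mul, hfρ, sub_zero] at this
    exact this.symm
  have hkρ : k ρ = deriv f ρ := dslope_same f ρ
  have hk0 : ∀ q ∈ Metric.closedBall (0 : ℂ) r, k q ≠ 0 := by
    intro q hq h0
    rw [mem_closedBall_zero_iff] at hq
    have : q = ρ := hz q hq (by rw [hfk, h0, mul_zero])
    rw [this, hkρ] at h0
    exact hd h0
  set N := fun q => g q / k q with hN
  have hNd : DifferentiableOn ℂ N (Metric.closedBall 0 r) :=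
    (hg.mono hsub).div (hkd.mono hsub) hk0
  have hNρ : N ρ = g ρ / deriv f ρ := by simp only [hN, hkρ]
  have hDd : DifferentiableOn ℂ (dslope N ρ) (Metric.closedBall 0 r) :=
    (Complex.differentiableOn_dslope hbr).2 hNd
  have heq : ∀ q, q ≠ ρ → g q / f q = dslope N ρ q + N ρ * (q - ρ)⁻¹ := by
    intro q hq
    have h1 : q - ρ ≠ 0 := sub_ne_zero.2 hq
    have h2 : g q / f q = N q * (q - ρ)⁻¹ := by
      rw [hfk]; simp only [hN]; rw [div_mul_eq_div_div_swap, ← div_eq_mul_inv]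
    rw [h2, dslope_of_ne N hq, slope_def_field]
    field_simp
    ring
  have an1 : AnalyticAt ℂ (dslope N ρ) 0 :=
    hDd.analyticAt (Metric.closedBall_mem_nhds _ hr)
  have an2 : AnalyticAt ℂ (fun q : ℂ => (q - ρ)⁻¹) 0 := by
    apply AnalyticAt.inv (by fun_prop)
    simpa using hρ0
  have an3 : AnalyticAt ℂ (fun q : ℂ => N ρ * (q - ρ)⁻¹) 0 := analyticAt_const.mul an2
  have e : (fun q => g q / f q) =ᶠ[nhds 0] fun q => dslope N ρ q + N ρ * (q - ρ)⁻¹ := by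
    filter_upwards [isOpen_ne.mem_nhds (Ne.symm hρ0 : (0 : ℂ) ≠ ρ)] with q hq
    exact heq q hq
  rw [coef_congr e, coef_add an1 an3, coef_const_mul, coef_inv_sub hρ0, ← hNρ]
  have : coef (dslope N ρ) n + N ρ * -(ρ ^ (n + 1))⁻¹ + N ρ * (ρ ^ (n + 1))⁻¹ = coef (dslope N ρ) n := by
    ring
  rw [this]
  apply coef_bound hr hDd
  intro z hz'
  rw [mem_sphere_zero_iff_norm] at hz'
  have hzρ : z ≠ ρ := by rintro rfl; linarith
  have h3 : dslope N ρ z = g z / f z - N ρ / (z - ρ) := by rw [heq z hzρ]; ring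
  rw [h3]
  refine (norm_sub_le _ _).trans (add_le_add (hM z hz') ?_)
  rw [norm_div]
  have := norm_sub_norm_le z ρ
  rw [hz'] at this
  exact div_le_div_of_nonneg_left (norm_nonneg _) (by linarith) this


lemma exists_lower {u : ℕ → ℝ} {c : ℝ} (hc : 0 < c) (hu : ∀ n, 0 < u n)
    (h : Tendsto u atTop (nhds c)) : ∃ m, 0 < m ∧ ∀ n, m ≤ u n := by
  obtain ⟨N, hN⟩ := eventually_atTop.1 (h.eventually (lt_mem_nhds (half_lt_self hc)))
  have hs : ∀ N : ℕ, ∃ m, 0 < m ∧ ∀ n < N, m ≤ u n := by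
    intro N
    induction N with
    | zero => exact ⟨1, one_pos, by simp⟩
    | succ N ih =>
      obtain ⟨m, h1, h2⟩ := ih
      refine ⟨min m (u N), lt_min h1 (hu N), fun n hn => ?_⟩
      rcases Nat.lt_succ_iff_lt_or_eq.1 hn with h | rfl
      · exact (min_le_left _ _).trans (h2 n h)
      · exact min_le_right _ _
  obtain ⟨m, h1, h2⟩ := hs N
  refine ⟨min m (c / 2), lt_min h1 (by positivity), fun n => ?_⟩
  rcases lt_or_ge n N with h | h
  · exact (min_le_left _ _).trans (h2 n h)
  · exact (min_le_right _ _).trans (hN n h).le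

lemma Pw_one_pos (t n : ℕ) (ht : 1 ≤ t) : 0 < ‖Pw 1 t 1 n 1‖ := by
  rw [Pw_one, Complex.norm_real, Real.norm_eq_abs, abs_pos]
  have : (0 : ℝ) < ∑ k ∈ Finset.range (n + 1), (Nl 1 t k 1 n : ℝ) := by
    apply Finset.sum_pos' (fun k _ => by positivity)
    exact ⟨n, by simp, by exact_mod_cast Nl_one_pos t ht n 1 le_rfl⟩
  exact this.ne'

/-- behaviour of the coefficients for `w` on the unit circle away from `1` -/
lemma away_bound (t : ℕ) (ht : 2 ≤ t) {q₀ : ℝ} (h0 : 0 < q₀) (h1 : q₀ < 0.58)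
    (hr : aS t 0 1 q₀ = 0) {W : Set ℂ} (hW : IsCompact W) (hW1 : ∀ w ∈ W, ‖w‖ = 1 ∧ w ≠ 1) :
    ∃ K κ : ℝ, 0 ≤ K ∧ 0 ≤ κ ∧ κ < 1 ∧ ∀ n, ∀ w ∈ W, q₀ ^ n * ‖Pw 1 t 1 n w‖ ≤ K * κ ^ n := by
  have ht1 : 1 ≤ t := by omega
  have hcomp : IsCompact (W ×ˢ Metric.closedBall (0 : ℂ) 1) := hW.prod (isCompact_closedBall _ _)
  have hev : ∀ᶠ r : ℝ in nhds q₀, ∀ y ∈ W ×ˢ Metric.closedBall (0 : ℂ) 1,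
      aS t 0 y.1 ((r : ℂ) * y.2) ≠ 0 := by
    apply hcomp.eventually_forall_of_forall_eventually
    rintro ⟨w, u⟩ ⟨hw, hu⟩
    simp only [mem_closedBall_zero_iff] at hw hu
    have hn : ‖(q₀ : ℂ) * u‖ ≤ q₀ := by
      rw [norm_mul, Complex.norm_real, Real.norm_of_nonneg h0.le]
      exact mul_le_of_le_one_right h0.le hu
    have hne : aS t 0 w ((q₀ : ℂ) * u) ≠ 0 := fun h =>
      (hW1 w hw).2 (aS_zero_strict t ht h0 h1 hr (hW1 w hw).1 hn h).2
    have hc1 := aS_contAt t 0 ht1 w ((q₀ : ℂ) * u) (by linarith)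
    have hc2 : ContinuousAt (fun z : ℝ × (ℂ × ℂ) => (z.2.1, (z.1 : ℂ) * z.2.2)) (q₀, (w, u)) := by
      apply Continuous.continuousAt
      fun_prop
    have hc3 : ContinuousAt (fun z : ℝ × (ℂ × ℂ) => aS t 0 z.2.1 ((z.1 : ℂ) * z.2.2)) (q₀, (w, u)) :=
      ContinuousAt.comp (f := fun z : ℝ × (ℂ × ℂ) => (z.2.1, (z.1 : ℂ) * z.2.2))
        (g := fun x : ℂ × ℂ => aS t 0 x.1 x.2) hc1 hc2
    exact hc3.eventually_ne hne
  obtain ⟨r, hr1, hr2, hr3⟩ : ∃ r : ℝ, q₀ < r ∧ r < 1 ∧ ∀ y ∈ W ×ˢ Metric.closedBall (0 : ℂ) 1,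
      aS t 0 y.1 ((r : ℂ) * y.2) ≠ 0 := by
    have h2 : ∀ᶠ r : ℝ in nhds q₀, r < 1 := gt_mem_nhds (by linarith)
    have h3 := (hev.and h2).filter_mono (nhdsWithin_le_nhds (s := Set.Ioi q₀))
    obtain ⟨r, ⟨h4, h5⟩, h6⟩ := (h3.and self_mem_nhdsWithin).exists
    exact ⟨r, h6, h5, h4⟩
  have hr0 : 0 < r := h0.trans hr1
  have hne : ∀ w ∈ W, ∀ q ∈ Metric.closedBall (0 : ℂ) r, aS t 0 w q ≠ 0 := by
    intro w hw q hq
    have hrne : (r : ℂ) ≠ 0 := by exact_mod_cast hr0.ne'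
    rw [mem_closedBall_zero_iff] at hq
    have := hr3 (w, q / r) ⟨hw, by
      rw [mem_closedBall_zero_iff, norm_div, Complex.norm_real, Real.norm_of_nonneg hr0.le,
        div_le_one hr0]
      exact hq⟩
    simpa [mul_div_cancel₀ _ hrne] using this
  have hcomp2 : IsCompact (W ×ˢ Metric.closedBall (0 : ℂ) r) := hW.prod (isCompact_closedBall _ _)
  have hcont : ContinuousOn (fun x : ℂ × ℂ => aS t 1 x.1 x.2 / aS t 0 x.1 x.2)
      (W ×ˢ Metric.closedBall (0 : ℂ) r) := by
    rintro ⟨w, q⟩ ⟨hw, hq⟩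
    have hq' := hq
    simp only [mem_closedBall_zero_iff] at hq'
    exact ((aS_contAt t 1 ht1 w q (by linarith)).div (aS_contAt t 0 ht1 w q (by linarith))
      (hne w hw q hq)).continuousWithinAt
  obtain ⟨K, hK⟩ := hcomp2.exists_bound_of_continuousOn hcont
  refine ⟨max K 0, q₀ / r, le_max_right _ _, by positivity, (div_lt_one hr0).2 hr1, fun n w hw => ?_⟩
  have hcf := coef_aS_div t 1 ht1 le_rfl w n 1 (by omega)
  rw [← hcf]
  have hb := coef_bound (f := fun q => aS t 1 w q / aS t (1 - 1) w q) (M := max K 0) hr0 (by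
    intro q hq
    have hq' := hq
    rw [mem_closedBall_zero_iff] at hq'
    exact ((aS_diffAt t 1 ht1 w q (by linarith)).div (aS_diffAt t 0 ht1 w q (by linarith))
      (hne w hw q hq)).differentiableWithinAt) (by
    intro z hz
    exact (hK (w, z) ⟨hw, Metric.sphere_subset_closedBall hz⟩).trans (le_max_left _ _)) n
  calc _ ≤ q₀ ^ n * (max K 0 / r ^ n) := by gcongr
    _ = _ := by rw [div_pow]; ring

theorem quasi_power (t : ℕ) (ht : 2 ≤ t) {q₀ : ℝ} (h0 : 0 < q₀) (h1 : q₀ < 0.58)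
    (hr : aS t 0 1 q₀ = 0) (hu : ∀ q : ℂ, ‖q‖ ≤ 0.58 → aS t 0 1 q = 0 → q = q₀)
    (hD : SF (dQ (bet t 0)) 1 q₀ ≠ 0) :
    ∃ L : ℂ → ℂ, AnalyticAt ℂ L 0 ∧ L 0 = 0 ∧
      (∀ᶠ s in nhds (0 : ℂ), aS t 0 (Complex.exp s) (q₀ * Complex.exp (-L s)) = 0) ∧
      (∃ K : ℝ, ∀ᶠ s in nhds (0 : ℂ), ∀ n : ℕ,
        ‖q₀ ^ n * Pw 1 t 1 n (Complex.exp s) * Complex.exp (-(n * L s))‖ ≤ K) ∧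
      (∃ m : ℝ, 0 < m ∧ ∀ n : ℕ, m ≤ q₀ ^ n * ‖Pw 1 t 1 n 1‖) := by
  have ht1 : 1 ≤ t := by omega
  have hS := SC_bet t 0 ht1 (R := 0.8) (by norm_num) (by norm_num)
  have hn0 : ‖(q₀ : ℂ)‖ = q₀ := by rw [Complex.norm_real, Real.norm_of_nonneg h0.le]
  have hq₀ne : (q₀ : ℂ) ≠ 0 := by exact_mod_cast h0.ne'
  have hq₀m : (q₀ : ℂ) ∈ Metric.ball (0 : ℂ) 0.8 := by
    rw [mem_ball_zero_iff, hn0]; linarith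
  have hfd := hS.hasFDerivAt (w := 1) hq₀m
  have cdf := hS.contDiffAt (w := 1) hq₀m
  have inv : (fderiv ℂ (fun x : ℂ × ℂ => SF (bet t 0) x.1 x.2) (1, (q₀ : ℂ)) ∘L
      .inr ℂ ℂ ℂ).IsInvertible := by
    refine ⟨ContinuousLinearEquiv.unitsEquivAut ℂ (Units.mk0 _ hD), ?_⟩
    rw [hfd.fderiv]
    ext
    simp
  set ρ := cdf.implicitFunction one_ne_zero inv with hρdef
  have hρ1 : ρ 1 = q₀ := cdf.implicitFunction_apply_self one_ne_zero inv
  have ea : ∀ᶠ w in nhds (1 : ℂ), aS t 0 w (ρ w) = 0 := by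
    have := cdf.eventually_apply_implicitFunction one_ne_zero inv
    filter_upwards [this] with w hw
    exact hw.trans hr
  have eu : ∀ᶠ v in nhds ((1 : ℂ), (q₀ : ℂ)), aS t 0 v.1 v.2 = 0 → v.2 = ρ v.1 := by
    have := cdf.eventually_apply_eq_iff_implicitFunction one_ne_zero inv
    filter_upwards [this] with v hv h
    exact (hv.1 (h.trans hr.symm)).symm
  have hρd : ∀ᶠ w in nhds (1 : ℂ), DifferentiableAt ℂ ρ w := by
    have := (cdf.contDiffAt_implicitFunction one_ne_zero inv).eventually (by simp)
    filter_upwards [this] with w hw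
    exact hw.differentiableAt one_ne_zero
  have hρan : AnalyticAt ℂ ρ 1 := Complex.analyticAt_iff_eventually_differentiableAt.2 hρd
  have hρc : ContinuousAt ρ 1 := hρan.continuousAt
  -- uniqueness
  have ec : ∀ᶠ w in nhds (1 : ℂ), ∀ q ∈ Metric.closedBall (0 : ℂ) 0.58,
      aS t 0 w q = 0 → q = ρ w := by
    apply (isCompact_closedBall (0 : ℂ) 0.58).eventually_forall_of_forall_eventually
    intro q hq
    rw [mem_closedBall_zero_iff] at hq
    by_cases hqq : q = q₀
    · rw [hqq]; exact eu
    · have hne : aS t 0 1 q ≠ 0 := fun h => hqq (hu q hq h)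
      have := (aS_contAt t 0 ht1 1 q (by linarith)).eventually_ne hne
      filter_upwards [this] with z hz h
      exact absurd h hz
  obtain ⟨r1, hr1, hr2⟩ := exists_between h1
  have ed1 : ∀ᶠ w in nhds (1 : ℂ), ‖ρ w‖ < r1 := by
    apply hρc.norm.eventually_lt_const
    simp only [hρ1, hn0]; exact hr1
  have ed2 : ∀ᶠ w in nhds (1 : ℂ), q₀ / 2 < ‖ρ w‖ := by
    apply hρc.norm.eventually_const_lt
    simp only [hρ1, hn0]; linarith
  have hpair : ContinuousAt (fun w => (w, ρ w)) 1 := continuousAt_id.prodMk hρc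
  have hDc : ContinuousAt (fun w => SF (dQ (bet t 0)) w (ρ w)) 1 := by
    have hc := (hS.dQ (R' := 0.7) (by norm_num)).continuousAt (w := 1) (q := q₀)
      (by rw [mem_ball_zero_iff, hn0]; linarith)
    rw [← hρ1] at hc
    exact ContinuousAt.comp (f := fun w => (w, ρ w))
      (g := fun x : ℂ × ℂ => SF (dQ (bet t 0)) x.1 x.2) hc hpair
  have hgc : ContinuousAt (fun w => aS t 1 w (ρ w)) 1 := by
    have hc := aS_contAt t 1 ht1 1 q₀ (by rw [hn0]; linarith)
    rw [← hρ1] at hc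
    exact ContinuousAt.comp (f := fun w => (w, ρ w))
      (g := fun x : ℂ × ℂ => aS t 1 x.1 x.2) hc hpair
  have ee : ∀ᶠ w in nhds (1 : ℂ), SF (dQ (bet t 0)) w (ρ w) ≠ 0 := by
    apply hDc.eventually_ne
    rw [hρ1]; exact hD
  set B := ‖aS t 1 1 q₀ / SF (dQ (bet t 0)) 1 q₀‖ + 1 with hB
  have eB : ∀ᶠ w in nhds (1 : ℂ), ‖aS t 1 w (ρ w) / SF (dQ (bet t 0)) w (ρ w)‖ < B := by
    apply (hgc.div hDc (by rw [hρ1]; exact hD)).norm.eventually_lt_const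
    simp only [Pi.div_apply, hρ1]
    rw [hB]; linarith
  have hsph : ∀ q ∈ Metric.sphere (0 : ℂ) 0.58, aS t 0 1 q ≠ 0 := by
    intro q hq h
    rw [mem_sphere_zero_iff_norm] at hq
    have := hu q hq.le h
    rw [this, hn0] at hq
    linarith
  have hcq : ∀ q ∈ Metric.sphere (0 : ℂ) 0.58,
      ContinuousAt (fun x : ℂ × ℂ => aS t 1 x.1 x.2 / aS t 0 x.1 x.2) (1, q) := by
    intro q hq
    have hne := hsph q hq
    rw [mem_sphere_zero_iff_norm] at hq
    exact (aS_contAt t 1 ht1 1 q (by linarith)).div (aS_contAt t 0 ht1 1 q (by linarith)) hne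
  obtain ⟨M0, hM0⟩ := (isCompact_sphere (0 : ℂ) 0.58).exists_bound_of_continuousOn
    (f := fun q => aS t 1 1 q / aS t 0 1 q) (by
      intro q hq
      exact (ContinuousAt.comp (f := fun q : ℂ => ((1 : ℂ), q))
        (g := fun x : ℂ × ℂ => aS t 1 x.1 x.2 / aS t 0 x.1 x.2) (hcq q hq)
        (by fun_prop)).continuousWithinAt)
  have ef : ∀ᶠ w in nhds (1 : ℂ), ∀ q ∈ Metric.sphere (0 : ℂ) 0.58,
      ‖aS t 1 w q / aS t 0 w q‖ < M0 + 1 := by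
    apply (isCompact_sphere (0 : ℂ) 0.58).eventually_forall_of_forall_eventually
    intro q hq
    apply (hcq q hq).norm.eventually_lt_const
    have := hM0 q hq
    simp only at this ⊢
    linarith
  set K1 := M0 + 1 + B / (0.58 - r1) with hK1
  have hB0 : 0 < B := by rw [hB]; positivity
  -- main estimate
  have key : ∀ᶠ w in nhds (1 : ℂ), ∀ n : ℕ,
      ‖Pw 1 t 1 n w + aS t 1 w (ρ w) / SF (dQ (bet t 0)) w (ρ w) * (ρ w ^ (n + 1))⁻¹‖ ≤
        K1 / 0.58 ^ n := by
    filter_upwards [ea, ec, ed1, ed2, ee, eB, ef] with w ha hc hd1 hd2 he hB' hf n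
    have hρm : ρ w ∈ Metric.ball (0 : ℂ) 0.8 := by rw [mem_ball_zero_iff]; linarith
    have hder : deriv (fun q => aS t 0 w q) (ρ w) = SF (dQ (bet t 0)) w (ρ w) :=
      (hS.hasDerivAt_q hρm).deriv
    have hρne : ρ w ≠ 0 := by
      intro h; rw [h, norm_zero] at hd2; linarith
    have := coef_pole (f := fun q => aS t 0 w q) (g := fun q => aS t 1 w q) (ρ := ρ w) (r := 0.58)
      (R := 1) (M := M0 + 1) (by norm_num) hρne (hd1.trans hr2)
      (fun q hq => (aS_diffAt t 0 ht1 w q (by rwa [mem_ball_zero_iff] at hq)).differentiableWithinAt)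
      (fun q hq => (aS_diffAt t 1 ht1 w q (by rwa [mem_ball_zero_iff] at hq)).differentiableWithinAt)
      ha (by rw [hder]; exact he)
      (fun q hq h => hc q (by rwa [mem_closedBall_zero_iff]) h)
      (fun q hq => (hf q (by rwa [mem_sphere_zero_iff_norm])).le) n
    rw [hder] at this
    have hcf := coef_aS_div t 1 ht1 le_rfl w n 1 (by omega)
    simp only [Nat.sub_self] at hcf
    rw [hcf] at this
    refine this.trans ?_
    gcongr
    rw [hK1]
    gcongr
  have key1 := key.self_of_nhds
  have hρne : ρ 1 ≠ 0 := by rw [hρ1]; exact hq₀ne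
  have hexp : Tendsto Complex.exp (nhds 0) (nhds 1) := by
    have := Complex.continuous_exp.tendsto 0
    rwa [Complex.exp_zero] at this
  have hLe : ∀ᶠ s in nhds (0 : ℂ),
      Complex.exp (- -Complex.log (ρ (Complex.exp s) / q₀)) = ρ (Complex.exp s) / q₀ := by
    filter_upwards [hexp.eventually ed2] with s hs
    rw [neg_neg, Complex.exp_log]
    apply div_ne_zero _ hq₀ne
    intro h; rw [h, norm_zero] at hs; linarith
  refine ⟨fun s => -Complex.log (ρ (Complex.exp s) / q₀), ?_, ?_, ?_, ⟨B / (q₀ / 2) + K1, ?_⟩, ?_⟩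
  · apply AnalyticAt.neg
    apply AnalyticAt.clog
    · apply AnalyticAt.div _ analyticAt_const hq₀ne
      apply AnalyticAt.fun_comp
      · rw [Complex.exp_zero]; exact hρan
      · exact analyticAt_cexp
    · rw [Complex.exp_zero, hρ1, div_self hq₀ne]; exact Complex.one_mem_slitPlane
  · simp [hρ1, div_self hq₀ne]
  · filter_upwards [hLe, hexp.eventually ea] with s h1 h2
    rw [h1, mul_div_cancel₀ _ hq₀ne]; exact h2
  · filter_upwards [hLe, hexp.eventually key, hexp.eventually ed1, hexp.eventually ed2,
      hexp.eventually eB] with s g1 g2 g3 g4 g5 n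
    have hx : Complex.exp (-(n * -Complex.log (ρ (Complex.exp s) / q₀))) =
        (ρ (Complex.exp s) / q₀) ^ n := by
      conv_rhs => rw [← g1, ← Complex.exp_nat_mul]
      congr 1; ring
    rw [hx]
    set z := ρ (Complex.exp s) with hz
    have hzne : z ≠ 0 := by
      intro h; rw [h, norm_zero] at g4; linarith
    have hx2 : (q₀ : ℂ) ^ n * Pw 1 t 1 n (Complex.exp s) * (z / q₀) ^ n =
        z ^ n * (Pw 1 t 1 n (Complex.exp s) +
          aS t 1 (Complex.exp s) z / SF (dQ (bet t 0)) (Complex.exp s) z * (z ^ (n + 1))⁻¹)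
        - aS t 1 (Complex.exp s) z / SF (dQ (bet t 0)) (Complex.exp s) z * z⁻¹ := by
      generalize aS t 1 (Complex.exp s) z / SF (dQ (bet t 0)) (Complex.exp s) z = X
      rw [div_pow, pow_succ]
      field_simp
      ring
    rw [hx2]
    refine (norm_sub_le _ _).trans ?_
    rw [norm_mul, norm_mul, norm_pow, norm_inv, add_comm]
    have hK1' : 0 ≤ K1 := by
      have := (norm_nonneg _).trans (g2 0)
      simpa using this
    have a1 : ‖z‖ ^ n * ‖(Pw 1 t 1 n (Complex.exp s) +
          aS t 1 (Complex.exp s) z / SF (dQ (bet t 0)) (Complex.exp s) z * (z ^ (n + 1))⁻¹)‖ ≤ K1 := by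
      calc _ ≤ 0.58 ^ n * (K1 / 0.58 ^ n) := by
            gcongr
            · linarith
            · exact g2 n
        _ = K1 := by field_simp
    have a2 : ‖aS t 1 (Complex.exp s) z / SF (dQ (bet t 0)) (Complex.exp s) z‖ * ‖z‖⁻¹ ≤ B / (q₀ / 2) := by
      rw [div_eq_mul_inv B]
      gcongr
    exact add_le_add a2 a1
  · set X := aS t 1 1 q₀ / SF (dQ (bet t 0)) 1 q₀ with hX
    rw [hρ1] at key1
    have hXne : X ≠ 0 := div_ne_zero (aS_one_ne t ht norm_one (by rw [hn0]; exact h1.le)) hD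
    have hlim : Tendsto (fun n : ℕ => (q₀ : ℂ) ^ n * Pw 1 t 1 n 1) atTop (nhds (-(X * (q₀ : ℂ)⁻¹))) := by
      rw [tendsto_iff_norm_sub_tendsto_zero]
      have hg : Tendsto (fun n : ℕ => K1 * (q₀ / 0.58) ^ n) atTop (nhds 0) := by
        have := (tendsto_pow_atTop_nhds_zero_of_lt_one (r := q₀ / 0.58) (by positivity)
          ((div_lt_one (by norm_num)).2 h1)).const_mul K1
        simpa using this
      refine squeeze_zero (fun n => norm_nonneg _) (fun n => ?_) hg
      have e : (q₀ : ℂ) ^ n * Pw 1 t 1 n 1 - -(X * (q₀ : ℂ)⁻¹) =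
          (q₀ : ℂ) ^ n * (Pw 1 t 1 n 1 + X * ((q₀ : ℂ) ^ (n + 1))⁻¹) := by
        rw [pow_succ]
        field_simp
        ring
      rw [e, norm_mul, norm_pow, hn0]
      calc _ ≤ q₀ ^ n * (K1 / 0.58 ^ n) := by
            gcongr
            exact key1 n
        _ = _ := by rw [div_pow]; ring
    have hlim2 := hlim.norm
    have hc : 0 < ‖-(X * (q₀ : ℂ)⁻¹)‖ := by
      rw [norm_pos_iff, neg_ne_zero]
      exact mul_ne_zero hXne (inv_ne_zero hq₀ne)
    have hlim3 : Tendsto (fun n : ℕ => q₀ ^ n * ‖Pw 1 t 1 n 1‖) atTop (nhds ‖-(X * (q₀ : ℂ)⁻¹)‖) := by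
      refine hlim2.congr fun n => ?_
      rw [norm_mul, norm_pow, hn0]
    exact exists_lower hc (fun n => mul_pos (by positivity) (Pw_one_pos t n ht1)) hlim3

def cf (p : ℕ → ℕ → ℝ) (n : ℕ) (s : ℂ) : ℂ :=
  ∑ k ∈ Finset.range (n + 1), (p n k : ℂ) * Complex.exp (k * s)

structure QPH (p : ℕ → ℕ → ℝ) (L : ℂ → ℂ) (δ K : ℝ) : Prop where
  nonneg : ∀ n k, 0 ≤ p n k
  sum_one : ∀ n, ∑ k ∈ Finset.range (n + 1), p n k = 1
  pos : 0 < δ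
  diff : DifferentiableOn ℂ L (Metric.ball 0 δ)
  zero : L 0 = 0
  bound : ∀ s ∈ Metric.ball (0 : ℂ) δ, ∀ n : ℕ, ‖cf p n s * Complex.exp (-(n * L s))‖ ≤ K
  away : ∀ η : ℝ, 0 < η → ∃ K' κ : ℝ, 0 ≤ K' ∧ 0 ≤ κ ∧ κ < 1 ∧ ∀ (n : ℕ) (θ : ℝ),
    η ≤ |θ| → |θ| ≤ Real.pi → ‖cf p n (θ * Complex.I)‖ ≤ K' * κ ^ n

lemma cf_hasDerivAt (p : ℕ → ℕ → ℝ) (n : ℕ) (s : ℂ) :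
    HasDerivAt (cf p n) (∑ k ∈ Finset.range (n + 1), (p n k : ℂ) * k * Complex.exp (k * s)) s := by
  unfold cf
  apply HasDerivAt.fun_sum
  intro k _
  have h : HasDerivAt (fun s : ℂ => (k : ℂ) * s) k s := by
    simpa using (hasDerivAt_id s).const_mul (k : ℂ)
  convert! h.cexp.const_mul (p n k : ℂ) using 1
  ring

lemma cf_hasDerivAt2 (p : ℕ → ℕ → ℝ) (n : ℕ) (s : ℂ) :
    HasDerivAt (fun s => ∑ k ∈ Finset.range (n + 1), (p n k : ℂ) * k * Complex.exp (k * s))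
      (∑ k ∈ Finset.range (n + 1), (p n k : ℂ) * k ^ 2 * Complex.exp (k * s)) s := by
  apply HasDerivAt.fun_sum
  intro k _
  have h : HasDerivAt (fun s : ℂ => (k : ℂ) * s) k s := by
    simpa using (hasDerivAt_id s).const_mul (k : ℂ)
  convert! h.cexp.const_mul ((p n k : ℂ) * k) using 1
  ring

def Rn (p : ℕ → ℕ → ℝ) (L : ℂ → ℂ) (n : ℕ) (s : ℂ) : ℂ := cf p n s * Complex.exp (-(n * L s))

lemma cf_zero {p : ℕ → ℕ → ℝ} {L : ℂ → ℂ} {δ K : ℝ} (h : QPH p L δ K) (n : ℕ) : cf p n 0 = 1 := by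
  unfold cf
  have := h.sum_one n
  simp only [mul_zero, Complex.exp_zero, mul_one]
  exact_mod_cast this

lemma Rn_zero {p : ℕ → ℕ → ℝ} {L : ℂ → ℂ} {δ K : ℝ} (h : QPH p L δ K) (n : ℕ) : Rn p L n 0 = 1 := by
  unfold Rn
  rw [cf_zero h, h.zero]; simp

lemma Rn_hasDerivAt {p : ℕ → ℕ → ℝ} {L : ℂ → ℂ} {δ K : ℝ} (h : QPH p L δ K) (n : ℕ) {s : ℂ}
    (hs : s ∈ Metric.ball (0 : ℂ) δ) : HasDerivAt (Rn p L n)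
      ((∑ k ∈ Finset.range (n + 1), (p n k : ℂ) * k * Complex.exp (k * s)) * Complex.exp (-(n * L s)) +
        cf p n s * (Complex.exp (-(n * L s)) * (-(n * deriv L s)))) s := by
  have hL := (h.diff.differentiableAt (Metric.isOpen_ball.mem_nhds hs)).hasDerivAt
  exact (cf_hasDerivAt p n s).mul ((hL.const_mul (n : ℂ)).neg.cexp)

lemma Rn_diff {p : ℕ → ℕ → ℝ} {L : ℂ → ℂ} {δ K : ℝ} (h : QPH p L δ K) (n : ℕ) :
    DifferentiableOn ℂ (Rn p L n) (Metric.ball 0 δ) :=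
  fun _ hs => (Rn_hasDerivAt h n hs).differentiableAt.differentiableWithinAt

lemma mean_var {p : ℕ → ℕ → ℝ} {L : ℂ → ℂ} {δ K : ℝ} (h : QPH p L δ K) : ∃ C : ℝ, ∀ n : ℕ,
    ‖(((∑ k ∈ Finset.range (n + 1), p n k * k) : ℝ) : ℂ) - n * deriv L 0‖ ≤ C ∧
    ‖(((∑ k ∈ Finset.range (n + 1), p n k * (k : ℝ) ^ 2) - (∑ k ∈ Finset.range (n + 1), p n k * k) ^ 2 : ℝ) : ℂ)
      - n * deriv (deriv L) 0‖ ≤ C := by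
  have hδ := h.pos
  have h0 : (0 : ℂ) ∈ Metric.ball (0 : ℂ) δ := Metric.mem_ball_self hδ
  have hsub : Metric.closedBall (0 : ℂ) (δ / 2) ⊆ Metric.ball 0 δ :=
    Metric.closedBall_subset_ball (by linarith)
  have hc : ∀ n j : ℕ, ‖iteratedDeriv j (Rn p L n) 0‖ ≤ j.factorial * K / (δ / 2) ^ j := by
    intro n j
    apply Complex.norm_iteratedDeriv_le_of_forall_mem_sphere_norm_le j (by positivity)
    · apply DifferentiableOn.diffContOnCl
      rw [closure_ball _ (by positivity)]
      exact (Rn_diff h n).mono hsub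
    · intro z hz
      exact h.bound z (hsub (Metric.sphere_subset_closedBall hz)) n
  set C1 := K / (δ / 2) with hC1
  set C2 := 2 * K / (δ / 2) ^ 2 with hC2
  have hL2 : HasDerivAt (deriv L) (deriv (deriv L) 0) 0 :=
    ((h.diff.deriv Metric.isOpen_ball).differentiableAt (Metric.isOpen_ball.mem_nhds h0)).hasDerivAt
  refine ⟨max C1 (C2 + C1 ^ 2), fun n => ?_⟩
  set M := ∑ k ∈ Finset.range (n + 1), p n k * (k : ℝ) with hM
  set V := ∑ k ∈ Finset.range (n + 1), p n k * (k : ℝ) ^ 2 with hV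
  have eM : (∑ k ∈ Finset.range (n + 1), (p n k : ℂ) * k * Complex.exp (k * 0)) = (M : ℂ) := by
    rw [hM]; push_cast; simp
  have eV : (∑ k ∈ Finset.range (n + 1), (p n k : ℂ) * k ^ 2 * Complex.exp (k * 0)) = (V : ℂ) := by
    rw [hV]; push_cast; simp
  have d1 := Rn_hasDerivAt h n h0
  rw [eM, h.zero, cf_zero h] at d1
  simp only [mul_zero, neg_zero, Complex.exp_zero, mul_one, one_mul] at d1
  have b1 := hc n 1
  rw [iteratedDeriv_one, d1.deriv] at b1
  simp only [Nat.factorial_one, Nat.cast_one, one_mul, pow_one, ← sub_eq_add_neg] at b1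
  have hd : deriv (Rn p L n) =ᶠ[nhds 0] fun s =>
      ((∑ k ∈ Finset.range (n + 1), (p n k : ℂ) * k * Complex.exp (k * s)) * Complex.exp (-(n * L s)) +
        cf p n s * (Complex.exp (-(n * L s)) * (-(n * deriv L s)))) := by
    filter_upwards [Metric.isOpen_ball.mem_nhds h0] with s hs
    exact (Rn_hasDerivAt h n hs).deriv
  have hLd := (h.diff.differentiableAt (Metric.isOpen_ball.mem_nhds h0)).hasDerivAt
  have hE : HasDerivAt (fun s => Complex.exp (-(n * L s))) _ 0 := (hLd.const_mul (n : ℂ)).fun_neg.cexp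
  have d2 := ((cf_hasDerivAt2 p n 0).fun_mul hE).fun_add
    ((cf_hasDerivAt p n 0).fun_mul (hE.fun_mul (hL2.const_mul (n : ℂ)).fun_neg))
  have d3 := d2.congr_of_eventuallyEq hd
  rw [eM, eV, h.zero, cf_zero h] at d3
  simp only [mul_zero, neg_zero, Complex.exp_zero, mul_one, one_mul] at d3
  have b2 := hc n 2
  rw [iteratedDeriv_succ, iteratedDeriv_one, d3.deriv] at b2
  simp only [Nat.factorial_two, Nat.cast_ofNat] at b2
  constructor
  · exact b1.trans (le_max_left _ _)
  · refine le_trans ?_ (le_max_right _ _)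
    rw [← hC1] at b1
    have e : (((V - M ^ 2 : ℝ)) : ℂ) - n * deriv (deriv L) 0 =
      ((V : ℂ) + (M : ℂ) * -(n * deriv L 0) + ((M : ℂ) * -(n * deriv L 0) + (-(n * deriv L 0) * -(n * deriv L 0)
        + -(n * deriv (deriv L) 0)))) - ((M : ℂ) - n * deriv L 0) ^ 2 := by
      push_cast; ring
    rw [e]
    refine (norm_sub_le _ _).trans (add_le_add b2 ?_)
    rw [norm_pow]
    gcongr

lemma im_zero_of_bdd {z : ℂ} {x : ℕ → ℝ} {C : ℝ} (h : ∀ n : ℕ, ‖(x n : ℂ) - n * z‖ ≤ C) : z.im = 0 := by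
  by_contra hz
  have h2 : ∀ n : ℕ, n * |z.im| ≤ C := by
    intro n
    have := (Complex.abs_im_le_norm _).trans (h n)
    simpa [abs_mul] using this
  obtain ⟨n, hn⟩ := exists_nat_gt (C / |z.im|)
  rw [div_lt_iff₀ (abs_pos.2 hz)] at hn
  linarith [h2 n]

lemma taylor2 {L : ℂ → ℂ} {δ : ℝ} (hδ : 0 < δ) (hd : DifferentiableOn ℂ L (Metric.ball 0 δ))
    (h0 : L 0 = 0) : ∃ L2 : ℂ → ℂ, ContinuousAt L2 0 ∧ L2 0 = deriv (deriv L) 0 / 2 ∧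
      ∀ s, L s = deriv L 0 * s + s ^ 2 * L2 s := by
  have hb : Metric.ball (0 : ℂ) δ ∈ nhds 0 := Metric.ball_mem_nhds _ hδ
  set L1 := dslope L 0 with hL1
  have d1 : DifferentiableOn ℂ L1 (Metric.ball 0 δ) := (Complex.differentiableOn_dslope hb).2 hd
  have e1 : ∀ s, L s = s * L1 s := by
    intro s
    have := sub_smul_dslope L 0 s
    rw [sub_zero, smul_eq_mul, h0, sub_zero] at this
    exact this.symm
  have e10 : L1 0 = deriv L 0 := dslope_same _ _
  set L2 := dslope L1 0 with hL2
  have d2 : DifferentiableOn ℂ L2 (Metric.ball 0 δ) := (Complex.differentiableOn_dslope hb).2 d1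
  refine ⟨L2, (d2.differentiableAt hb).continuousAt, ?_, fun s => ?_⟩
  · have e20 : L2 0 = deriv L1 0 := dslope_same _ _
    have hdL : deriv L =ᶠ[nhds 0] fun s => L1 s + s * deriv L1 s := by
      filter_upwards [hb] with s hs
      have hd1 := (d1.differentiableAt (Metric.isOpen_ball.mem_nhds hs)).hasDerivAt
      have := (hasDerivAt_id' s).fun_mul hd1
      have hL : L = fun s => s * L1 s := funext e1
      rw [hL, this.deriv, one_mul]
    have hd1 := (d1.differentiableAt hb).hasDerivAt
    have hd11 := ((d1.deriv Metric.isOpen_ball).differentiableAt hb).hasDerivAt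
    have := hd1.fun_add ((hasDerivAt_id' (0 : ℂ)).fun_mul hd11)
    rw [(this.congr_of_eventuallyEq hdL).deriv, e20]
    ring
  · have := sub_smul_dslope L1 0 s
    rw [sub_zero, smul_eq_mul] at this
    rw [e1 s, ← e10]
    linear_combination (-s) * this

lemma Rn_sub_one {p : ℕ → ℕ → ℝ} {L : ℂ → ℂ} {δ K : ℝ} (h : QPH p L δ K) : ∃ C : ℝ,
    ∀ n : ℕ, ∀ s ∈ Metric.ball (0 : ℂ) (δ / 2), ‖Rn p L n s - 1‖ ≤ C * ‖s‖ := by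
  have hδ := h.pos
  refine ⟨K / (δ / 2), fun n s hs => ?_⟩
  have hder : ∀ z ∈ Metric.ball (0 : ℂ) (δ / 2), ‖deriv (Rn p L n) z‖ ≤ K / (δ / 2) := by
    intro z hz
    have hsub : Metric.closedBall z (δ / 2) ⊆ Metric.ball 0 δ := by
      intro y hy
      rw [Metric.mem_ball] at hz ⊢
      rw [Metric.mem_closedBall] at hy
      linarith [dist_triangle y z 0]
    apply Complex.norm_deriv_le_of_forall_mem_sphere_norm_le (by positivity)
    · apply DifferentiableOn.diffContOnCl
      rw [closure_ball _ (by positivity)]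
      exact (Rn_diff h n).mono hsub
    · intro y hy
      exact h.bound y (hsub (Metric.sphere_subset_closedBall hy)) n
  have h0 : (0 : ℂ) ∈ Metric.ball (0 : ℂ) (δ / 2) := Metric.mem_ball_self (by positivity)
  have := (convex_ball (0 : ℂ) (δ / 2)).norm_image_sub_le_of_norm_deriv_le
    (f := Rn p L n) (fun z hz => ((Rn_diff h n).differentiableAt
      (Metric.isOpen_ball.mem_nhds (Metric.ball_subset_ball (by linarith) hz)))) hder h0 hs
  rwa [Rn_zero h, sub_zero] at this

def psi (p : ℕ → ℕ → ℝ) (μ σ : ℝ) (n : ℕ) (u : ℝ) : ℂ :=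
  cf p n ((u / (σ * √n) : ℝ) * Complex.I) * Complex.exp (((-(μ * n * (u / (σ * √n))) : ℝ) : ℂ) * Complex.I)

lemma norm_psi (p : ℕ → ℕ → ℝ) (μ σ : ℝ) (n : ℕ) (u : ℝ) :
    ‖psi p μ σ n u‖ = ‖cf p n ((u / (σ * √n) : ℝ) * Complex.I)‖ := by
  unfold psi
  rw [norm_mul, Complex.norm_exp_ofReal_mul_I, mul_one]

lemma cf_continuous (p : ℕ → ℕ → ℝ) (n : ℕ) : Continuous (cf p n) := by
  unfold cf; fun_prop

lemma psi_continuous (p : ℕ → ℕ → ℝ) (μ σ : ℝ) (n : ℕ) : Continuous (psi p μ σ n) := by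
  have := cf_continuous p n
  unfold psi
  fun_prop

lemma psi_eq {p : ℕ → ℕ → ℝ} {L L2 : ℂ → ℂ} {μ σ : ℝ} (hσ : 0 < σ)
    (hL2 : ∀ s, L s = μ * s + s ^ 2 * L2 s) {n : ℕ} (hn : 1 ≤ n) (u : ℝ) :
    psi p μ σ n u = Rn p L n ((u / (σ * √n) : ℝ) * Complex.I) *
      Complex.exp (-((u ^ 2 / σ ^ 2 : ℝ) : ℂ) * L2 ((u / (σ * √n) : ℝ) * Complex.I)) := by
  unfold psi Rn
  rw [mul_assoc (cf p n _), ← Complex.exp_add]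
  congr 2
  rw [hL2]
  have hn' : (0 : ℝ) < n := by exact_mod_cast hn
  have key : (n : ℝ) * (u / (σ * √n)) ^ 2 = u ^ 2 / σ ^ 2 := by
    rw [div_pow, mul_pow, Real.sq_sqrt hn'.le]; field_simp
  have key' : (n : ℂ) * ((u / (σ * √n) : ℝ) : ℂ) ^ 2 = ((u ^ 2 / σ ^ 2 : ℝ) : ℂ) := by
    rw [← key]; push_cast; ring
  rw [← key']
  generalize ((u / (σ * √n) : ℝ)) = θ
  push_cast
  linear_combination ((n:ℂ) * θ ^ 2 * L2 (θ * Complex.I)) * Complex.I_sq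

lemma theta_tendsto {σ : ℝ} (hσ : 0 < σ) (u : ℝ) :
    Tendsto (fun n : ℕ => (((u / (σ * √n) : ℝ) : ℂ) * Complex.I)) atTop (nhds 0) := by
  have h1 : Tendsto (fun n : ℕ => u / (σ * √(n : ℝ))) atTop (nhds 0) := by
    apply Tendsto.div_atTop tendsto_const_nhds
    exact Tendsto.const_mul_atTop hσ (Real.tendsto_sqrt_atTop.comp tendsto_natCast_atTop_atTop)
  have h2 := (Complex.continuous_ofReal.tendsto 0).comp h1
  have h3 := h2.mul_const Complex.I
  simpa using h3

lemma psi_tendsto {p : ℕ → ℕ → ℝ} {L : ℂ → ℂ} {δ K : ℝ} (h : QPH p L δ K) {μ σ : ℝ} (hσ : 0 < σ)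
    (h1 : deriv L 0 = μ) (h2 : deriv (deriv L) 0 = ((σ ^ 2 : ℝ) : ℂ)) (u : ℝ) :
    Tendsto (fun n => psi p μ σ n u) atTop (nhds (Complex.exp (-(u ^ 2 / 2)))) := by
  obtain ⟨L2, hc, hz, hL2⟩ := taylor2 h.pos h.diff h.zero
  rw [h1] at hL2
  obtain ⟨C, hC⟩ := Rn_sub_one h
  have ht := theta_tendsto hσ u
  have hR : Tendsto (fun n : ℕ => Rn p L n ((u / (σ * √n) : ℝ) * Complex.I)) atTop (nhds 1) := by
    rw [tendsto_iff_norm_sub_tendsto_zero]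
    have hb : ∀ᶠ n : ℕ in atTop, (((u / (σ * √n) : ℝ) : ℂ) * Complex.I) ∈ Metric.ball (0 : ℂ) (δ / 2) :=
      ht.eventually (Metric.ball_mem_nhds _ (by linarith [h.pos]))
    have hg : Tendsto (fun n : ℕ => C * ‖(((u / (σ * √n) : ℝ) : ℂ) * Complex.I)‖) atTop (nhds 0) := by
      simpa using ht.norm.const_mul C
    refine squeeze_zero' (Eventually.of_forall fun _ => norm_nonneg _) ?_ hg
    filter_upwards [hb] with n hn
    exact hC n _ hn
  have hE : Tendsto (fun n : ℕ => Complex.exp (-((u ^ 2 / σ ^ 2 : ℝ) : ℂ) *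
      L2 ((u / (σ * √n) : ℝ) * Complex.I))) atTop (nhds (Complex.exp (-(u ^ 2 / 2)))) := by
    have := (Complex.continuous_exp.tendsto _).comp
      ((hc.tendsto.comp ht).const_mul (-((u ^ 2 / σ ^ 2 : ℝ) : ℂ)))
    convert! this using 2
    rw [hz, h2]
    congr 1
    have : (σ : ℂ) ≠ 0 := by exact_mod_cast hσ.ne'
    push_cast
    field_simp
  have := hR.mul hE
  rw [one_mul] at this
  refine this.congr' ?_
  filter_upwards [eventually_ge_atTop 1] with n hn
  rw [psi_eq hσ hL2 hn]

lemma psi_dom {p : ℕ → ℕ → ℝ} {L : ℂ → ℂ} {δ K : ℝ} (h : QPH p L δ K) {μ σ : ℝ} (hσ : 0 < σ)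
    (h1 : deriv L 0 = μ) (h2 : deriv (deriv L) 0 = ((σ ^ 2 : ℝ) : ℂ)) :
    ∃ C c : ℝ, 0 < c ∧ 0 ≤ C ∧ ∀ n : ℕ, 1 ≤ n → ∀ u : ℝ, |u| ≤ Real.pi * (σ * √n) →
      ‖psi p μ σ n u‖ ≤ C * Real.exp (-c * u ^ 2) := by
  obtain ⟨L2, hc, hz, hL2⟩ := taylor2 h.pos h.diff h.zero
  rw [h1] at hL2
  have hδ := h.pos
  have hev : ∀ᶠ s in nhds (0 : ℂ), σ ^ 2 / 4 < (L2 s).re := by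
    have : Tendsto (fun s => (L2 s).re) (nhds 0) (nhds (σ ^ 2 / 2)) := by
      have := (Complex.continuous_re.tendsto _).comp hc.tendsto
      rw [hz, h2] at this
      have e : (((σ ^ 2 : ℝ) : ℂ) / 2).re = σ ^ 2 / 2 := by
        have : (((σ ^ 2 : ℝ) : ℂ) / 2) = ((σ ^ 2 / 2 : ℝ) : ℂ) := by push_cast; ring
        rw [this, Complex.ofReal_re]
      rwa [e] at this
    exact this.eventually_const_lt (by have := pow_pos hσ 2; linarith)
  obtain ⟨η0, hη0, hη0'⟩ := Metric.eventually_nhds_iff_ball.1 hev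
  set η := min η0 δ with hη
  have hηpos : 0 < η := lt_min hη0 hδ
  obtain ⟨K', κ, hK', hκ0, hκ1, hA⟩ := h.away η hηpos
  set κ' := max κ (1 / 2) with hκ'
  have hκ'0 : 0 < κ' := lt_of_lt_of_le (by norm_num) (le_max_right _ _)
  have hκ'1 : κ' < 1 := max_lt hκ1 (by norm_num)
  have hlog : Real.log κ' < 0 := Real.log_neg hκ'0 hκ'1
  set c1 := -Real.log κ' / (Real.pi ^ 2 * σ ^ 2) with hc1
  have hpi := Real.pi_pos
  have hc1p : 0 < c1 := by rw [hc1]; apply div_pos (by linarith); positivity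
  have hK : 0 ≤ K := (norm_nonneg _).trans (h.bound 0 (Metric.mem_ball_self hδ) 0)
  refine ⟨max K K', min (1 / 4) c1, lt_min (by norm_num) hc1p, le_max_of_le_left hK, fun n hn u hu => ?_⟩
  have hn' : (0 : ℝ) < n := by exact_mod_cast hn
  have hsq : 0 < σ * √n := by have := Real.sqrt_pos.2 hn'; positivity
  by_cases hθ : |u / (σ * √n)| < η
  · have hs : ‖(((u / (σ * √n) : ℝ) : ℂ) * Complex.I)‖ < η := by
      rw [norm_mul, Complex.norm_I, mul_one, Complex.norm_real, Real.norm_eq_abs]; exact hθ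
    rw [psi_eq hσ hL2 hn, norm_mul, Complex.norm_exp]
    have hb := h.bound _ (mem_ball_zero_iff.2 (hs.trans_le (min_le_right _ _))) n
    have hr := hη0' _ (mem_ball_zero_iff.2 (hs.trans_le (min_le_left _ _)))
    apply mul_le_mul (hb.trans (le_max_left _ _)) _ (Real.exp_nonneg _) (le_max_of_le_left hK)
    apply Real.exp_le_exp.2
    have e : (-((u ^ 2 / σ ^ 2 : ℝ) : ℂ) * L2 ((u / (σ * √n) : ℝ) * Complex.I)).re =
      -(u ^ 2 / σ ^ 2) * (L2 ((u / (σ * √n) : ℝ) * Complex.I)).re := by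
      rw [← Complex.ofReal_neg, Complex.re_ofReal_mul]
    rw [e]
    have h4 : u ^ 2 / σ ^ 2 * (σ ^ 2 / 4) = u ^ 2 / 4 := by field_simp
    have h5 : u ^ 2 / σ ^ 2 * (σ ^ 2 / 4) ≤ u ^ 2 / σ ^ 2 * (L2 ((u / (σ * √n) : ℝ) * Complex.I)).re :=
      mul_le_mul_of_nonneg_left hr.le (by positivity)
    have h6 : min (1 / 4) c1 * u ^ 2 ≤ 1 / 4 * u ^ 2 :=
      mul_le_mul_of_nonneg_right (min_le_left _ _) (sq_nonneg u)
    linarith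
  · push Not at hθ
    rw [norm_psi]
    have hθ2 : |u / (σ * √n)| ≤ Real.pi := by
      rw [abs_div, abs_of_pos hsq, div_le_iff₀ hsq]; exact hu
    refine (hA n _ hθ hθ2).trans ?_
    apply mul_le_mul (le_max_right _ _) _ (pow_nonneg hκ0 n) (le_max_of_le_left hK)
    refine (pow_le_pow_left₀ hκ0 (le_max_left κ (1 / 2)) n).trans ?_
    rw [← hκ', ← Real.exp_log (pow_pos hκ'0 n), Real.log_pow]
    apply Real.exp_le_exp.2
    have hu2 : u ^ 2 ≤ Real.pi ^ 2 * σ ^ 2 * n := by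
      have := pow_le_pow_left₀ (abs_nonneg u) hu 2
      rw [sq_abs] at this
      calc u ^ 2 ≤ _ := this
        _ = _ := by rw [mul_pow, mul_pow, Real.sq_sqrt hn'.le]; ring
    have h6 : min (1 / 4) c1 * u ^ 2 ≤ c1 * u ^ 2 :=
      mul_le_mul_of_nonneg_right (min_le_right _ _) (sq_nonneg u)
    have h7 : c1 * u ^ 2 ≤ c1 * (Real.pi ^ 2 * σ ^ 2 * n) := by gcongr
    have h8 : c1 * (Real.pi ^ 2 * σ ^ 2 * n) = -(n * Real.log κ') := by
      rw [hc1]; field_simp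
    linarith

lemma L1_tendsto {p : ℕ → ℕ → ℝ} {L : ℂ → ℂ} {δ K : ℝ} (h : QPH p L δ K) {μ σ : ℝ} (hσ : 0 < σ)
    (h1 : deriv L 0 = μ) (h2 : deriv (deriv L) 0 = ((σ ^ 2 : ℝ) : ℂ)) :
    Tendsto (fun n : ℕ => ∫ u : ℝ, ‖(Set.Ioc (-(Real.pi * (σ * √n))) (Real.pi * (σ * √n))).indicator
      (psi p μ σ n) u - Complex.exp (-(u ^ 2 / 2))‖) atTop (nhds 0) := by
  obtain ⟨C, c, hc, hC, hb⟩ := psi_dom h hσ h1 h2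
  have hg : Continuous fun u : ℝ => Complex.exp (-((u : ℂ) ^ 2 / 2)) := by fun_prop
  have key := tendsto_integral_filter_of_dominated_convergence (μ := volume) (l := (atTop : Filter ℕ))
    (F := fun (n : ℕ) (u : ℝ) => ‖(Set.Ioc (-(Real.pi * (σ * √n))) (Real.pi * (σ * √n))).indicator
      (psi p μ σ n) u - Complex.exp (-(u ^ 2 / 2))‖) (f := fun _ => 0)
    (fun u => C * Real.exp (-c * u ^ 2) + Real.exp (-(1 / 2) * u ^ 2)) ?_ ?_ ?_ ?_
  · simpa using key
  · refine Eventually.of_forall fun n => ?_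
    exact (((psi_continuous p μ σ n).aestronglyMeasurable.indicator measurableSet_Ioc).sub
      hg.aestronglyMeasurable).norm
  · filter_upwards [eventually_ge_atTop 1] with n hn
    refine Eventually.of_forall fun u => ?_
    rw [norm_norm]
    refine (norm_sub_le _ _).trans (add_le_add ?_ ?_)
    · by_cases hu : u ∈ Set.Ioc (-(Real.pi * (σ * √n))) (Real.pi * (σ * √n))
      · rw [Set.indicator_of_mem hu]
        exact hb n hn u (abs_le.2 ⟨hu.1.le, hu.2⟩)
      · rw [Set.indicator_of_notMem hu, norm_zero]; positivity
    · have : (-((u : ℂ) ^ 2 / 2)) = ((-(1 / 2) * u ^ 2 : ℝ) : ℂ) := by push_cast; ring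
      rw [this, Complex.norm_exp_ofReal]
  · exact ((integrable_exp_neg_mul_sq hc).const_mul C).add (integrable_exp_neg_mul_sq (by norm_num))
  · refine Eventually.of_forall fun u => ?_
    have hp := psi_tendsto h hσ h1 h2 u
    rw [tendsto_iff_norm_sub_tendsto_zero] at hp
    refine hp.congr' ?_
    have hat : Tendsto (fun n : ℕ => Real.pi * (σ * √(n : ℝ))) atTop atTop :=
      Tendsto.const_mul_atTop Real.pi_pos
        (Tendsto.const_mul_atTop hσ (Real.tendsto_sqrt_atTop.comp tendsto_natCast_atTop_atTop))
    filter_upwards [hat.eventually_gt_atTop |u|] with n hn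
    rw [Set.indicator_of_mem]
    have := abs_lt.1 hn
    exact ⟨this.1, this.2.le⟩

def pz (p : ℕ → ℕ → ℝ) (n : ℕ) (k : ℤ) : ℝ :=
  ∑ j ∈ Finset.range (n + 1), if (j : ℤ) = k then p n j else 0

lemma integral_exp_int (m : ℤ) : (∫ θ in (-Real.pi)..Real.pi, Complex.exp ((m : ℂ) * Complex.I * θ)) =
    if m = 0 then ((2 * Real.pi : ℝ) : ℂ) else 0 := by
  split_ifs with h
  · subst h
    simp
    ring
  · have hc : (m : ℂ) * Complex.I ≠ 0 := mul_ne_zero (by exact_mod_cast h) Complex.I_ne_zero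
    rw [integral_exp_mul_complex hc]
    have : Complex.exp ((m : ℂ) * Complex.I * (Real.pi : ℝ)) =
        Complex.exp ((m : ℂ) * Complex.I * ((-Real.pi : ℝ) : ℂ)) := by
      have e : (m : ℂ) * Complex.I * (Real.pi : ℝ) = (m : ℂ) * Complex.I * ((-Real.pi : ℝ) : ℂ) +
          m * (2 * Real.pi * Complex.I) := by push_cast; ring
      rw [e, Complex.exp_add, Complex.exp_int_mul_two_pi_mul_I, mul_one]
    rw [this, sub_self, zero_div]

lemma fourier_coef (p : ℕ → ℕ → ℝ) (n : ℕ) (k : ℤ) :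
    (∫ θ in (-Real.pi)..Real.pi, cf p n (θ * Complex.I) * Complex.exp (-(k * θ) * Complex.I)) =
      ((2 * Real.pi : ℝ) : ℂ) * pz p n k := by
  have e : ∀ θ : ℝ, cf p n (θ * Complex.I) * Complex.exp (-(k * θ) * Complex.I) =
      ∑ j ∈ Finset.range (n + 1), (p n j : ℂ) * Complex.exp ((((j : ℤ) - k : ℤ) : ℂ) * Complex.I * θ) := by
    intro θ
    unfold cf
    rw [Finset.sum_mul]
    refine Finset.sum_congr rfl fun j _ => ?_
    rw [mul_assoc, ← Complex.exp_add]
    congr 2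
    push_cast; ring
  simp_rw [e]
  rw [intervalIntegral.integral_finsetSum]
  · unfold pz
    push_cast
    rw [Finset.mul_sum]
    refine Finset.sum_congr rfl fun j _ => ?_
    have := integral_exp_int ((j : ℤ) - k)
    push_cast at this
    rw [intervalIntegral.integral_const_mul, this]
    by_cases hj : (j : ℤ) = k
    · rw [if_pos (by omega), if_pos hj]; ring
    · rw [if_neg (by omega), if_neg hj]; simp
  · intro j _
    apply Continuous.intervalIntegrable
    fun_prop

lemma local_eq (p : ℕ → ℕ → ℝ) {μ σ : ℝ} (hσ : 0 < σ) {n : ℕ} (hn : 1 ≤ n) (k : ℤ) :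
    ((2 * Real.pi : ℝ) : ℂ) * ((σ * √n * pz p n k : ℝ) : ℂ) =
      ∫ u : ℝ, (Set.Ioc (-(Real.pi * (σ * √n))) (Real.pi * (σ * √n))).indicator (psi p μ σ n) u *
        Complex.exp (Complex.I * ((-((k - μ * n) / (σ * √n)) : ℝ) : ℂ) * u) := by
  have hn' : (0 : ℝ) < n := by exact_mod_cast hn
  have hS : 0 < σ * √n := by have := Real.sqrt_pos.2 hn'; positivity
  have h1 := intervalIntegral.integral_comp_div (a := -(Real.pi * (σ * √n))) (b := Real.pi * (σ * √n))
    (fun θ : ℝ => cf p n (θ * Complex.I) * Complex.exp (-(k * θ) * Complex.I)) hS.ne'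
  rw [neg_div, mul_div_cancel_right₀ _ hS.ne', fourier_coef,
    intervalIntegral.integral_of_le (by have := Real.pi_pos; have : 0 < Real.pi * (σ * √n) := by positivity
                                        linarith)] at h1
  have h2 : ((2 * Real.pi : ℝ) : ℂ) * ((σ * √n * pz p n k : ℝ) : ℂ) =
      (σ * √n) • (((2 * Real.pi : ℝ) : ℂ) * pz p n k) := by
    rw [Complex.real_smul]; push_cast; ring
  rw [h2, ← h1, ← integral_indicator measurableSet_Ioc]
  congr 1
  ext u
  by_cases hu : u ∈ Set.Ioc (-(Real.pi * (σ * √n))) (Real.pi * (σ * √n))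
  · rw [Set.indicator_of_mem hu, Set.indicator_of_mem hu]
    unfold psi
    rw [mul_assoc, ← Complex.exp_add]
    congr 2
    push_cast
    ring
  · rw [Set.indicator_of_notMem hu, Set.indicator_of_notMem hu, zero_mul]

lemma pdf_eq (x : ℝ) : ((2 * Real.pi : ℝ) : ℂ) * (stdGaussPDF x : ℂ) =
    ∫ u : ℝ, Complex.exp (-(u ^ 2 / 2)) * Complex.exp (Complex.I * ((-x : ℝ) : ℂ) * u) := by
  have h := fourierIntegral_gaussian (b := 1 / 2) (by norm_num) ((-x : ℝ) : ℂ)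
  have e : ∀ u : ℝ, Complex.exp (-(u ^ 2 / 2)) * Complex.exp (Complex.I * ((-x : ℝ) : ℂ) * u) =
      Complex.exp (Complex.I * ((-x : ℝ) : ℂ) * u) * Complex.exp (-(1 / 2) * u ^ 2) := by
    intro u; rw [mul_comm]; congr 2; ring
  simp_rw [e]
  rw [h]
  have h2pi : (0 : ℝ) ≤ 2 * Real.pi := by have := Real.pi_pos; positivity
  have e1 : ((Real.pi : ℂ) / (1 / 2)) ^ (1 / 2 : ℂ) = ((√(2 * Real.pi) : ℝ) : ℂ) := by
    rw [Real.sqrt_eq_rpow, Complex.ofReal_cpow h2pi]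
    push_cast
    congr 1
    ring
  have e2 : Complex.exp (-((-x : ℝ) : ℂ) ^ 2 / (4 * (1 / 2))) = ((Real.exp (-x ^ 2 / 2) : ℝ) : ℂ) := by
    push_cast
    congr 1
    ring
  rw [e1, e2, ← Complex.ofReal_mul, ← Complex.ofReal_mul]
  congr 1
  unfold stdGaussPDF
  have h3 : √(2 * Real.pi) ≠ 0 := (Real.sqrt_pos.2 (by have := Real.pi_pos; positivity)).ne'
  have h4 := Real.mul_self_sqrt h2pi
  rw [← mul_assoc]
  congr 1
  field_simp
  nlinarith

lemma llt {p : ℕ → ℕ → ℝ} {L : ℂ → ℂ} {δ K : ℝ} (h : QPH p L δ K) {μ σ : ℝ} (hσ : 0 < σ)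
    (h1 : deriv L 0 = μ) (h2 : deriv (deriv L) 0 = ((σ ^ 2 : ℝ) : ℂ)) (ε : ℝ) (hε : 0 < ε) :
    ∃ N : ℕ, ∀ n ≥ N, ∀ k : ℤ,
      |σ * √n * pz p n k - stdGaussPDF ((k - μ * n) / (σ * √n))| ≤ ε := by
  have hT := L1_tendsto h hσ h1 h2
  have hpi := Real.pi_pos
  have hev := hT.eventually (gt_mem_nhds (show (0 : ℝ) < 2 * Real.pi * ε by positivity))
  obtain ⟨N, hN⟩ := eventually_atTop.1 (hev.and (eventually_ge_atTop 1))
  refine ⟨N, fun n hn k => ?_⟩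
  obtain ⟨hlt, hn1⟩ := hN n hn
  have hi1 : Integrable (fun u : ℝ => (Set.Ioc (-(Real.pi * (σ * √n))) (Real.pi * (σ * √n))).indicator
      (psi p μ σ n) u * Complex.exp (Complex.I * ((-((k - μ * n) / (σ * √n)) : ℝ) : ℂ) * u)) := by
    have : (fun u : ℝ => (Set.Ioc (-(Real.pi * (σ * √n))) (Real.pi * (σ * √n))).indicator
      (psi p μ σ n) u * Complex.exp (Complex.I * ((-((k - μ * n) / (σ * √n)) : ℝ) : ℂ) * u)) =
      (Set.Ioc (-(Real.pi * (σ * √n))) (Real.pi * (σ * √n))).indicator (fun u : ℝ =>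
      psi p μ σ n u * Complex.exp (Complex.I * ((-((k - μ * n) / (σ * √n)) : ℝ) : ℂ) * u)) := by
      ext u
      by_cases hu : u ∈ Set.Ioc (-(Real.pi * (σ * √n))) (Real.pi * (σ * √n))
      · simp [Set.indicator_of_mem hu]
      · simp [Set.indicator_of_notMem hu]
    rw [this, integrable_indicator_iff measurableSet_Ioc]
    have := psi_continuous p μ σ n
    exact (Continuous.integrableOn_Icc (by fun_prop)).mono_set Set.Ioc_subset_Icc_self
  have hi2 : Integrable (fun u : ℝ => Complex.exp (-((u : ℂ) ^ 2 / 2)) *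
      Complex.exp (Complex.I * ((-((k - μ * n) / (σ * √n)) : ℝ) : ℂ) * u)) := by
    have := integrable_cexp_quadratic (b := 1 / 2) (by norm_num)
      (Complex.I * ((-((k - μ * n) / (σ * √n)) : ℝ) : ℂ)) 0
    refine this.congr (Eventually.of_forall fun u => ?_)
    simp only
    rw [← Complex.exp_add]
    congr 1
    ring
  have key : ((2 * Real.pi : ℝ) : ℂ) * ((σ * √n * pz p n k -
      stdGaussPDF ((k - μ * n) / (σ * √n)) : ℝ) : ℂ) = ∫ u : ℝ,
      ((Set.Ioc (-(Real.pi * (σ * √n))) (Real.pi * (σ * √n))).indicator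
      (psi p μ σ n) u - Complex.exp (-(u ^ 2 / 2))) *
        Complex.exp (Complex.I * ((-((k - μ * n) / (σ * √n)) : ℝ) : ℂ) * u) := by
    rw [Complex.ofReal_sub, mul_sub, local_eq p (μ := μ) hσ hn1, pdf_eq, ← integral_sub hi1 hi2]
    congr 1
    ext u
    ring
  have hb := norm_integral_le_integral_norm (μ := volume) (fun u : ℝ =>
      ((Set.Ioc (-(Real.pi * (σ * √n))) (Real.pi * (σ * √n))).indicator
      (psi p μ σ n) u - Complex.exp (-((u : ℂ) ^ 2 / 2))) *
        Complex.exp (Complex.I * ((-((k - μ * n) / (σ * √n)) : ℝ) : ℂ) * u))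
  rw [← key, norm_mul, Complex.norm_real, Complex.norm_real, Real.norm_eq_abs, Real.norm_eq_abs,
    abs_of_pos (by positivity)] at hb
  have hne : ∀ u : ℝ, ‖Complex.exp (Complex.I * ((-((k - μ * n) / (σ * √n)) : ℝ) : ℂ) * u)‖ = 1 := by
    intro u
    have : Complex.I * ((-((k - μ * n) / (σ * √n)) : ℝ) : ℂ) * u =
      ((-((k - μ * n) / (σ * √n)) * u : ℝ) : ℂ) * Complex.I := by push_cast; ring
    rw [this, Complex.norm_exp_ofReal_mul_I]
  simp_rw [norm_mul, hne, mul_one] at hb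
  have h3 := hb.trans hlt.le
  exact le_of_mul_le_mul_left h3 (by positivity)

def xk (μ σ : ℝ) (n j : ℕ) : ℝ := ((j : ℝ) - μ * n) / (σ * √n)

def lawn (p : ℕ → ℕ → ℝ) (μ σ : ℝ) (n : ℕ) : Measure ℝ :=
  ∑ j ∈ Finset.range (n + 1), ENNReal.ofReal (p n j) • Measure.dirac (xk μ σ n j)

lemma lawn_apply (p : ℕ → ℕ → ℝ) (hp : ∀ n k, 0 ≤ p n k) (μ σ : ℝ) (n : ℕ) {S : Set ℝ}
    (hS : MeasurableSet S) [DecidablePred (· ∈ S)] :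
    lawn p μ σ n S = ENNReal.ofReal (∑ j ∈ Finset.range (n + 1), if xk μ σ n j ∈ S then p n j else 0) := by
  unfold lawn
  rw [Measure.finsetSum_apply, ENNReal.ofReal_sum_of_nonneg]
  · refine Finset.sum_congr rfl fun j _ => ?_
    rw [Measure.smul_apply, Measure.dirac_apply' _ hS]
    by_cases h : xk μ σ n j ∈ S
    · simp [h]
    · simp [h]
  · intro j _
    split_ifs
    · exact hp _ _
    · exact le_rfl

lemma lawn_prob {p : ℕ → ℕ → ℝ} {L : ℂ → ℂ} {δ K : ℝ} (h : QPH p L δ K) (μ σ : ℝ) (n : ℕ) :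
    IsProbabilityMeasure (lawn p μ σ n) := by
  classical
  constructor
  rw [lawn_apply p h.nonneg μ σ n MeasurableSet.univ]
  simp [h.sum_one n]

lemma lawn_charFun {p : ℕ → ℕ → ℝ} {L : ℂ → ℂ} {δ K : ℝ} (h : QPH p L δ K) (μ σ : ℝ) (n : ℕ) (u : ℝ) :
    charFun (lawn p μ σ n) u = psi p μ σ n u := by
  rw [charFun_apply_real]
  unfold lawn psi cf
  rw [integral_finsetSum_measure]
  · rw [Finset.sum_mul]
    refine Finset.sum_congr rfl fun j _ => ?_
    rw [integral_smul_measure, integral_dirac, ENNReal.toReal_ofReal (h.nonneg n j), Complex.real_smul,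
      mul_assoc (p n j : ℂ), ← Complex.exp_add]
    congr 2
    unfold xk
    push_cast
    ring
  · intro j _
    apply Integrable.smul_measure _ ENNReal.ofReal_ne_top
    apply integrable_dirac
    exact enorm_lt_top

lemma gauss_Iic (x : ℝ) : ((ProbabilityTheory.gaussianReal 0 1) (Set.Iic x)).toReal = stdGaussCDF x := by
  rw [ProbabilityTheory.gaussianReal_apply_eq_integral _ one_ne_zero, ENNReal.toReal_ofReal]
  · unfold stdGaussCDF ProbabilityTheory.gaussianPDFReal
    rw [integral_const_mul]
    simp
  · exact setIntegral_nonneg measurableSet_Iic fun y _ => ProbabilityTheory.gaussianPDFReal_nonneg _ _ _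

lemma clt {p : ℕ → ℕ → ℝ} {L : ℂ → ℂ} {δ K : ℝ} (h : QPH p L δ K) {μ σ : ℝ} (hσ : 0 < σ)
    (h1 : deriv L 0 = μ) (h2 : deriv (deriv L) 0 = ((σ ^ 2 : ℝ) : ℂ)) (x : ℝ) :
    Tendsto (fun n : ℕ => ∑ j ∈ Finset.range (n + 1), if xk μ σ n j ≤ x then p n j else 0) atTop
      (nhds (stdGaussCDF x)) := by
  classical
  let ν : ℕ → ProbabilityMeasure ℝ := fun n => ⟨lawn p μ σ n, lawn_prob h μ σ n⟩
  let ν0 : ProbabilityMeasure ℝ := ⟨ProbabilityTheory.gaussianReal 0 1, inferInstance⟩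
  have ht : Tendsto ν atTop (nhds ν0) := by
    apply ProbabilityMeasure.tendsto_of_tendsto_charFun
    intro u
    have e : charFun (ν0 : Measure ℝ) u = Complex.exp (-(u ^ 2 / 2)) := by
      show charFun (ProbabilityTheory.gaussianReal 0 1) u = _
      rw [ProbabilityTheory.charFun_gaussianReal]
      congr 1
      simp
    rw [e]
    refine (psi_tendsto h hσ h1 h2 u).congr fun n => ?_
    exact (lawn_charFun h μ σ n u).symm
  have hfr : (ν0 : Measure ℝ) (frontier (Set.Iic x)) = 0 := by
    rw [frontier_Iic]
    have := ProbabilityTheory.nullSingletonClass_gaussianReal (μ := 0) (v := 1) one_ne_zero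
    exact measure_singleton (μ := ProbabilityTheory.gaussianReal 0 1) x
  have hm := ProbabilityMeasure.tendsto_measure_of_null_frontier_of_tendsto' ht hfr
  have hr := (ENNReal.tendsto_toReal (measure_ne_top _ _)).comp hm
  have e0 : ((ν0 : Measure ℝ) (Set.Iic x)).toReal = stdGaussCDF x := gauss_Iic x
  rw [e0] at hr
  refine hr.congr fun n => ?_
  show (lawn p μ σ n (Set.Iic x)).toReal = _
  rw [lawn_apply p h.nonneg μ σ n measurableSet_Iic, ENNReal.toReal_ofReal]
  · rfl
  · refine Finset.sum_nonneg fun j _ => ?_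
    split_ifs
    · exact h.nonneg _ _
    · exact le_rfl

def pfo (t : ℕ) (n k : ℕ) : ℝ := (Nl 1 t k 1 n : ℝ) / forestCount t 1 n

lemma forestCount_cast (t n : ℕ) : Pw 1 t 1 n 1 = (forestCount t 1 n : ℂ) := by
  rw [Pw_one, forestCount_eq]; push_cast; rfl

lemma cf_pfo (t n : ℕ) (s : ℂ) : cf (pfo t) n s = Pw 1 t 1 n (Complex.exp s) / forestCount t 1 n := by
  unfold cf pfo Pw
  rw [Finset.sum_div]
  refine Finset.sum_congr rfl fun k _ => ?_
  rw [← Complex.exp_nat_mul]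
  push_cast
  ring

lemma exp_I_ne_one {θ η : ℝ} (hη : 0 < η) (h1 : η ≤ |θ|) (h2 : |θ| ≤ Real.pi) :
    Complex.exp (θ * Complex.I) ≠ 1 := by
  intro h
  rw [Complex.exp_eq_one_iff] at h
  obtain ⟨m, hm⟩ := h
  have h3 : (θ : ℂ) = ((m * (2 * Real.pi) : ℝ) : ℂ) := by
    apply mul_right_cancel₀ Complex.I_ne_zero
    rw [hm]; push_cast; ring
  have h4 : θ = m * (2 * Real.pi) := by exact_mod_cast h3
  have hpi := Real.pi_pos
  rw [h4, abs_mul, abs_of_pos (by positivity : 0 < 2 * Real.pi)] at h1 h2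
  have h5 : |(m : ℝ)| < 1 := by nlinarith
  have h6 : |m| < 1 := by exact_mod_cast h5
  have h7 : m = 0 := Int.abs_lt_one_iff.1 h6
  rw [h7] at h1
  simp at h1
  linarith

lemma forest_QPH (t : ℕ) (ht : 2 ≤ t) {q₀ : ℝ} (h0 : 0 < q₀) (h1 : q₀ < 0.58)
    (hr : aS t 0 1 q₀ = 0) (hu : ∀ q : ℂ, ‖q‖ ≤ 0.58 → aS t 0 1 q = 0 → q = q₀)
    (hD : SF (dQ (bet t 0)) 1 q₀ ≠ 0) :
    ∃ (L : ℂ → ℂ) (δ K : ℝ), AnalyticAt ℂ L 0 ∧ L 0 = 0 ∧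
      (∀ᶠ s in nhds 0, aS t 0 (Complex.exp s) (q₀ * Complex.exp (-L s)) = 0) ∧ QPH (pfo t) L δ K := by
  obtain ⟨L, hLa, hL0, hLe, ⟨K, hK⟩, m, hm, hmn⟩ := quasi_power t ht h0 h1 hr hu hD
  have hcp : ∀ n, (0 : ℝ) < forestCount t 1 n := by
    intro n
    have := hmn n
    rw [forestCount_cast] at this
    by_contra hc
    have hc' : (forestCount t 1 n : ℝ) = 0 := le_antisymm (not_lt.1 hc) (Nat.cast_nonneg _)
    have hc2 : forestCount t 1 n = 0 := by exact_mod_cast hc'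
    rw [hc2] at this
    simp at this
    linarith
  have hcm : ∀ n, m ≤ q₀ ^ n * forestCount t 1 n := by
    intro n
    have := hmn n
    rw [forestCount_cast] at this
    simpa using this
  obtain ⟨δ, hδ, hδ'⟩ := Metric.eventually_nhds_iff_ball.1 (hK.and hLa.eventually_analyticAt)
  refine ⟨L, δ, K / m, hLa, hL0, hLe, ?_⟩
  constructor
  · intro n k; unfold pfo; positivity
  · intro n
    unfold pfo
    rw [← Finset.sum_div]
    have := forestCount_eq t 1 n
    rw [div_eq_one_iff_eq (hcp n).ne', this]
    push_cast; rfl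
  · exact hδ
  · intro s hs
    exact (hδ' s hs).2.differentiableAt.differentiableWithinAt
  · exact hL0
  · intro s hs n
    have hb := (hδ' s hs).1 n
    have hK0 : 0 ≤ K := (norm_nonneg _).trans hb
    rw [cf_pfo]
    have e : Pw 1 t 1 n (Complex.exp s) / forestCount t 1 n * Complex.exp (-(n * L s)) =
      (q₀ ^ n * Pw 1 t 1 n (Complex.exp s) * Complex.exp (-(n * L s))) / (q₀ ^ n * forestCount t 1 n) := by
      have hc : (forestCount t 1 n : ℂ) ≠ 0 := by exact_mod_cast (hcp n).ne'
      have hq : (q₀ : ℂ) ≠ 0 := by exact_mod_cast h0.ne'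
      field_simp
    rw [e, norm_div]
    have e2 : ‖((q₀ : ℂ) ^ n * (forestCount t 1 n : ℂ))‖ = q₀ ^ n * forestCount t 1 n := by
      simp [abs_of_pos h0]
    rw [e2]
    exact div_le_div₀ hK0 hb hm (hcm n)
  · intro η hη
    have hWc : IsCompact ((fun θ : ℝ => Complex.exp (θ * Complex.I)) '' {θ : ℝ | η ≤ |θ| ∧ |θ| ≤ Real.pi}) := by
      apply IsCompact.image _ (by fun_prop)
      apply Metric.isCompact_of_isClosed_isBounded
      · exact (isClosed_le continuous_const continuous_abs).inter (isClosed_le continuous_abs continuous_const)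
      · apply (Metric.isBounded_closedBall (x := (0 : ℝ)) (r := Real.pi)).subset
        intro θ hθ
        rw [Metric.mem_closedBall, dist_zero_right, Real.norm_eq_abs]
        exact hθ.2
    obtain ⟨K', κ, hK', hκ, hκ1, hA⟩ := away_bound t ht h0 h1 hr hWc (by
      rintro w ⟨θ, hθ, rfl⟩
      exact ⟨Complex.norm_exp_ofReal_mul_I θ, exp_I_ne_one hη hθ.1 hθ.2⟩)
    refine ⟨K' / m, κ, by positivity, hκ, hκ1, fun n θ hθ1 hθ2 => ?_⟩
    have hb := hA n _ ⟨θ, ⟨hθ1, hθ2⟩, rfl⟩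
    rw [cf_pfo, norm_div, Complex.norm_natCast]
    have e : ‖Pw 1 t 1 n (Complex.exp (θ * Complex.I))‖ / (forestCount t 1 n : ℝ) =
      (q₀ ^ n * ‖Pw 1 t 1 n (Complex.exp (θ * Complex.I))‖) / (q₀ ^ n * forestCount t 1 n) := by
      have hc := (hcp n).ne'
      field_simp
    rw [e]
    refine (div_le_div₀ (by positivity) hb hm (hcm n)).trans (le_of_eq ?_)
    ring

lemma forest_asymp {t : ℕ} {L : ℂ → ℂ} {δ K : ℝ} (h : QPH (pfo t) L δ K) {μ σ : ℝ} (hσ : 0 < σ)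
    (h1 : deriv L 0 = μ) (h2 : deriv (deriv L) 0 = ((σ ^ 2 : ℝ) : ℂ)) :
    (∃ C : ℝ, ∀ n : ℕ, 1 ≤ n → |forestExp t 1 n (fun T => (T.height : ℝ)) - μ * n| ≤ C) ∧
    (∃ C : ℝ, ∀ n : ℕ, 1 ≤ n → |forestVar t 1 n (fun T => (T.height : ℝ)) - σ ^ 2 * n| ≤ C) ∧
    (∀ x : ℝ, Tendsto (fun n : ℕ => forestProb t 1 n
      {T | ((T.height : ℝ) - μ * n) / (σ * Real.sqrt n) ≤ x}) atTop (nhds (stdGaussCDF x))) ∧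
    (∀ ε : ℝ, 0 < ε → ∃ N : ℕ, ∀ n : ℕ, N ≤ n → ∀ k : ℤ,
      |σ * Real.sqrt n * forestProb t 1 n {T | (T.height : ℤ) = k} -
        stdGaussPDF ((k - μ * n) / (σ * Real.sqrt n))| ≤ ε) := by
  classical
  obtain ⟨C, hC⟩ := mean_var h
  have hE1 : ∀ n, forestExp t 1 n (fun T => (T.height : ℝ)) = ∑ k ∈ Finset.range (n + 1), pfo t n k * k := by
    intro n
    rw [forestExp_eq t 1 n (fun k => (k : ℝ)), Finset.sum_div]
    refine Finset.sum_congr rfl fun k _ => ?_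
    unfold pfo; ring
  have hE2 : ∀ n, forestExp t 1 n (fun T => (T.height : ℝ) ^ 2) =
      ∑ k ∈ Finset.range (n + 1), pfo t n k * (k : ℝ) ^ 2 := by
    intro n
    rw [forestExp_eq t 1 n (fun k => (k : ℝ) ^ 2), Finset.sum_div]
    refine Finset.sum_congr rfl fun k _ => ?_
    unfold pfo; ring
  have hP : ∀ n (S : Set ℕ), forestProb t 1 n {T | T.height ∈ S} =
      ∑ k ∈ Finset.range (n + 1), if k ∈ S then pfo t n k else 0 := by
    intro n S
    rw [forestProb_eq, Finset.sum_div]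
    refine Finset.sum_congr rfl fun k _ => ?_
    unfold pfo
    by_cases hk : k ∈ S
    · simp [hk]
    · simp [hk]
  refine ⟨⟨C, fun n _ => ?_⟩, ⟨C, fun n _ => ?_⟩, fun x => ?_, fun ε hε => ?_⟩
  · have := (hC n).1
    rw [h1, ← Complex.ofReal_natCast, ← Complex.ofReal_mul, ← Complex.ofReal_sub, Complex.norm_real,
      Real.norm_eq_abs] at this
    rw [hE1, mul_comm]; exact this
  · have := (hC n).2
    rw [h2, ← Complex.ofReal_natCast, ← Complex.ofReal_mul, ← Complex.ofReal_sub, Complex.norm_real,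
      Real.norm_eq_abs] at this
    unfold forestVar
    rw [hE1, hE2, mul_comm (σ ^ 2)]; exact this
  · refine (clt h hσ h1 h2 x).congr fun n => ?_
    refine Eq.trans ?_ (hP n {k | ((k : ℝ) - μ * n) / (σ * Real.sqrt n) ≤ x}).symm
    refine Finset.sum_congr rfl fun k _ => ?_
    by_cases hx : ((k : ℝ) - μ * n) / (σ * Real.sqrt n) ≤ x
    · exact (if_pos hx).trans (if_pos (by exact hx)).symm
    · exact (if_neg hx).trans (if_neg (by exact hx)).symm
  · obtain ⟨N, hN⟩ := llt h hσ h1 h2 ε hε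
    refine ⟨N, fun n hn k => ?_⟩
    have e : forestProb t 1 n {T | (T.height : ℤ) = k} = pz (pfo t) n k := by
      refine (hP n {j | (j : ℤ) = k}).trans ?_
      unfold pz
      refine Finset.sum_congr rfl fun j _ => ?_
      simp
    rw [e]
    exact hN n hn k

/-- tail of the series, divided by `phi 1` -/
def tau (t j : ℕ) (q : ℂ) : ℂ :=
  if j < 4 then 0 else (-1) ^ j * ∏ i ∈ Finset.range (j - 1), phi t (i + 2) q

def C4 (t : ℕ) : ℝ := 1.4 * 0.62 ^ (hp t 2 + hp t 3 + hp t 4)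

def Ct (t j : ℕ) : ℝ := if j < 4 then 0 else C4 t * (1 / 100) ^ (j - 4)

lemma C4_pos (t : ℕ) : 0 < C4 t := by unfold C4; positivity

lemma hp_four_ge (t : ℕ) (ht : 2 ≤ t) : 15 ≤ hp t 4 := by
  rw [hp_succ, hp_three]; nlinarith

lemma norm_phi_le2 {t i k : ℕ} {A : ℝ} {q : ℂ} (hq : ‖q‖ ≤ 0.62) (hk : k ≤ hp t i)
    (hA : 1 ≤ A * (1 - 0.62 ^ k)) (hA0 : 0 ≤ A) (hk1 : 1 ≤ k) : ‖phi t i q‖ ≤ A * 0.62 ^ hp t i := by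
  unfold phi
  have h1 : ‖q ^ hp t i‖ ≤ 0.62 ^ hp t i := by rw [norm_pow]; gcongr
  have h2 : (0.62 : ℝ) ^ hp t i ≤ 0.62 ^ k := pow_le_pow_of_le_one (by norm_num) (by norm_num) hk
  have h2' : (0.62 : ℝ) ^ k < 1 := pow_lt_one₀ (by norm_num) (by norm_num) (by omega)
  have h3 : 1 - 0.62 ^ k ≤ ‖1 - q ^ hp t i‖ := by
    have := norm_sub_norm_le (1 : ℂ) (q ^ hp t i)
    rw [norm_one] at this; linarith
  have h4 : 0 < ‖1 - q ^ hp t i‖ := by linarith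
  rw [norm_div, div_le_iff₀ h4]
  have h5 : 1 ≤ A * ‖1 - q ^ hp t i‖ := hA.trans (by gcongr)
  have h6 : (0 : ℝ) ≤ 0.62 ^ hp t i := by positivity
  nlinarith

lemma norm_tau_le (t : ℕ) (ht : 2 ≤ t) (j : ℕ) {q : ℂ} (hq : ‖q‖ ≤ 0.62) : ‖tau t j q‖ ≤ Ct t j := by
  unfold tau Ct
  split_ifs with h
  · simp
  · obtain ⟨m, rfl⟩ : ∃ m, j = m + 4 := ⟨j - 4, by omega⟩
    rw [norm_mul, norm_pow, norm_neg, norm_one, one_pow, one_mul, norm_prod]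
    have e : m + 4 - 1 = 3 + m := by omega
    rw [e, Finset.prod_range_add, Nat.add_sub_cancel]
    apply mul_le_mul
    · rw [Finset.prod_range_succ, Finset.prod_range_succ, Finset.prod_range_one]
      have a1 : ‖phi t (0 + 2) q‖ ≤ 1.313 * 0.62 ^ hp t 2 :=
        norm_phi_le2 (k := 3) hq (by rw [hp_two]; omega) (by norm_num) (by norm_num) (by norm_num)
      have a2 : ‖phi t (1 + 2) q‖ ≤ 1.037 * 0.62 ^ hp t 3 :=
        norm_phi_le2 (k := 7) hq (by rw [hp_three]; nlinarith) (by norm_num) (by norm_num) (by norm_num)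
      have a3 : ‖phi t (2 + 2) q‖ ≤ 1.001 * 0.62 ^ hp t 4 :=
        norm_phi_le2 (k := 15) hq (hp_four_ge t ht) (by norm_num) (by norm_num) (by norm_num)
      calc ‖phi t (0 + 2) q‖ * ‖phi t (1 + 2) q‖ * ‖phi t (2 + 2) q‖
          ≤ (1.313 * 0.62 ^ hp t 2) * (1.037 * 0.62 ^ hp t 3) * (1.001 * 0.62 ^ hp t 4) := by gcongr
        _ = (1.313 * 1.037 * 1.001) * 0.62 ^ (hp t 2 + hp t 3 + hp t 4) := by rw [pow_add, pow_add]; ring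
        _ ≤ C4 t := by
          unfold C4
          gcongr
          norm_num
    · calc ∏ x ∈ Finset.range m, ‖phi t (3 + x + 2) q‖ ≤ ∏ x ∈ Finset.range m, (1 / 100 : ℝ) := by
            apply Finset.prod_le_prod (fun _ _ => norm_nonneg _)
            intro i _
            have h15 : 15 ≤ hp t (3 + i + 2) := (hp_four_ge t ht).trans (hp_mono t (by omega))
            exact (norm_phi_le (k := 15) (by norm_num) hq (by norm_num) h15).trans (by norm_num)
        _ = _ := by simp
    · exact Finset.prod_nonneg fun _ _ => norm_nonneg _
    · exact (C4_pos t).le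

lemma tau_diffOn (t : ℕ) (ht : 2 ≤ t) (j : ℕ) : DifferentiableOn ℂ (tau t j) (Metric.ball 0 0.62) := by
  unfold tau
  split_ifs with h
  · exact differentiableOn_const _
  · apply DifferentiableOn.const_mul
    apply DifferentiableOn.fun_finsetProd
    intro i _
    exact phi_diffOn t (i + 2) (by omega) (by omega) (by norm_num)

lemma Ct_nonneg (t j : ℕ) : 0 ≤ Ct t j := by
  unfold Ct
  have := C4_pos t
  split_ifs
  · exact le_rfl
  · positivity

/-- a tail bound majorant -/
def mj (M : ℝ) (k : ℕ) : ℝ := if k < 4 then 0 else M * (1 / 50) ^ (k - 4)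

lemma mj_hasSum (M : ℝ) : HasSum (mj M) (M * (50 / 49)) := by
  have h1 : HasSum (fun k : ℕ => mj M (k + 4)) (M * (50 / 49)) := by
    have := (hasSum_geometric_of_lt_one (r := (1 / 50 : ℝ)) (by norm_num) (by norm_num)).mul_left M
    convert! this using 1
    norm_num
  have h2 := (hasSum_nat_add_iff 4).1 h1
  have h3 : ∑ i ∈ Finset.range 4, mj M i = 0 := by
    apply Finset.sum_eq_zero
    intro i hi
    rw [Finset.mem_range] at hi
    simp [mj, hi]
  rwa [h3, add_zero] at h2

lemma mj_nonneg {M : ℝ} (hM : 0 ≤ M) (k : ℕ) : 0 ≤ mj M k := by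
  unfold mj; split_ifs
  · exact le_rfl
  · positivity

lemma tail_bound {M : ℝ} (hM : 0 ≤ M) (l : ℕ) {a : ℕ → ℂ} (ha : ∀ k, ‖a k‖ ≤ mj M (k + l)) :
    ‖∑' k, a k‖ ≤ M * (50 / 49) := by
  have hs : Summable fun k => mj M (k + l) := (summable_nat_add_iff l).2 (mj_hasSum M).summable
  have h1 : ‖∑' k, a k‖ ≤ ∑' k, mj M (k + l) := tsum_of_norm_bounded hs.hasSum ha
  refine h1.trans ?_
  rw [← (mj_hasSum M).tsum_eq]
  have := (mj_hasSum M).summable.sum_add_tsum_nat_add l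
  have h2 : 0 ≤ ∑ i ∈ Finset.range l, mj M i := Finset.sum_nonneg fun i _ => mj_nonneg hM i
  linarith

lemma sq_le_two_pow (m : ℕ) : ((m : ℝ) + 4) ^ 2 ≤ 16 * 2 ^ m := by
  induction m with
  | zero => norm_num
  | succ m ih =>
    push_cast
    have : (0 : ℝ) ≤ m := Nat.cast_nonneg m
    have e : (2 : ℝ) ^ (m + 1) = 2 * 2 ^ m := by ring
    rw [e]
    nlinarith

lemma Ct_mj (t k : ℕ) : Ct t k ≤ mj (C4 t) k ∧ (k : ℝ) ^ 2 * Ct t k ≤ mj (16 * C4 t) k := by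
  unfold Ct mj
  have hC := C4_pos t
  split_ifs with h
  · simp
  · obtain ⟨m, rfl⟩ : ∃ m, k = m + 4 := ⟨k - 4, by omega⟩
    rw [Nat.add_sub_cancel]
    constructor
    · gcongr; norm_num
    · have h1 := sq_le_two_pow m
      have h2 : (2 : ℝ) ^ m * (1 / 100) ^ m = (1 / 50) ^ m := by rw [← mul_pow]; norm_num
      rw [← h2]
      push_cast
      have h3 : 0 ≤ C4 t * (1 / 100 : ℝ) ^ m := by positivity
      nlinarith

lemma SC_tau (t : ℕ) (ht : 2 ≤ t) : SC (tau t) 0.62 := by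
  refine ⟨fun j => ∏ i ∈ Finset.range (j - 1), (0.62 : ℝ) ^ (i + 2) / (1 - 0.62 ^ (i + 2)),
    tau_diffOn t ht, fun j q hq => ?_, fun j => ?_, fun M hM => ?_⟩
  · rw [mem_ball_zero_iff] at hq
    unfold tau
    split_ifs
    · rw [norm_zero]
      apply Finset.prod_nonneg
      intro i _
      have : (0.62 : ℝ) ^ (i + 2) < 1 := pow_lt_one₀ (by norm_num) (by norm_num) (by omega)
      exact div_nonneg (by positivity) (by linarith)
    · rw [norm_mul, norm_pow, norm_neg, norm_one, one_pow, one_mul, norm_prod]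
      apply Finset.prod_le_prod (fun i _ => norm_nonneg _)
      intro i _
      exact norm_phi_le (by norm_num) hq.le (by omega) (hp_ge t (by omega) _)
  · apply Finset.prod_nonneg
    intro i _
    have : (0.62 : ℝ) ^ (i + 2) < 1 := pow_lt_one₀ (by norm_num) (by norm_num) (by omega)
    exact div_nonneg (by positivity) (by linarith)
  · rw [← summable_nat_add_iff 1]
    have := (summable_prod (R := 0.62) (by norm_num) (by norm_num) 2 (by norm_num) M hM).mul_left M
    refine this.congr fun j => ?_
    simp only [Nat.add_sub_cancel]
    rw [pow_succ]
    ring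

lemma aS_factor (t : ℕ) (ht : 2 ≤ t) (w q : ℂ) (hq : ‖q‖ < 0.62) (hq0 : q ≠ 0) :
    aS t 0 w q = phi t 1 q * (1 / q - 1 - w + w ^ 2 * phi t 2 q - w ^ 3 * (phi t 2 q * phi t 3 q)
      + SF (tau t) w q) := by
  have hqm : q ∈ Metric.ball (0 : ℂ) 0.62 := by rwa [mem_ball_zero_iff]
  have s1 := (SC_bet t 0 (by omega) (R := 0.62) (by norm_num) (by norm_num)).summable w hqm
  have s2 := (SC_tau t ht).summable w hqm
  unfold aS SF
  rw [← s1.sum_add_tsum_nat_add 4, ← s2.sum_add_tsum_nat_add 4]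
  have e1 : ∑ i ∈ Finset.range 4, w ^ i * tau t i q = 0 := by
    apply Finset.sum_eq_zero
    intro i hi
    rw [Finset.mem_range] at hi
    simp [tau, hi]
  have e2 : ∀ i, w ^ (i + 4) * bet t 0 (i + 4) q = phi t 1 q * (w ^ (i + 4) * tau t (i + 4) q) := by
    intro i
    unfold bet PP tau
    rw [if_neg (by omega), zero_mul, pow_zero, mul_one, Finset.prod_range_succ']
    have : i + 4 - 1 = i + 3 := by omega
    rw [this]
    simp only [zero_add]
    ring
  simp_rw [e2]
  rw [tsum_mul_left, e1, zero_add, mul_add]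
  congr 1
  have h1q : 1 - q ≠ 0 := by
    have := one_sub_pow_ne (q := q) (by linarith) (n := 1) le_rfl
    simpa using this
  have hphi : phi t 1 q * (1 / q - 1) = 1 := by
    unfold phi
    rw [hp_one, pow_one]
    field_simp
  rw [Finset.sum_range_succ, Finset.sum_range_succ, Finset.sum_range_succ, Finset.sum_range_one]
  unfold bet PP
  simp only [Finset.prod_range_succ, Finset.prod_range_zero, zero_mul, pow_zero, zero_add]
  norm_num
  linear_combination -hphi

lemma phi_one_ne (t : ℕ) {q : ℂ} (hq : ‖q‖ < 1) (hq0 : q ≠ 0) : phi t 1 q ≠ 0 := by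
  unfold phi
  rw [hp_one, pow_one]
  apply div_ne_zero hq0
  have := one_sub_pow_ne (q := q) hq (n := 1) le_rfl
  simpa using this

section bounds
variable {t : ℕ} {q : ℂ}

lemma norm_dtau_le (ht : 2 ≤ t) (hq : ‖q‖ ≤ 0.558) (j : ℕ) : ‖deriv (tau t j) q‖ ≤ Ct t j / 0.06 := by
  have hsub : Metric.closedBall q 0.06 ⊆ Metric.ball 0 0.62 := by
    intro y hy
    rw [Metric.mem_closedBall] at hy
    rw [Metric.mem_ball]
    have := dist_triangle y q 0
    rw [dist_zero_right q] at this
    linarith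
  apply Complex.norm_deriv_le_of_forall_mem_sphere_norm_le (by norm_num)
  · apply DifferentiableOn.diffContOnCl
    rw [closure_ball _ (by norm_num)]
    exact (tau_diffOn t ht j).mono hsub
  · intro y hy
    have := hsub (Metric.sphere_subset_closedBall hy)
    rw [mem_ball_zero_iff] at this
    exact norm_tau_le t ht j this.le

lemma norm_ddtau_le (ht : 2 ≤ t) (hq : ‖q‖ ≤ 0.558) (j : ℕ) :
    ‖deriv (deriv (tau t j)) q‖ ≤ 2 * Ct t j / 0.06 ^ 2 := by
  have hsub : Metric.closedBall q 0.06 ⊆ Metric.ball 0 0.62 := by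
    intro y hy
    rw [Metric.mem_closedBall] at hy
    rw [Metric.mem_ball]
    have := dist_triangle y q 0
    rw [dist_zero_right q] at this
    linarith
  have := Complex.norm_iteratedDeriv_le_of_forall_mem_sphere_norm_le (f := tau t j) (c := q) (R := 0.06)
    (C := Ct t j) 2 (by norm_num) ?_ ?_
  · rw [iteratedDeriv_succ, iteratedDeriv_one] at this
    simpa using this
  · apply DifferentiableOn.diffContOnCl
    rw [closure_ball _ (by norm_num)]
    exact (tau_diffOn t ht j).mono hsub
  · intro y hy
    have := hsub (Metric.sphere_subset_closedBall hy)
    rw [mem_ball_zero_iff] at this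
    exact norm_tau_le t ht j this.le

end bounds

def Bt (t : ℕ) : ℝ := 17 * C4 t

lemma Bt_pos (t : ℕ) : 0 < Bt t := by unfold Bt; have := C4_pos t; positivity

lemma mj_mul (a M : ℝ) (k : ℕ) : a * mj M k = mj (a * M) k := by
  unfold mj; split_ifs <;> ring

lemma tail_bound' {t l : ℕ} {A : ℝ} (hA : 0 ≤ A) {a : ℕ → ℂ}
    (ha : ∀ k, ‖a k‖ ≤ A * (((k + l : ℕ) : ℝ) ^ 2 * Ct t (k + l))) : ‖∑' k, a k‖ ≤ A * Bt t := by
  have hC := C4_pos t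
  have := tail_bound (M := A * (16 * C4 t)) (by positivity) l (a := a) (fun k => by
    rw [← mj_mul]
    exact (ha k).trans (mul_le_mul_of_nonneg_left (Ct_mj t (k + l)).2 hA))
  refine this.trans ?_
  unfold Bt
  have : 0 ≤ A * C4 t := by positivity
  nlinarith

lemma SF_tau_bound {t : ℕ} (ht : 2 ≤ t) {q : ℂ} (hq : ‖q‖ ≤ 0.62) : ‖SF (tau t) 1 q‖ ≤ 1.03 * C4 t := by
  have hC := C4_pos t
  unfold SF
  have := tail_bound (M := C4 t) hC.le 0 (a := fun j => 1 ^ j * tau t j q) (fun k => by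
    rw [one_pow, one_mul]
    exact (norm_tau_le t ht k hq).trans (Ct_mj t k).1)
  refine this.trans ?_
  nlinarith

lemma Ct_sq_ge (t j : ℕ) : Ct t j ≤ (j : ℝ) ^ 2 * Ct t j := by
  have h := Ct_nonneg t j
  by_cases hj : j < 4
  · simp [Ct, hj]
  · have : (1 : ℝ) ≤ (j : ℝ) ^ 2 := by
      have : (1 : ℝ) ≤ j := by exact_mod_cast (by omega : 1 ≤ j)
      nlinarith
    nlinarith

lemma SF_dW_bound {t : ℕ} (ht : 2 ≤ t) {q : ℂ} (hq : ‖q‖ ≤ 0.62) : ‖SF (dW (tau t)) 1 q‖ ≤ Bt t := by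
  rw [← one_mul (Bt t)]
  apply tail_bound' (l := 1) zero_le_one
  intro k
  rw [one_pow, one_mul, one_mul, dW, norm_mul]
  have h1 := norm_tau_le t ht (k + 1) hq
  have h2 := Ct_nonneg t (k + 1)
  have e : ‖(k : ℂ) + 1‖ = (k : ℝ) + 1 := by exact_mod_cast Complex.norm_natCast (k + 1)
  rw [e]
  push_cast
  have hk : (0 : ℝ) ≤ k := Nat.cast_nonneg k
  calc ((k : ℝ) + 1) * ‖tau t (k + 1) q‖ ≤ ((k : ℝ) + 1) * Ct t (k + 1) := by gcongr
    _ ≤ _ := by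
      have : 0 ≤ (k : ℝ) * ((k : ℝ) + 1) * Ct t (k + 1) := by positivity
      nlinarith

lemma SF_dWW_bound {t : ℕ} (ht : 2 ≤ t) {q : ℂ} (hq : ‖q‖ ≤ 0.62) :
    ‖SF (dW (dW (tau t))) 1 q‖ ≤ Bt t := by
  rw [← one_mul (Bt t)]
  apply tail_bound' (l := 2) zero_le_one
  intro k
  rw [one_pow, one_mul, one_mul, dW, dW, norm_mul, norm_mul]
  have h1 := norm_tau_le t ht (k + 1 + 1) hq
  have h2 := Ct_nonneg t (k + 1 + 1)
  have e : ‖(k : ℂ) + 1‖ = (k : ℝ) + 1 := by exact_mod_cast Complex.norm_natCast (k + 1)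
  have e2 : ‖((k + 1 : ℕ) : ℂ) + 1‖ = (k : ℝ) + 2 := by
    have := Complex.norm_natCast (k + 2)
    push_cast at this ⊢
    rw [← this]; congr 1; ring
  rw [e, e2]
  push_cast
  have hk : (0 : ℝ) ≤ k := Nat.cast_nonneg k
  calc ((k : ℝ) + 1) * (((k : ℝ) + 2) * ‖tau t (k + 1 + 1) q‖)
      ≤ ((k : ℝ) + 1) * (((k : ℝ) + 2) * Ct t (k + 1 + 1)) := by gcongr
    _ ≤ _ := by
      show _ ≤ ((k : ℝ) + 2) ^ 2 * Ct t (k + 1 + 1)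
      have : 0 ≤ ((k : ℝ) + 2) * Ct t (k + 1 + 1) := by positivity
      nlinarith

lemma SF_dQ_bound {t : ℕ} (ht : 2 ≤ t) {q : ℂ} (hq : ‖q‖ ≤ 0.558) :
    ‖SF (dQ (tau t)) 1 q‖ ≤ 1 / 0.06 * Bt t := by
  apply tail_bound' (l := 0) (by norm_num)
  intro k
  rw [one_pow, one_mul, dQ]
  have h1 := norm_dtau_le ht hq k
  have h2 := Ct_sq_ge t k
  rw [add_zero]
  refine h1.trans ?_
  rw [div_eq_inv_mul, one_div]
  gcongr

lemma SF_dQQ_bound {t : ℕ} (ht : 2 ≤ t) {q : ℂ} (hq : ‖q‖ ≤ 0.558) :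
    ‖SF (dQ (dQ (tau t))) 1 q‖ ≤ 2 / 0.06 ^ 2 * Bt t := by
  apply tail_bound' (l := 0) (by norm_num)
  intro k
  rw [one_pow, one_mul, dQ]
  have h1 := norm_ddtau_le ht hq k
  have h2 := Ct_sq_ge t k
  rw [add_zero]
  refine h1.trans ?_
  rw [mul_div_right_comm]
  gcongr

lemma SF_dWQ_bound {t : ℕ} (ht : 2 ≤ t) {q : ℂ} (hq : ‖q‖ ≤ 0.558) :
    ‖SF (dW (dQ (tau t))) 1 q‖ ≤ 1 / 0.06 * Bt t := by
  apply tail_bound' (l := 1) (by norm_num)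
  intro k
  rw [one_pow, one_mul, dW, norm_mul]
  have h1 : ‖dQ (tau t) (k + 1) q‖ ≤ _ := norm_dtau_le ht hq (k + 1)
  have h2 := Ct_nonneg t (k + 1)
  have e : ‖(k : ℂ) + 1‖ = (k : ℝ) + 1 := by exact_mod_cast Complex.norm_natCast (k + 1)
  rw [e]
  push_cast
  have hk : (0 : ℝ) ≤ k := Nat.cast_nonneg k
  calc ((k : ℝ) + 1) * ‖dQ (tau t) (k + 1) q‖ ≤ ((k : ℝ) + 1) * (Ct t (k + 1) / 0.06) := by gcongr
    _ = 1 / 0.06 * (((k : ℝ) + 1) * Ct t (k + 1)) := by ring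
    _ ≤ _ := by gcongr; nlinarith

lemma SF_dQW_eq {t : ℕ} (ht : 2 ≤ t) {q : ℂ} (hq : ‖q‖ ≤ 0.558) :
    SF (dQ (dW (tau t))) 1 q = SF (dW (dQ (tau t))) 1 q := by
  have hqm : q ∈ Metric.ball (0 : ℂ) 0.62 := by rw [mem_ball_zero_iff]; linarith
  unfold SF
  congr 1
  ext k
  congr 1
  unfold dQ dW
  rw [deriv_const_mul]
  exact (tau_diffOn t ht (k + 1)).differentiableAt (Metric.isOpen_ball.mem_nhds hqm)

lemma implicit_deriv {L l1 P C T T1 : ℂ → ℂ} {y N H v T2 : ℂ} (hL0 : L 0 = 0)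
    (hF : ∀ᶠ s in nhds (0 : ℂ), y * Complex.exp (L s) - 1 - Complex.exp s + Complex.exp s ^ 2 * P s
      - Complex.exp s ^ 3 * (P s * C s) + T s = 0)
    (hL : ∀ᶠ s in nhds (0 : ℂ), HasDerivAt L (l1 s) s) (hl1 : HasDerivAt l1 v 0)
    (hP : ∀ᶠ s in nhds (0 : ℂ), HasDerivAt P (-(l1 s * (N * (P s * (1 + P s))))) s)
    (hC : ∀ᶠ s in nhds (0 : ℂ), HasDerivAt C (-(l1 s * (H * (C s * (1 + C s))))) s)
    (hT : ∀ᶠ s in nhds (0 : ℂ), HasDerivAt T (T1 s) s) (hT1 : HasDerivAt T1 T2 0)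
    {m p c : ℂ} (hm : l1 0 = m) (hp : P 0 = p) (hc : C 0 = c) :
    (y * m - 1 + 2 * p - m * N * p * (1 + p) - 3 * (p * c)
      + m * (p * c * (N * (1 + p) + H * (1 + c))) + T1 0 = 0) ∧
    ((v + m ^ 2) * y - 1 + 4 * p - 4 * m * N * p * (1 + p) - v * N * p * (1 + p)
      + m ^ 2 * N ^ 2 * p * (1 + p) * (1 + 2 * p)
      - (9 * (p * c) - 6 * m * (p * c * (N * (1 + p) + H * (1 + c)))
        - v * (p * c * (N * (1 + p) + H * (1 + c)))
        + m ^ 2 * (p * c * ((N * (1 + p) + H * (1 + c)) ^ 2 + N ^ 2 * p * (1 + p)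
          + H ^ 2 * c * (1 + c)))) + T2 = 0) := by
  have hE : ∀ᶠ s in nhds (0 : ℂ),
      y * (Complex.exp (L s) * l1 s) - Complex.exp s
        + (2 * Complex.exp s ^ 2 * P s + Complex.exp s ^ 2 * (-(l1 s * (N * (P s * (1 + P s))))))
        - (3 * Complex.exp s ^ 3 * (P s * C s) + Complex.exp s ^ 3 *
          ((-(l1 s * (N * (P s * (1 + P s))))) * C s + P s * (-(l1 s * (H * (C s * (1 + C s)))))))
        + T1 s = 0 := by
    filter_upwards [hF.eventually_nhds, hL, hP, hC, hT] with s h1 h2 h3 h4 h5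
    have he := Complex.hasDerivAt_exp s
    have a := ((((((h2.cexp).const_mul y).sub_const 1).fun_sub he).fun_add
      ((he.fun_pow 2).fun_mul h3)).fun_sub ((he.fun_pow 3).fun_mul (h3.fun_mul h4))).fun_add h5
    have b : HasDerivAt (fun s => y * Complex.exp (L s) - 1 - Complex.exp s + Complex.exp s ^ 2 * P s
      - Complex.exp s ^ 3 * (P s * C s) + T s) 0 s :=
      (hasDerivAt_const s (0 : ℂ)).congr_of_eventuallyEq h1
    have := a.unique b
    rw [← this]
    push_cast
    ring
  have hL' := hL.self_of_nhds
  have hP' := hP.self_of_nhds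
  have hC' := hC.self_of_nhds
  have he := Complex.hasDerivAt_exp 0
  constructor
  · have := hE.self_of_nhds
    rw [hL0, hm, hp, hc, Complex.exp_zero] at this
    linear_combination this
  · have b := (hasDerivAt_const (0 : ℂ) (0 : ℂ)).congr_of_eventuallyEq hE
    have dP := (hl1.fun_mul ((hP'.fun_mul (hP'.const_add 1)).const_mul N)).fun_neg
    have dC := (hl1.fun_mul ((hC'.fun_mul (hC'.const_add 1)).const_mul H)).fun_neg
    have a := (((((hL'.cexp.fun_mul hl1).const_mul y).fun_sub he).fun_add
      ((((he.fun_pow 2).const_mul 2).fun_mul hP').fun_add ((he.fun_pow 2).fun_mul dP))).fun_sub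
      ((((he.fun_pow 3).const_mul 3).fun_mul (hP'.fun_mul hC')).fun_add
        ((he.fun_pow 3).fun_mul ((dP.fun_mul hC').fun_add (hP'.fun_mul dC))))).fun_add hT1
    have := a.unique b
    simp only [hL0, hm, hp, hc, Complex.exp_zero] at this
    push_cast at this
    linear_combination this

lemma phi_hasDerivAt (t i : ℕ) (ht : 1 ≤ t) (hi : 1 ≤ i) {q : ℂ} (hq : ‖q‖ < 1) :
    ∃ d, HasDerivAt (phi t i) d q ∧ q * d = hp t i * (phi t i q * (1 + phi t i q)) := by
  have h1 : 1 ≤ hp t i := hi.trans (hp_ge t ht i)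
  have hne : (1 : ℂ) - q ^ hp t i ≠ 0 := one_sub_pow_ne hq (by omega)
  have hd := (hasDerivAt_pow (hp t i) q)
  refine ⟨_, hd.fun_div (hd.const_sub 1) hne, ?_⟩
  unfold phi
  obtain ⟨k, hk⟩ : ∃ k, hp t i = k + 1 := ⟨hp t i - 1, by omega⟩
  rw [hk] at hne ⊢
  rw [Nat.add_sub_cancel]
  field_simp
  ring

/-- complex version of the denominator -/
def Dc (t : ℕ) (q : ℂ) : ℂ := 1 / q - hp t 2 * (phi t 2 q * (1 + phi t 2 q))
  + phi t 2 q * phi t 3 q * (hp t 2 * (1 + phi t 2 q) + hp t 3 * (1 + phi t 3 q))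
  - q * SF (dQ (tau t)) 1 q

def Gf (t : ℕ) (w q : ℂ) : ℂ := 1 / q - 1 - w + w ^ 2 * phi t 2 q - w ^ 3 * (phi t 2 q * phi t 3 q)
      + SF (tau t) w q

lemma Gf_hasDerivAt_q (t : ℕ) (ht : 2 ≤ t) {q : ℂ} (hq : ‖q‖ < 0.62) (hq0 : q ≠ 0) :
    HasDerivAt (fun q => Gf t 1 q) (-(Dc t q) / q) q := by
  have hqm : q ∈ Metric.ball (0 : ℂ) 0.62 := by rwa [mem_ball_zero_iff]
  obtain ⟨d2, h2, e2⟩ := phi_hasDerivAt t 2 (by omega) (by norm_num) (q := q) (by linarith)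
  obtain ⟨d3, h3, e3⟩ := phi_hasDerivAt t 3 (by omega) (by norm_num) (q := q) (by linarith)
  have hτ := (SC_tau t ht).hasDerivAt_q (w := 1) hqm
  have := (((((hasDerivAt_inv hq0).sub_const 1).sub_const 1).fun_add (h2.const_mul (1 ^ 2))).fun_sub
    ((h2.fun_mul h3).const_mul (1 ^ 3))).fun_add hτ
  unfold Gf
  simp only [one_div]
  convert! this using 1
  unfold Dc
  rw [div_eq_iff hq0]
  have : (q ^ 2)⁻¹ * q = 1 / q := by field_simp
  linear_combination (-1 + phi t 3 q) * e2 + phi t 2 q * e3 + this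

lemma Gf_hasDerivAt_w (t : ℕ) (ht : 2 ≤ t) {q : ℂ} (hq : ‖q‖ < 0.62) :
    HasDerivAt (fun w => Gf t w q) (-1 + 2 * phi t 2 q - 3 * (phi t 2 q * phi t 3 q)
      + SF (dW (tau t)) 1 q) 1 := by
  have hqm : q ∈ Metric.ball (0 : ℂ) 0.62 := by rwa [mem_ball_zero_iff]
  have hτ := (SC_tau t ht).hasDerivAt_w (w := 1) hqm
  have hi := hasDerivAt_id' (1 : ℂ)
  have := ((((hi.const_sub (1 / q - 1))).fun_add ((hi.fun_pow 2).mul_const (phi t 2 q))).fun_sub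
    ((hi.fun_pow 3).mul_const (phi t 2 q * phi t 3 q))).fun_add hτ
  unfold Gf
  convert! this using 1
  norm_num

lemma aS_eq_Gf (t : ℕ) (ht : 2 ≤ t) (w : ℂ) {q : ℂ} (hq : ‖q‖ < 0.62) (hq0 : q ≠ 0) :
    aS t 0 w q = phi t 1 q * Gf t w q := aS_factor t ht w q hq hq0

lemma aS_zero_iff (t : ℕ) (ht : 2 ≤ t) (w : ℂ) {q : ℂ} (hq : ‖q‖ < 0.62) (hq0 : q ≠ 0) :
    aS t 0 w q = 0 ↔ Gf t w q = 0 := by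
  rw [aS_eq_Gf t ht w hq hq0, mul_eq_zero, or_iff_right (phi_one_ne t (by linarith) hq0)]

lemma aS_hasDerivAt_q (t : ℕ) (ht : 2 ≤ t) {q : ℂ} (hq : ‖q‖ < 0.62) (hq0 : q ≠ 0)
    (hr : Gf t 1 q = 0) :
    HasDerivAt (fun q => aS t 0 1 q) (phi t 1 q * (-(Dc t q) / q)) q := by
  obtain ⟨d, hd, -⟩ := phi_hasDerivAt t 1 (by omega) (by norm_num) (q := q) (by linarith)
  have := hd.fun_mul (Gf_hasDerivAt_q t ht hq hq0)
  rw [hr, mul_zero, zero_add] at this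
  refine this.congr_of_eventuallyEq ?_
  have h1 : ∀ᶠ z in nhds q, ‖z‖ < 0.62 := continuous_norm.continuousAt.eventually_lt_const hq
  filter_upwards [h1, eventually_ne_nhds hq0] with z hz hz0
  exact aS_eq_Gf t ht 1 hz hz0

lemma SF_dQ_bet (t : ℕ) (ht : 2 ≤ t) {q : ℂ} (hq : ‖q‖ < 0.62) (hq0 : q ≠ 0)
    (hr : Gf t 1 q = 0) : SF (dQ (bet t 0)) 1 q = phi t 1 q * (-(Dc t q) / q) := by
  have hqm : q ∈ Metric.ball (0 : ℂ) 0.62 := by rwa [mem_ball_zero_iff]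
  exact ((SC_bet t 0 (by omega) (R := 0.62) (by norm_num) (by norm_num)).hasDerivAt_q hqm).unique
    (aS_hasDerivAt_q t ht hq hq0 hr)

lemma mu_formula (t : ℕ) (ht : 2 ≤ t) {q : ℂ} (hq : ‖q‖ < 0.62) (hq0 : q ≠ 0)
    (hr : Gf t 1 q = 0) (hD : Dc t q ≠ 0) :
    deriv (fun w : ℂ => bGF t q 1 1 w) 1 / (q * deriv (fun q : ℂ => bGF t q 1 1 1) q) =
      (1 - 2 * phi t 2 q + 3 * (phi t 2 q * phi t 3 q) - SF (dW (tau t)) 1 q) / Dc t q := by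
  have h1 : HasDerivAt (fun w : ℂ => bGF t q 1 1 w) (-(phi t 1 q * (-1 + 2 * phi t 2 q
      - 3 * (phi t 2 q * phi t 3 q) + SF (dW (tau t)) 1 q))) 1 := by
    have := (((Gf_hasDerivAt_w t ht hq).const_mul (phi t 1 q)).const_sub 1)
    refine this.congr_of_eventuallyEq (Eventually.of_forall fun w => ?_)
    show bGF t q 1 1 w = _
    rw [bGF_eq t (by omega) q w (by linarith), aS_eq_Gf t ht w hq hq0]
  have h2 : HasDerivAt (fun q : ℂ => bGF t q 1 1 1) (-(phi t 1 q * (-(Dc t q) / q))) q := by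
    have := (aS_hasDerivAt_q t ht hq hq0 hr).const_sub 1
    refine this.congr_of_eventuallyEq ?_
    have h1 : ∀ᶠ z in nhds q, ‖z‖ < 0.62 := continuous_norm.continuousAt.eventually_lt_const hq
    filter_upwards [h1] with z hz
    rw [bGF_eq t (by omega) z 1 (by linarith)]
  rw [h1.deriv, h2.deriv]
  have := phi_one_ne t (q := q) (by linarith) hq0
  field_simp
  ring

lemma L_eqs (t : ℕ) (ht : 2 ≤ t) {q : ℂ} (hq : ‖q‖ < 0.6) (hq0 : q ≠ 0) {L : ℂ → ℂ}
    (hLa : AnalyticAt ℂ L 0) (hL0 : L 0 = 0)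
    (hev : ∀ᶠ s in nhds 0, aS t 0 (Complex.exp s) (q * Complex.exp (-L s)) = 0)
    {m v p c : ℂ} (hm : deriv L 0 = m) (hv : deriv (deriv L) 0 = v) (hp' : phi t 2 q = p)
    (hc : phi t 3 q = c) {N H : ℂ} (hN : hp t 2 = N) (hH : hp t 3 = H) :
    m * Dc t q = 1 - 2 * p + 3 * (p * c) - SF (dW (tau t)) 1 q ∧
    v * Dc t q = 1 - 4 * p + 4 * m * N * p * (1 + p) - m ^ 2 * (1 / q + N ^ 2 * p * (1 + p) * (1 + 2 * p))
      + 9 * (p * c) - 6 * m * (p * c * (N * (1 + p) + H * (1 + c)))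
      + m ^ 2 * (p * c * ((N * (1 + p) + H * (1 + c)) ^ 2 + N ^ 2 * p * (1 + p) + H ^ 2 * c * (1 + c)))
      - (SF (dW (dW (tau t))) 1 q - m * q * (SF (dQ (dW (tau t))) 1 q + SF (dW (dQ (tau t))) 1 q)
        + SF (dW (tau t)) 1 q
        + m ^ 2 * (q ^ 2 * SF (dQ (dQ (tau t))) 1 q + q * SF (dQ (tau t)) 1 q)) := by
  have hLd : ∀ᶠ s in nhds (0 : ℂ), HasDerivAt L (deriv L s) s := by
    filter_upwards [hLa.eventually_analyticAt] with s hs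
    exact hs.differentiableAt.hasDerivAt
  have hl1 : HasDerivAt (deriv L) v 0 := by
    rw [← hv]; exact hLa.deriv.differentiableAt.hasDerivAt
  have hQd : ∀ᶠ s in nhds (0 : ℂ), HasDerivAt (fun s => q * Complex.exp (-L s))
      (-(deriv L s) * (q * Complex.exp (-L s))) s := by
    filter_upwards [hLd] with s hs
    convert! (hs.fun_neg.cexp).const_mul q using 1
    ring
  have hQ0 : q * Complex.exp (-L 0) = q := by rw [hL0, neg_zero, Complex.exp_zero, mul_one]
  have hQ6 : ∀ᶠ s in nhds (0 : ℂ), ‖q * Complex.exp (-L s)‖ < 0.6 := by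
    have := hQd.self_of_nhds.continuousAt.norm
    apply this.eventually_lt_const
    show ‖q * Complex.exp (-L 0)‖ < 0.6
    rw [hQ0]; exact hq
  have hph : ∀ i : ℕ, 1 ≤ i → ∀ᶠ s in nhds (0 : ℂ),
      HasDerivAt (fun s => phi t i (q * Complex.exp (-L s)))
      (-(deriv L s * (hp t i * (phi t i (q * Complex.exp (-L s)) * (1 + phi t i (q * Complex.exp (-L s))))))) s := by
    intro i hi
    filter_upwards [hQd, hQ6] with s h1 h2
    obtain ⟨d, hd, e⟩ := phi_hasDerivAt t i (by omega) hi (q := q * Complex.exp (-L s)) (by linarith)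
    convert! HasDerivAt.comp s hd h1 using 1
    rw [← e]; ring
  have hT := hQ6.and (hQd.and hLd)
  have hT' : ∀ᶠ s in nhds (0 : ℂ), HasDerivAt (fun s => SF (tau t) (Complex.exp s) (q * Complex.exp (-L s)))
      (SF (dW (tau t)) (Complex.exp s) (q * Complex.exp (-L s)) * Complex.exp s +
       SF (dQ (tau t)) (Complex.exp s) (q * Complex.exp (-L s)) * (-(deriv L s) * (q * Complex.exp (-L s)))) s := by
    filter_upwards [hQd, hQ6] with s h1 h2
    exact (SC_tau t ht).hasDerivAt_comp (Q := fun s => q * Complex.exp (-L s))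
      (by rw [mem_ball_zero_iff]; linarith) (Complex.hasDerivAt_exp s) h1
  have hQ00 : q * Complex.exp (-L 0) ∈ Metric.ball (0 : ℂ) 0.6 := by
    rw [hQ0, mem_ball_zero_iff]; exact hq
  have hQ00' : q * Complex.exp (-L 0) ∈ Metric.ball (0 : ℂ) 0.62 := by
    rw [hQ0, mem_ball_zero_iff]; linarith
  have dQ0 := hQd.self_of_nhds
  have he := Complex.hasDerivAt_exp 0
  have a1 := (SC_tau t ht).dW.hasDerivAt_comp (Q := fun s => q * Complex.exp (-L s)) hQ00' he dQ0
  have a2 := ((SC_tau t ht).dQ (R' := 0.6) (by norm_num)).hasDerivAt_comp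
    (Q := fun s => q * Complex.exp (-L s)) hQ00 he dQ0
  have hT1 := (a1.fun_mul he).fun_add (a2.fun_mul (hl1.fun_neg.fun_mul dQ0))
  have hF : ∀ᶠ s in nhds (0 : ℂ), (1 / q) * Complex.exp (L s) - 1 - Complex.exp s
      + Complex.exp s ^ 2 * phi t 2 (q * Complex.exp (-L s))
      - Complex.exp s ^ 3 * (phi t 2 (q * Complex.exp (-L s)) * phi t 3 (q * Complex.exp (-L s)))
      + SF (tau t) (Complex.exp s) (q * Complex.exp (-L s)) = 0 := by
    filter_upwards [hev, hQ6] with s h1 h2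
    rw [aS_zero_iff t ht _ (by linarith) (mul_ne_zero hq0 (Complex.exp_ne_zero _))] at h1
    rw [← h1]
    unfold Gf
    have : 1 / (q * Complex.exp (-L s)) = 1 / q * Complex.exp (L s) := by
      rw [Complex.exp_neg]
      field_simp
    rw [this]
  obtain ⟨r1, r2⟩ := implicit_deriv hL0 hF hLd hl1 (hph 2 (by norm_num)) (hph 3 (by norm_num)) hT' hT1
    (m := m) (p := p) (c := c) hm (by rw [hQ0, hp']) (by rw [hQ0, hc])
  simp only [hQ0, Complex.exp_zero, hm, hN, hH] at r1 r2
  unfold Dc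
  rw [hp', hc, hN, hH]
  constructor
  · linear_combination r1
  · linear_combination r2

def pR (n : ℕ) (x : ℝ) : ℝ := x ^ n / (1 - x ^ n)

lemma phi_ofReal (t i : ℕ) (x : ℝ) : phi t i (x : ℂ) = (pR (hp t i) x : ℂ) := by
  unfold phi pR; push_cast; rfl

lemma tau_ofReal (t j : ℕ) (x : ℝ) : ∃ r : ℝ, tau t j (x : ℂ) = r := by
  unfold tau
  split_ifs
  · exact ⟨0, by simp⟩
  · refine ⟨(-1) ^ j * ∏ i ∈ Finset.range (j - 1), pR (hp t (i + 2)) x, ?_⟩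
    push_cast
    simp only [phi_ofReal]

lemma SF_tau_im (t : ℕ) (x : ℝ) : (SF (tau t) 1 (x : ℂ)).im = 0 := by
  choose r hr using fun j => tau_ofReal t j x
  unfold SF
  have : (fun j => (1 : ℂ) ^ j * tau t j x) = fun j => ((r j : ℝ) : ℂ) := by
    ext j; rw [one_pow, one_mul, hr]
  rw [this, ← Complex.ofReal_tsum, Complex.ofReal_im]

/-- real version of `Gf` at `w = 1` -/
def gR (t : ℕ) (x : ℝ) : ℝ := 1 / x - 2 + pR (hp t 2) x - pR (hp t 2) x * pR (hp t 3) x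
  + (SF (tau t) 1 (x : ℂ)).re

lemma Gf_ofReal (t : ℕ) (x : ℝ) : Gf t 1 (x : ℂ) = (gR t x : ℂ) := by
  unfold Gf gR
  have : SF (tau t) 1 (x : ℂ) = ((SF (tau t) 1 (x : ℂ)).re : ℂ) := by
    apply Complex.ext
    · simp
    · rw [SF_tau_im]; simp
  push_cast
  rw [← this, phi_ofReal, phi_ofReal]
  ring

lemma locate (t : ℕ) (ht : 2 ≤ t) {q₀ a b : ℝ} (ha : 0 < a) (hab : a ≤ b) (hb : b ≤ 0.6)
    (hq₀uniq : ∀ q : ℂ, ‖q‖ < 1 - 0.72 / (t : ℝ) → bGF t q 1 1 1 = 1 → q = (q₀ : ℂ))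
    (h1 : 1.03 * C4 t ≤ 1 / a - 2 + pR (hp t 2) a - pR (hp t 2) a * pR (hp t 3) a)
    (h2 : 1 / b - 2 + pR (hp t 2) b - pR (hp t 2) b * pR (hp t 3) b ≤ -(1.03 * C4 t)) :
    a ≤ q₀ ∧ q₀ ≤ b := by
  have hn : ∀ x : ℝ, x ∈ Set.Icc a b → ‖(x : ℂ)‖ ≤ 0.6 := by
    intro x hx
    rw [Complex.norm_real, Real.norm_eq_abs, abs_of_pos (ha.trans_le hx.1)]
    exact hx.2.trans hb
  have hne : ∀ x : ℝ, x ∈ Set.Icc a b → (x : ℂ) ≠ 0 := by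
    intro x hx
    exact_mod_cast (ha.trans_le hx.1).ne'
  have hcont : ContinuousOn (gR t) (Set.Icc a b) := by
    intro x hx
    apply ContinuousAt.continuousWithinAt
    have h := (Gf_hasDerivAt_q t ht (q := (x : ℂ)) (by linarith [hn x hx]) (hne x hx)).continuousAt
    have h' : ContinuousAt (fun x : ℝ => (Gf t 1 (x : ℂ)).re) x :=
      Complex.continuous_re.continuousAt.comp
        (ContinuousAt.comp (f := fun x : ℝ => (x : ℂ)) h Complex.continuous_ofReal.continuousAt)
    simpa only [Gf_ofReal, Complex.ofReal_re] using h'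
  have hb' : ∀ x : ℝ, x ∈ Set.Icc a b → |(SF (tau t) 1 (x : ℂ)).re| ≤ 1.03 * C4 t := fun x hx =>
    (Complex.abs_re_le_norm _).trans (SF_tau_bound ht (by linarith [hn x hx]))
  have g1 : 0 ≤ gR t a := by
    have := abs_le.1 (hb' a ⟨le_rfl, hab⟩)
    unfold gR; linarith
  have g2 : gR t b ≤ 0 := by
    have := abs_le.1 (hb' b ⟨hab, le_rfl⟩)
    unfold gR; linarith
  obtain ⟨z, hz, hz0⟩ := intermediate_value_Icc' hab hcont ⟨g2, g1⟩
  have h3 : aS t 0 1 (z : ℂ) = 0 := by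
    rw [aS_zero_iff t ht 1 (by linarith [hn z hz]) (hne z hz), Gf_ofReal, hz0]; simp
  have h4 : bGF t (z : ℂ) 1 1 1 = 1 := by
    rw [bGF_eq t (by omega) _ _ (by linarith [hn z hz]), h3, sub_zero]
  have h5 : (0.72 : ℝ) / t ≤ 0.36 := by
    rw [div_le_iff₀ (by positivity)]
    have : (2 : ℝ) ≤ t := by exact_mod_cast ht
    linarith
  have h6 := hq₀uniq z (by linarith [hn z hz]) h4
  have h7 : z = q₀ := by exact_mod_cast h6
  rw [← h7]
  exact hz

def muPoly (t : ℕ) : ℝ := 1/2+((t:ℝ)-2)/2^(t+3)+(2*(t:ℝ)^2+3*t-8)/2^(2*t+5)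
  +(9*(t:ℝ)^3+45*t^2+2*t-88)/2^(3*t+8)

def vPoly (t : ℕ) : ℝ := 1/4+(-(t:ℝ)^2+5*t-2)/2^(t+4)+(-4*(t:ℝ)^3+4*t^2+27*t-14)/2^(2*t+6)

/-- the system of numerical relations -/
structure NS (t : ℕ) (N H x p c X Y e0 e1 e2 D : ℝ) : Prop where
  hN : N = t + 1
  hH : H = 1 + t + t ^ 2
  hp : p = pR (t + 1) x
  hc : c = pR (1 + t + t ^ 2) x
  hX : X = p * c * (N * (1 + p) + H * (1 + c))
  hY : Y = p * c * ((N * (1 + p) + H * (1 + c)) ^ 2 + N ^ 2 * p * (1 + p) + H ^ 2 * c * (1 + c))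
  h0 : 1 / x = 2 - p + p * c - e0
  hD : D = 1 / x - N * (p * (1 + p)) + X - e1
  b0 : |e0| ≤ 1.03 * C4 t
  b1 : |e1| ≤ 9.3 * Bt t
  b2 : |e2| ≤ Bt t

structure NG (t : ℕ) (μ v : ℝ) : Prop where
  h1 : |μ - muPoly t| ≤ 0.55 * (t : ℝ) ^ 4 / 2 ^ (4 * t)
  h2 : 0 < v
  h3 : |v - vPoly t| ≤ 0.26 * (t : ℝ) ^ 4 / 2 ^ (3 * t)

/-- the numerical statement which has to be verified -/
def NumOK (t : ℕ) (x : ℝ) : Prop := ∀ N H p c X Y e0 e1 e2 D : ℝ, NS t N H x p c X Y e0 e1 e2 D →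
  0 < D ∧ ∀ μ v e3 : ℝ, μ * D = 1 - 2 * p + 3 * (p * c) - e2 → (|μ| ≤ 0.6 → |e3| ≤ 80 * Bt t) →
    v * D = 1 - 4 * p + 4 * μ * N * p * (1 + p) - μ ^ 2 * (1 / x + N ^ 2 * p * (1 + p) * (1 + 2 * p))
      + 9 * (p * c) - 6 * μ * X + μ ^ 2 * Y - e3 → NG t μ v

theorem final_of_num (t : ℕ) (ht : 2 ≤ t) (x : ℝ) (hx0 : 0 < x) (hx1 : x ≤ 0.558)
    (hr : bGF t (x : ℂ) 1 1 1 = 1)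
    (hq₀uniq : ∀ q : ℂ, ‖q‖ < 1 - 0.72 / (t : ℝ) → bGF t q 1 1 1 = 1 → q = (x : ℂ))
    (hnum : NumOK t x) : ∃ (μ σ : ℝ) (L : ℂ → ℂ) (δ K : ℝ), 0 < σ ∧
      (μ : ℂ) = deriv (fun w : ℂ => bGF t (x : ℂ) 1 1 w) 1 /
        ((x : ℂ) * deriv (fun q : ℂ => bGF t q 1 1 1) (x : ℂ)) ∧
      |μ - muPoly t| ≤ 0.55 * (t : ℝ) ^ 4 / 2 ^ (4 * t) ∧
      |σ ^ 2 - vPoly t| ≤ 0.26 * (t : ℝ) ^ 4 / 2 ^ (3 * t) ∧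
      QPH (pfo t) L δ K ∧ deriv L 0 = μ ∧ deriv (deriv L) 0 = ((σ ^ 2 : ℝ) : ℂ) := by
  have hxn : ‖(x : ℂ)‖ = x := by rw [Complex.norm_real, Real.norm_eq_abs, abs_of_pos hx0]
  have hx558 : ‖(x : ℂ)‖ ≤ 0.558 := by rw [hxn]; exact hx1
  have hxne : (x : ℂ) ≠ 0 := by exact_mod_cast hx0.ne'
  have hB := Bt_pos t
  have ha0 : aS t 0 1 (x : ℂ) = 0 := by
    have := bGF_eq t (by omega) (x : ℂ) 1 (by linarith)
    rw [hr] at this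
    linear_combination this
  have hG0 : Gf t 1 (x : ℂ) = 0 := (aS_zero_iff t ht 1 (by linarith) hxne).1 ha0
  have hg0 : gR t x = 0 := by rw [Gf_ofReal] at hG0; exact_mod_cast hG0
  have h5 : (0.72 : ℝ) / t ≤ 0.36 := by
    rw [div_le_iff₀ (by positivity)]
    have : (2 : ℝ) ≤ t := by exact_mod_cast ht
    linarith
  have hu : ∀ q : ℂ, ‖q‖ ≤ 0.58 → aS t 0 1 q = 0 → q = x := by
    intro q hq h
    apply hq₀uniq q (by linarith)
    rw [bGF_eq t (by omega) q 1 (by linarith), h, sub_zero]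
  set τ0 := SF (tau t) 1 (x : ℂ)
  set τw := SF (dW (tau t)) 1 (x : ℂ) with hτw
  set τq := SF (dQ (tau t)) 1 (x : ℂ) with hτq
  set τww := SF (dW (dW (tau t))) 1 (x : ℂ) with hτww
  set τwq := SF (dW (dQ (tau t))) 1 (x : ℂ) with hτwq
  set τqq := SF (dQ (dQ (tau t))) 1 (x : ℂ) with hτqq
  have b0 : ‖τ0‖ ≤ _ := SF_tau_bound ht (q := (x : ℂ)) (by linarith)
  have bw : ‖τw‖ ≤ _ := SF_dW_bound ht (q := (x : ℂ)) (by linarith)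
  have bww : ‖τww‖ ≤ _ := SF_dWW_bound ht (q := (x : ℂ)) (by linarith)
  have bq : ‖τq‖ ≤ _ := SF_dQ_bound ht (q := (x : ℂ)) (by linarith)
  have bqq : ‖τqq‖ ≤ _ := SF_dQQ_bound ht (q := (x : ℂ)) (by linarith)
  have bwq : ‖τwq‖ ≤ _ := SF_dWQ_bound ht (q := (x : ℂ)) (by linarith)
  have ewq : SF (dQ (dW (tau t))) 1 (x : ℂ) = τwq := SF_dQW_eq ht (q := (x : ℂ)) (by linarith)
  have bxq : ‖(x : ℂ) * τq‖ ≤ 9.3 * Bt t := by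
    rw [norm_mul, hxn]
    calc x * ‖τq‖ ≤ 0.558 * (1 / 0.06 * Bt t) := by gcongr
      _ = 9.3 * Bt t := by norm_num; ring
  have bxwq : ‖(x : ℂ) * τwq‖ ≤ 9.3 * Bt t := by
    rw [norm_mul, hxn]
    calc x * ‖τwq‖ ≤ 0.558 * (1 / 0.06 * Bt t) := by gcongr
      _ = 9.3 * Bt t := by norm_num; ring
  have bxqq : ‖(x : ℂ) ^ 2 * τqq‖ ≤ 173 * Bt t := by
    rw [norm_mul, norm_pow, hxn]
    calc x ^ 2 * ‖τqq‖ ≤ 0.558 ^ 2 * (2 / 0.06 ^ 2 * Bt t) := by gcongr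
      _ ≤ 173 * Bt t := by norm_num; nlinarith
  set N : ℝ := ((hp t 2 : ℕ) : ℝ) with hN
  set H : ℝ := ((hp t 3 : ℕ) : ℝ) with hH
  set p : ℝ := pR (hp t 2) x with hpd
  set c : ℝ := pR (hp t 3) x with hcd
  have hpc : phi t 2 (x : ℂ) = p := phi_ofReal t 2 x
  have hcc : phi t 3 (x : ℂ) = c := phi_ofReal t 3 x
  have e2 : hp t 2 = t + 1 := by rw [hp_two]; omega
  have e3 : hp t 3 = 1 + t + t ^ 2 := by rw [hp_three]
  set X : ℝ := p * c * (N * (1 + p) + H * (1 + c)) with hX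
  set D : ℝ := 1 / x - N * (p * (1 + p)) + X - ((x : ℂ) * τq).re with hD
  have hDre : (Dc t (x : ℂ)).re = D := by
    unfold Dc
    rw [hpc, hcc, Complex.sub_re, ← hτq, hD]
    congr 1
    rw [hX, ← Complex.ofReal_re (1 / x - N * (p * (1 + p)) + p * c * (N * (1 + p) + H * (1 + c)))]
    push_cast
    rw [hN, hH]
    push_cast
    rfl
  have hNS : NS t N H x p c X (p * c * ((N * (1 + p) + H * (1 + c)) ^ 2 + N ^ 2 * p * (1 + p)
      + H ^ 2 * c * (1 + c))) τ0.re ((x : ℂ) * τq).re τw.re D := by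
    refine ⟨?_, ?_, ?_, ?_, rfl, rfl, ?_, hD, ?_, ?_, ?_⟩
    · rw [hN, e2]; push_cast; ring
    · rw [hH, e3]; push_cast; ring
    · rw [hpd, e2]
    · rw [hcd, e3]
    · unfold gR at hg0; linarith
    · exact (Complex.abs_re_le_norm _).trans b0
    · exact (Complex.abs_re_le_norm _).trans bxq
    · exact (Complex.abs_re_le_norm _).trans bw
  obtain ⟨hDpos, hrest⟩ := hnum _ _ _ _ _ _ _ _ _ _ hNS
  have hDne : Dc t (x : ℂ) ≠ 0 := by
    intro h
    rw [h, Complex.zero_re] at hDre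
    linarith
  have hdne : SF (dQ (bet t 0)) 1 (x : ℂ) ≠ 0 := by
    rw [SF_dQ_bet t ht (by linarith) hxne hG0]
    exact mul_ne_zero (phi_one_ne t (by linarith) hxne) (div_ne_zero (neg_ne_zero.2 hDne) hxne)
  obtain ⟨L, δ, K, hLa, hL0, hev, hQ⟩ := forest_QPH t ht hx0 (by linarith) ha0 hu hdne
  obtain ⟨Cst, hC⟩ := mean_var hQ
  have im1 : (deriv L 0).im = 0 := im_zero_of_bdd fun n => (hC n).1
  have im2 : (deriv (deriv L) 0).im = 0 := im_zero_of_bdd fun n => (hC n).2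
  obtain ⟨μ, hμ⟩ : ∃ μ : ℝ, deriv L 0 = μ := ⟨(deriv L 0).re, Complex.ext (by simp) (by simp [im1])⟩
  obtain ⟨v, hv⟩ : ∃ v : ℝ, deriv (deriv L) 0 = v :=
    ⟨(deriv (deriv L) 0).re, Complex.ext (by simp) (by simp [im2])⟩
  obtain ⟨r1, r2⟩ := L_eqs t ht (q := (x : ℂ)) (by linarith) hxne hLa hL0 hev hμ hv hpc hcc
    (N := (N : ℂ)) (H := (H : ℂ)) (by rw [hN]; simp) (by rw [hH]; simp)
  have s1 := congrArg Complex.re r1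
  have s2 := congrArg Complex.re r2
  rw [ewq, ← hτww, ← hτwq, ← hτqq, ← hτq, ← hτw] at s2
  rw [← hτw] at s1
  rw [Complex.re_ofReal_mul, hDre] at s1 s2
  have hNG : NG t μ v := by
    apply hrest μ v (τww - 2 * μ * (x * τwq) + τw + (μ : ℂ) ^ 2 * (x ^ 2 * τqq + x * τq)).re
    · rw [s1, Complex.sub_re]
      congr 1
      rw [← Complex.ofReal_re (1 - 2 * p + 3 * (p * c))]
      push_cast
      rfl
    · intro hμ6
      refine (Complex.abs_re_le_norm _).trans ?_
      have hμn : ‖(μ : ℂ)‖ ≤ 0.6 := by rwa [Complex.norm_real, Real.norm_eq_abs]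
      have k1 : ‖2 * (μ : ℂ) * (x * τwq)‖ ≤ 2 * 0.6 * (9.3 * Bt t) := by
        rw [norm_mul, norm_mul, Complex.norm_ofNat]
        gcongr
      have k2 : ‖(μ : ℂ) ^ 2 * (x ^ 2 * τqq + x * τq)‖ ≤ 0.6 ^ 2 * (173 * Bt t + 9.3 * Bt t) := by
        rw [norm_mul, norm_pow]
        gcongr
        exact (norm_add_le _ _).trans (add_le_add bxqq bxq)
      refine (norm_add_le _ _).trans ?_
      have k3 : ‖τww - 2 * μ * (x * τwq) + τw‖ ≤ Bt t + 2 * 0.6 * (9.3 * Bt t) + Bt t :=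
        (norm_add_le _ _).trans (add_le_add ((norm_sub_le _ _).trans (add_le_add bww k1)) bw)
      nlinarith
    · rw [s2, Complex.sub_re]
      have hb : ∀ a b a' b' : ℝ, a = a' → b = b' → a - b = a' - b' := by
        intro a b a' b' h1 h2; rw [h1, h2]
      apply hb
      · rw [← Complex.ofReal_re (1 - 4 * p + 4 * μ * N * p * (1 + p) - μ ^ 2 * (1 / x + N ^ 2 * p * (1 + p) * (1 + 2 * p))
      + 9 * (p * c) - 6 * μ * X + μ ^ 2 * (p * c * ((N * (1 + p) + H * (1 + c)) ^ 2 + N ^ 2 * p * (1 + p)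
      + H ^ 2 * c * (1 + c))))]
        rw [hX]
        push_cast
        rfl
      · congr 1
        ring
  refine ⟨μ, Real.sqrt v, L, δ, K, Real.sqrt_pos.2 hNG.h2, ?_, hNG.h1, ?_, hQ, hμ, ?_⟩
  · rw [mu_formula t ht (by linarith) hxne hG0 hDne, hpc, hcc, eq_div_iff hDne, ← hτw, ← r1]
  · rw [Real.sq_sqrt hNG.h2.le]; exact hNG.h3
  · rw [Real.sq_sqrt hNG.h2.le]; exact hv

lemma pR_mono {n : ℕ} {a b : ℝ} (ha : 0 ≤ a) (hab : a ≤ b) (hb : b < 1) (hn : n ≠ 0) :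
    pR n a ≤ pR n b := by
  unfold pR
  have h1 : a ^ n ≤ b ^ n := by gcongr
  have h2 : b ^ n < 1 := pow_lt_one₀ (ha.trans hab) hb hn
  have h3 : 0 ≤ a ^ n := by positivity
  rw [div_le_div_iff₀ (by linarith) (by linarith)]
  nlinarith

lemma pR_nonneg {n : ℕ} {a : ℝ} (ha : 0 ≤ a) (hb : a < 1) (hn : n ≠ 0) : 0 ≤ pR n a := by
  unfold pR
  have h2 : a ^ n < 1 := pow_lt_one₀ ha hb hn
  exact div_nonneg (by positivity) (by linarith)

set_option maxHeartbeats 1600000 in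
lemma core {t : ℕ} {N H x p c X Y e0 e1 e2 D : ℝ} (h : NS t N H x p c X Y e0 e1 e2 D)
    {Nv Hv pl ph cl ch E0 E1 E2 E3 Dl Dh ml mh vl vh : ℝ} (hNv : N = Nv) (hHv : H = Hv) (hN0 : 0 ≤ Nv) (hH0 : 0 ≤ Hv)
    (hpl : 0 ≤ pl) (hcl : 0 ≤ cl) (hp1 : pl ≤ p) (hp2 : p ≤ ph) (hc1 : cl ≤ c) (hc2 : c ≤ ch)
    (hE0 : 1.03 * C4 t ≤ E0) (hE1 : 9.3 * Bt t ≤ E1) (hE2 : Bt t ≤ E2) (hE3 : 80 * Bt t ≤ E3)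
    (hDl0 : 0 < Dl)
    (hDl : Dl ≤ 2 - ph + pl * cl - E0 - Nv * (ph * (1 + ph)) + pl * cl * (Nv * (1 + pl) + Hv * (1 + cl)) - E1)
    (hDh : 2 - pl + ph * ch + E0 - Nv * (pl * (1 + pl)) + ph * ch * (Nv * (1 + ph) + Hv * (1 + ch)) + E1 ≤ Dh)
    (hml0 : 0 ≤ ml) (hmh6 : mh ≤ 0.6) (hml : ml * Dh ≤ 1 - 2 * ph + 3 * (pl * cl) - E2)
    (hmh : 1 - 2 * pl + 3 * (ph * ch) + E2 ≤ mh * Dl)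
    (hvl0 : 0 < vl)
    (hvl : vl * Dh ≤ 1 - 4 * ph + 4 * ml * Nv * pl * (1 + pl)
      - mh ^ 2 * (2 - pl + ph * ch + E0 + Nv ^ 2 * ph * (1 + ph) * (1 + 2 * ph)) + 9 * (pl * cl)
      - 6 * mh * (ph * ch * (Nv * (1 + ph) + Hv * (1 + ch)))
      + ml ^ 2 * (pl * cl * ((Nv * (1 + pl) + Hv * (1 + cl)) ^ 2 + Nv ^ 2 * pl * (1 + pl) + Hv ^ 2 * cl * (1 + cl))) - E3)
    (hvh : 1 - 4 * pl + 4 * mh * Nv * ph * (1 + ph)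
      - ml ^ 2 * (2 - ph + pl * cl - E0 + Nv ^ 2 * pl * (1 + pl) * (1 + 2 * pl)) + 9 * (ph * ch)
      - 6 * ml * (pl * cl * (Nv * (1 + pl) + Hv * (1 + cl)))
      + mh ^ 2 * (ph * ch * ((Nv * (1 + ph) + Hv * (1 + ch)) ^ 2 + Nv ^ 2 * ph * (1 + ph) + Hv ^ 2 * ch * (1 + ch))) + E3
       ≤ vh * Dl)
    (hvh0 : 0 ≤ vh) (hphs : 0 ≤ 2 - ph + pl * cl - E0)
    (g1 : muPoly t - 0.55 * (t : ℝ) ^ 4 / 2 ^ (4 * t) ≤ ml) (g2 : mh ≤ muPoly t + 0.55 * (t : ℝ) ^ 4 / 2 ^ (4 * t))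
    (g3 : vPoly t - 0.26 * (t : ℝ) ^ 4 / 2 ^ (3 * t) ≤ vl) (g4 : vh ≤ vPoly t + 0.26 * (t : ℝ) ^ 4 / 2 ^ (3 * t)) :
    0 < D ∧ ∀ μ v e3 : ℝ, μ * D = 1 - 2 * p + 3 * (p * c) - e2 → (|μ| ≤ 0.6 → |e3| ≤ 80 * Bt t) →
    v * D = 1 - 4 * p + 4 * μ * N * p * (1 + p) - μ ^ 2 * (1 / x + N ^ 2 * p * (1 + p) * (1 + 2 * p))
      + 9 * (p * c) - 6 * μ * X + μ ^ 2 * Y - e3 → NG t μ v := by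
  subst hNv
  subst hHv
  have hp0 : 0 ≤ p := hpl.trans hp1
  have hc0 : 0 ≤ c := hcl.trans hc1
  have hph0 : 0 ≤ ph := hp0.trans hp2
  have hch0 : 0 ≤ ch := hc0.trans hc2
  have i0 := abs_le.1 h.b0
  have i1 := abs_le.1 h.b1
  have i2 := abs_le.1 h.b2
  have pc1 : pl * cl ≤ p * c := by gcongr
  have pc2 : p * c ≤ ph * ch := by gcongr
  have X1 : pl * cl * (N * (1 + pl) + H * (1 + cl)) ≤ X := by rw [h.hX]; gcongr
  have X2 : X ≤ ph * ch * (N * (1 + ph) + H * (1 + ch)) := by rw [h.hX]; gcongr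
  have Y1 : pl * cl * ((N * (1 + pl) + H * (1 + cl)) ^ 2 + N ^ 2 * pl * (1 + pl) + H ^ 2 * cl * (1 + cl)) ≤ Y := by
    rw [h.hY]; gcongr
  have Y2 : Y ≤ ph * ch * ((N * (1 + ph) + H * (1 + ch)) ^ 2 + N ^ 2 * ph * (1 + ph) + H ^ 2 * ch * (1 + ch)) := by
    rw [h.hY]; gcongr
  have X0 : 0 ≤ X := le_trans (by positivity) X1
  have Y0 : 0 ≤ Y := le_trans (by positivity) Y1
  have u1 : N * (pl * (1 + pl)) ≤ N * (p * (1 + p)) := by gcongr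
  have u2 : N * (p * (1 + p)) ≤ N * (ph * (1 + ph)) := by gcongr
  have y1 : 2 - ph + pl * cl - E0 ≤ 1 / x := by rw [h.h0]; linarith
  have y2 : 1 / x ≤ 2 - pl + ph * ch + E0 := by rw [h.h0]; linarith
  have D1 : Dl ≤ D := by rw [h.hD]; linarith
  have D2 : D ≤ Dh := by rw [h.hD]; linarith
  have D0 : 0 < D := by linarith
  refine ⟨D0, fun μ v e3 hμ he3 hv => ?_⟩
  have m1 : ml ≤ μ := by
    apply le_of_mul_le_mul_right _ D0
    have : ml * D ≤ ml * Dh := by gcongr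
    linarith
  have m0 : 0 ≤ μ := hml0.trans m1
  have hmh0 : 0 ≤ mh := by
    by_contra hneg
    push Not at hneg
    have : 0 ≤ μ * D := by positivity
    have hneg' : mh * Dl < 0 := mul_neg_of_neg_of_pos hneg hDl0
    linarith
  have m2 : μ ≤ mh := by
    apply le_of_mul_le_mul_right _ D0
    have : mh * Dl ≤ mh * D := by gcongr
    linarith
  have i3 := abs_le.1 (he3 (by rw [abs_of_nonneg m0]; linarith))
  have s1 : N ^ 2 * pl * (1 + pl) * (1 + 2 * pl) ≤ N ^ 2 * p * (1 + p) * (1 + 2 * p) := by gcongr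
  have s2 : N ^ 2 * p * (1 + p) * (1 + 2 * p) ≤ N ^ 2 * ph * (1 + ph) * (1 + 2 * ph) := by gcongr
  have s0 : 0 ≤ N ^ 2 * pl * (1 + pl) * (1 + 2 * pl) := by positivity
  have w1 : 4 * ml * N * pl * (1 + pl) ≤ 4 * μ * N * p * (1 + p) := by gcongr
  have w2 : 4 * μ * N * p * (1 + p) ≤ 4 * mh * N * ph * (1 + ph) := by gcongr
  have x0 : 0 ≤ 1 / x := hphs.trans y1
  have z1 : ml ^ 2 * (2 - ph + pl * cl - E0 + N ^ 2 * pl * (1 + pl) * (1 + 2 * pl)) ≤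
      μ ^ 2 * (1 / x + N ^ 2 * p * (1 + p) * (1 + 2 * p)) := by gcongr
  have z2 : μ ^ 2 * (1 / x + N ^ 2 * p * (1 + p) * (1 + 2 * p)) ≤
      mh ^ 2 * (2 - pl + ph * ch + E0 + N ^ 2 * ph * (1 + ph) * (1 + 2 * ph)) := by gcongr
  have f1 : 6 * ml * (pl * cl * (N * (1 + pl) + H * (1 + cl))) ≤ 6 * μ * X := by gcongr
  have f2 : 6 * μ * X ≤ 6 * mh * (ph * ch * (N * (1 + ph) + H * (1 + ch))) := by gcongr
  have g1' : ml ^ 2 * (pl * cl * ((N * (1 + pl) + H * (1 + cl)) ^ 2 + N ^ 2 * pl * (1 + pl) + H ^ 2 * cl * (1 + cl)))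
      ≤ μ ^ 2 * Y := by gcongr
  have g2' : μ ^ 2 * Y ≤ mh ^ 2 * (ph * ch * ((N * (1 + ph) + H * (1 + ch)) ^ 2 + N ^ 2 * ph * (1 + ph) + H ^ 2 * ch * (1 + ch))) := by
    gcongr
  have v1 : vl ≤ v := by
    apply le_of_mul_le_mul_right _ D0
    have : vl * D ≤ vl * Dh := by gcongr
    linarith
  have v2 : v ≤ vh := by
    apply le_of_mul_le_mul_right _ D0
    have : vh * Dl ≤ vh * D := by gcongr
    linarith
  refine ⟨?_, by linarith, ?_⟩
  · rw [abs_le]; constructor <;> linarith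
  · rw [abs_le]; constructor <;> linarith

lemma C4_le_2 : C4 2 ≤ 0.000009035 := by
  unfold C4
  rw [hp_succ 2 3, hp_two, hp_three]
  norm_num

lemma loc_2 {x : ℝ} (hu : ∀ q : ℂ, ‖q‖ < 1 - 0.72 / (((2 : ℕ)) : ℝ) → bGF 2 q 1 1 1 = 1 → q = (x : ℂ)) :
    (0.55735 : ℝ) ≤ x ∧ x ≤ 0.55739 := by
  have hC := C4_le_2
  have e2 : hp 2 2 = 3 := by rw [hp_two]
  have e3 : hp 2 3 = 7 := by rw [hp_three]; norm_num
  refine locate 2 (by norm_num) (by norm_num) (by norm_num) (by norm_num) hu ?_ ?_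
  · refine le_trans (b := 1.03 * 0.000009035) (by linarith) ?_
    rw [e2, e3]; unfold pR; norm_num
  · refine le_trans (b := -(1.03 * 0.000009035)) ?_ (by linarith)
    rw [e2, e3]; unfold pR; norm_num

lemma num_2 {x : ℝ} (h1 : 0.55735 ≤ x) (h2 : x ≤ 0.55739) : NumOK 2 x := by
  intro N H p c X Y e0 e1 e2 D h
  have hC := C4_le_2
  have hB : Bt 2 = 17 * C4 2 := rfl
  have hx0 : 0 ≤ x := le_trans (by norm_num) h1
  refine core h (Nv := 3) (Hv := 7) (pl := 0.209386) (ph := 0.209442) (cl := 0.0169907) (ch := 0.0169995)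
    (E0 := 1.03 * 0.000009035) (E1 := 9.3 * (17 * 0.000009035)) (E2 := 17 * 0.000009035) (E3 := 80 * (17 * 0.000009035))
    (Dl := 1.070988) (Dh := 1.074192) (ml := 0.550772) (mh := 0.55282) (vl := 0.29774) (vh := 0.34064)
    (by rw [h.hN]; norm_num) (by rw [h.hH]; norm_num) (by norm_num) (by norm_num) (by norm_num) (by norm_num)
    ?_ ?_ ?_ ?_ (by linarith) (by linarith) (by linarith) (by linarith)
    (by norm_num) (by norm_num) (by norm_num) (by norm_num) (by norm_num) (by norm_num) (by norm_num)
    (by norm_num) (by norm_num) (by norm_num) (by norm_num) (by norm_num)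
    (by unfold muPoly; norm_num) (by unfold muPoly; norm_num) (by unfold vPoly; norm_num)
    (by unfold vPoly; norm_num)
  · rw [h.hp]
    exact le_trans (by unfold pR; norm_num) (pR_mono (by norm_num) h1 (h2.trans_lt (by norm_num)) (by norm_num))
  · rw [h.hp]
    exact (pR_mono hx0 h2 (by norm_num) (by norm_num)).trans (by unfold pR; norm_num)
  · rw [h.hc]
    exact le_trans (by unfold pR; norm_num) (pR_mono (by norm_num) h1 (h2.trans_lt (by norm_num)) (by norm_num))
  · rw [h.hc]
    exact (pR_mono hx0 h2 (by norm_num) (by norm_num)).trans (by unfold pR; norm_num)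

lemma C4_le_3 : C4 3 ≤ 0.00000001 := by
  unfold C4
  rw [hp_succ 3 3, hp_two, hp_three]
  norm_num

lemma loc_3 {x : ℝ} (hu : ∀ q : ℂ, ‖q‖ < 1 - 0.72 / (((3 : ℕ)) : ℝ) → bGF 3 q 1 1 1 = 1 → q = (x : ℂ)) :
    (0.52063 : ℝ) ≤ x ∧ x ≤ 0.52065 := by
  have hC := C4_le_3
  have e2 : hp 3 2 = 4 := by rw [hp_two]
  have e3 : hp 3 3 = 13 := by rw [hp_three]; norm_num
  refine locate 3 (by norm_num) (by norm_num) (by norm_num) (by norm_num) hu ?_ ?_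
  · refine le_trans (b := 1.03 * 0.00000001) (by linarith) ?_
    rw [e2, e3]; unfold pR; norm_num
  · refine le_trans (b := -(1.03 * 0.00000001)) ?_ (by linarith)
    rw [e2, e3]; unfold pR; norm_num

lemma num_3 {x : ℝ} (h1 : 0.52063 ≤ x) (h2 : x ≤ 0.52065) : NumOK 3 x := by
  intro N H p c X Y e0 e1 e2 D h
  have hC := C4_le_3
  have hB : Bt 3 = 17 * C4 3 := rfl
  have hx0 : 0 ≤ x := le_trans (by norm_num) h1
  refine core h (Nv := 4) (Hv := 13) (pl := 0.079297) (ph := 0.079311) (cl := 0.0002065) (ch := 0.0002067)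
    (E0 := 1.03 * 0.00000001) (E1 := 9.3 * (17 * 0.00000001)) (E2 := 17 * 0.00000001) (E3 := 80 * (17 * 0.00000001))
    (Dl := 1.578582) (Dh := 1.578665) (ml := 0.532999) (mh := 0.533046) (vl := 0.2639) (vh := 0.26428)
    (by rw [h.hN]; norm_num) (by rw [h.hH]; norm_num) (by norm_num) (by norm_num) (by norm_num) (by norm_num)
    ?_ ?_ ?_ ?_ (by linarith) (by linarith) (by linarith) (by linarith)
    (by norm_num) (by norm_num) (by norm_num) (by norm_num) (by norm_num) (by norm_num) (by norm_num)
    (by norm_num) (by norm_num) (by norm_num) (by norm_num) (by norm_num)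
    (by unfold muPoly; norm_num) (by unfold muPoly; norm_num) (by unfold vPoly; norm_num)
    (by unfold vPoly; norm_num)
  · rw [h.hp]
    exact le_trans (by unfold pR; norm_num) (pR_mono (by norm_num) h1 (h2.trans_lt (by norm_num)) (by norm_num))
  · rw [h.hp]
    exact (pR_mono hx0 h2 (by norm_num) (by norm_num)).trans (by unfold pR; norm_num)
  · rw [h.hc]
    exact le_trans (by unfold pR; norm_num) (pR_mono (by norm_num) h1 (h2.trans_lt (by norm_num)) (by norm_num))
  · rw [h.hc]
    exact (pR_mono hx0 h2 (by norm_num) (by norm_num)).trans (by unfold pR; norm_num)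

lemma C4_le_4 : C4 4 ≤ 0.00000001 := by
  unfold C4
  rw [hp_succ 4 3, hp_two, hp_three]
  norm_num

lemma loc_4 {x : ℝ} (hu : ∀ q : ℂ, ‖q‖ < 1 - 0.72 / (((4 : ℕ)) : ℝ) → bGF 4 q 1 1 1 = 1 → q = (x : ℂ)) :
    (0.509 : ℝ) ≤ x ∧ x ≤ 0.50901 := by
  have hC := C4_le_4
  have e2 : hp 4 2 = 5 := by rw [hp_two]
  have e3 : hp 4 3 = 21 := by rw [hp_three]; norm_num
  refine locate 4 (by norm_num) (by norm_num) (by norm_num) (by norm_num) hu ?_ ?_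
  · refine le_trans (b := 1.03 * 0.00000001) (by linarith) ?_
    rw [e2, e3]; unfold pR; norm_num
  · refine le_trans (b := -(1.03 * 0.00000001)) ?_ (by linarith)
    rw [e2, e3]; unfold pR; norm_num

lemma num_4 {x : ℝ} (h1 : 0.509 ≤ x) (h2 : x ≤ 0.50901) : NumOK 4 x := by
  intro N H p c X Y e0 e1 e2 D h
  have hC := C4_le_4
  have hB : Bt 4 = 17 * C4 4 := rfl
  have hx0 : 0 ≤ x := le_trans (by norm_num) h1
  refine core h (Nv := 5) (Hv := 21) (pl := 0.035374) (ph := 0.035378) (cl := 0.0000006) (ch := 0.0000007)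
    (E0 := 1.03 * 0.00000001) (E1 := 9.3 * (17 * 0.00000001)) (E2 := 17 * 0.00000001) (E3 := 80 * (17 * 0.00000001))
    (Dl := 1.781472) (Dh := 1.781502) (ml := 0.521606) (mh := 0.521621) (vl := 0.24654) (vh := 0.24665)
    (by rw [h.hN]; norm_num) (by rw [h.hH]; norm_num) (by norm_num) (by norm_num) (by norm_num) (by norm_num)
    ?_ ?_ ?_ ?_ (by linarith) (by linarith) (by linarith) (by linarith)
    (by norm_num) (by norm_num) (by norm_num) (by norm_num) (by norm_num) (by norm_num) (by norm_num)
    (by norm_num) (by norm_num) (by norm_num) (by norm_num) (by norm_num)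
    (by unfold muPoly; norm_num) (by unfold muPoly; norm_num) (by unfold vPoly; norm_num)
    (by unfold vPoly; norm_num)
  · rw [h.hp]
    exact le_trans (by unfold pR; norm_num) (pR_mono (by norm_num) h1 (h2.trans_lt (by norm_num)) (by norm_num))
  · rw [h.hp]
    exact (pR_mono hx0 h2 (by norm_num) (by norm_num)).trans (by unfold pR; norm_num)
  · rw [h.hc]
    exact le_trans (by unfold pR; norm_num) (pR_mono (by norm_num) h1 (h2.trans_lt (by norm_num)) (by norm_num))
  · rw [h.hc]
    exact (pR_mono hx0 h2 (by norm_num) (by norm_num)).trans (by unfold pR; norm_num)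

lemma C4_le_5 : C4 5 ≤ 0.00000001 := by
  unfold C4
  rw [hp_succ 5 3, hp_two, hp_three]
  norm_num

lemma loc_5 {x : ℝ} (hu : ∀ q : ℂ, ‖q‖ < 1 - 0.72 / (((5 : ℕ)) : ℝ) → bGF 5 q 1 1 1 = 1 → q = (x : ℂ)) :
    (0.50421 : ℝ) ≤ x ∧ x ≤ 0.504215 := by
  have hC := C4_le_5
  have e2 : hp 5 2 = 6 := by rw [hp_two]
  have e3 : hp 5 3 = 31 := by rw [hp_three]; norm_num
  refine locate 5 (by norm_num) (by norm_num) (by norm_num) (by norm_num) hu ?_ ?_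
  · refine le_trans (b := 1.03 * 0.00000001) (by linarith) ?_
    rw [e2, e3]; unfold pR; norm_num
  · refine le_trans (b := -(1.03 * 0.00000001)) ?_ (by linarith)
    rw [e2, e3]; unfold pR; norm_num

lemma num_5 {x : ℝ} (h1 : 0.50421 ≤ x) (h2 : x ≤ 0.504215) : NumOK 5 x := by
  intro N H p c X Y e0 e1 e2 D h
  have hC := C4_le_5
  have hB : Bt 5 = 17 * C4 5 := rfl
  have hx0 : 0 ≤ x := le_trans (by norm_num) h1
  refine core h (Nv := 6) (Hv := 31) (pl := 0.016705) (ph := 0.016707) (cl := 0) (ch := 0.0000001)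
    (E0 := 1.03 * 0.00000001) (E1 := 9.3 * (17 * 0.00000001)) (E2 := 17 * 0.00000001) (E3 := 80 * (17 * 0.00000001))
    (Dl := 1.881374) (Dh := 1.881393) (ml := 0.51376) (mh := 0.513769) (vl := 0.24038) (vh := 0.24045)
    (by rw [h.hN]; norm_num) (by rw [h.hH]; norm_num) (by norm_num) (by norm_num) (by norm_num) (by norm_num)
    ?_ ?_ ?_ ?_ (by linarith) (by linarith) (by linarith) (by linarith)
    (by norm_num) (by norm_num) (by norm_num) (by norm_num) (by norm_num) (by norm_num) (by norm_num)
    (by norm_num) (by norm_num) (by norm_num) (by norm_num) (by norm_num)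
    (by unfold muPoly; norm_num) (by unfold muPoly; norm_num) (by unfold vPoly; norm_num)
    (by unfold vPoly; norm_num)
  · rw [h.hp]
    exact le_trans (by unfold pR; norm_num) (pR_mono (by norm_num) h1 (h2.trans_lt (by norm_num)) (by norm_num))
  · rw [h.hp]
    exact (pR_mono hx0 h2 (by norm_num) (by norm_num)).trans (by unfold pR; norm_num)
  · rw [h.hc]
    exact le_trans (by unfold pR; norm_num) (pR_mono (by norm_num) h1 (h2.trans_lt (by norm_num)) (by norm_num))
  · rw [h.hc]
    exact (pR_mono hx0 h2 (by norm_num) (by norm_num)).trans (by unfold pR; norm_num)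

lemma abs_mul_le {a b A B : ℝ} (ha : |a| ≤ A) (hb : |b| ≤ B) : |a * b| ≤ A * B := by
  rw [abs_mul]
  exact mul_le_mul ha hb (abs_nonneg _) ((abs_nonneg _).trans ha)

lemma abs_add_le' {a b A B : ℝ} (ha : |a| ≤ A) (hb : |b| ≤ B) : |a + b| ≤ A + B :=
  (abs_add_le a b).trans (add_le_add ha hb)

def muE (ν E : ℝ) : ℝ := 1 / 2 + (1 - 3 * ν) / 4 * E + (2 - ν - 9 * ν ^ 2) / 8 * E ^ 2
  + (9 + 18 * ν - 61 * ν ^ 2 - 54 * ν ^ 3) / 32 * E ^ 3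

/-- `ν` times the variance polynomial -/
def vE (ν E : ℝ) : ℝ := ν / 4 + (-1 + 7 * ν - 8 * ν ^ 2) / 8 * E
  + (-4 + 16 * ν + 7 * ν ^ 2 - 33 * ν ^ 3) / 16 * E ^ 2

lemma g_bound {ν z R1 g b3 : ℝ} (h0 : 0 ≤ ν) (h1 : ν ≤ 1 / 7) (hz0 : 0 < z) (hz : z ≤ 0.0576)
    (hR : |R1| ≤ 0.06) (hb : b3 = (1 - ν) / 8 + ν / 2 + ν ^ 2)
    (hg : g = -(1 / 2 + ν) + b3 * z + R1 * z ^ 2) :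
    (0 ≤ b3 ∧ b3 ≤ 0.2) ∧ -0.65 ≤ g ∧ g ≤ -0.48 := by
  obtain ⟨r1, r2⟩ := abs_le.1 hR
  have b0 : 0 ≤ b3 := by rw [hb]; nlinarith
  have b1 : b3 ≤ 0.2 := by rw [hb]; nlinarith
  have hz2 : z ^ 2 ≤ 0.0576 ^ 2 := by gcongr
  have hz20 : 0 ≤ z ^ 2 := by positivity
  have k1 : |R1 * z ^ 2| ≤ 0.06 * 0.0576 ^ 2 :=
    abs_mul_le hR (by rwa [abs_of_nonneg hz20])
  obtain ⟨k2, k3⟩ := abs_le.1 k1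
  have k4 : b3 * z ≤ 0.2 * 0.0576 := by gcongr
  have k5 : 0 ≤ b3 * z := by positivity
  refine ⟨⟨b0, b1⟩, ?_, ?_⟩
  · rw [hg]; linarith
  · rw [hg]; linarith

set_option maxHeartbeats 1600000 in
lemma mu_core {ν z R1 b3 E : ℝ} (h0 : 0 ≤ ν) (h1 : ν ≤ 1 / 7) (hz0 : 0 < z) (hz : z ≤ 0.0576)
    (hR : |R1| ≤ 0.06) (hb : b3 = (1 - ν) / 8 + ν / 2 + ν ^ 2)
    (hE : E = z - (1 / 2 + ν) * z ^ 2 + b3 * z ^ 3 + R1 * z ^ 4) :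
    |1 - 2 * z * ν - muE ν E * (2 - (1 + ν) * z - ν * z ^ 2)| ≤ 2.6 * z ^ 4 := by
  obtain ⟨g, hg⟩ : ∃ g, g = -(1 / 2 + ν) + b3 * z + R1 * z ^ 2 := ⟨_, rfl⟩
  obtain ⟨⟨b0, b1⟩, g1, g2⟩ := g_bound h0 h1 hz0 hz hR hb hg
  have hga : |g| ≤ 0.65 := abs_le.2 ⟨g1, by linarith⟩
  have hza : |z| ≤ 0.0576 := by rwa [abs_of_pos hz0]
  obtain ⟨α, hα⟩ : ∃ α, α = (1 - 3 * ν) / 4 := ⟨_, rfl⟩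
  obtain ⟨β, hβ⟩ : ∃ β, β = (2 - ν - 9 * ν ^ 2) / 8 := ⟨_, rfl⟩
  obtain ⟨γ, hγ⟩ : ∃ γ, γ = (9 + 18 * ν - 61 * ν ^ 2 - 54 * ν ^ 3) / 32 := ⟨_, rfl⟩
  have hn2 : 0 ≤ ν ^ 2 := by positivity
  have hn3 : 0 ≤ ν ^ 3 := by positivity
  have hn2' : ν ^ 2 ≤ 1 / 49 := by nlinarith
  have hn3' : ν ^ 3 ≤ 1 / 343 := by
    calc ν ^ 3 ≤ (1 / 7) ^ 3 := by gcongr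
      _ = _ := by norm_num
  have ha : |α| ≤ 0.25 := by rw [hα, abs_le]; constructor <;> linarith
  have hbb : |β| ≤ 0.25 := by rw [hβ, abs_le]; constructor <;> linarith
  have hc : |γ| ≤ 0.37 := by rw [hγ, abs_le]; constructor <;> linarith
  have hb3 : |b3| ≤ 0.2 := by rw [abs_of_nonneg b0]; exact b1
  obtain ⟨R2, hR2⟩ : ∃ R2, R2 = 2 * b3 + 2 * R1 * z + g ^ 2 := ⟨_, rfl⟩
  obtain ⟨R3, hR3⟩ : ∃ R3, R3 = 3 * g + 3 * z * g ^ 2 + z ^ 2 * g ^ 3 := ⟨_, rfl⟩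
  have hg2 : |g ^ 2| ≤ 0.65 ^ 2 := by rw [abs_pow]; gcongr
  have hg3 : |g ^ 3| ≤ 0.65 ^ 3 := by rw [abs_pow]; gcongr
  have hz2 : |z ^ 2| ≤ 0.0576 ^ 2 := by rw [abs_pow]; gcongr
  have hnu : |ν| ≤ 1 / 7 := by rwa [abs_of_nonneg h0]
  have B2 : |R2| ≤ 0.85 := by
    rw [hR2, mul_assoc]
    have := abs_le.1 (abs_mul_le hR hza)
    have := abs_le.1 hg2
    rw [abs_le]; constructor <;> linarith
  have B3 : |R3| ≤ 2.05 := by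
    rw [hR3, mul_assoc]
    have := abs_le.1 (abs_mul_le hza hg2)
    have := abs_le.1 (abs_mul_le hz2 hg3)
    rw [abs_le]; constructor <;> linarith
  have E2 : E ^ 2 = z ^ 2 - (1 + 2 * ν) * z ^ 3 + R2 * z ^ 4 := by
    have : E = z + z ^ 2 * g := by rw [hE, hg]; ring
    rw [this, hR2]
    have e2 : z ^ 3 * g = z ^ 3 * (-(1 / 2 + ν) + b3 * z + R1 * z ^ 2) := by rw [hg]
    linear_combination 2 * e2
  have E3 : E ^ 3 = z ^ 3 + R3 * z ^ 4 := by
    have : E = z + z ^ 2 * g := by rw [hE, hg]; ring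
    rw [this, hR3]; ring
  obtain ⟨S, hS⟩ : ∃ S, S = α * R1 + β * R2 + γ * R3 := ⟨_, rfl⟩
  obtain ⟨p2, hp2⟩ : ∃ p2, p2 = β - α * (1 / 2 + ν) := ⟨_, rfl⟩
  obtain ⟨p3, hp3⟩ : ∃ p3, p3 = γ - β * (1 + 2 * ν) + α * b3 := ⟨_, rfl⟩
  have BS : |S| ≤ 0.25 * 0.06 + 0.25 * 0.85 + 0.37 * 2.05 := by
    rw [hS]
    exact abs_add_le' (abs_add_le' (abs_mul_le ha hR) (abs_mul_le hbb B2)) (abs_mul_le hc B3)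
  have Bp2 : |p2| ≤ 0.5 := by
    rw [hp2]
    have := abs_le.1 (abs_mul_le ha (show |1 / 2 + ν| ≤ 0.65 by rw [abs_le]; constructor <;> linarith))
    have := abs_le.1 hbb
    rw [abs_le]; constructor <;> linarith
  have Bp3 : |p3| ≤ 0.2 := by
    have : p3 = 1 / 16 + 3 / 16 * ν - 9 / 16 * ν ^ 2 - 3 / 16 * ν ^ 3 := by
      rw [hp3, hα, hβ, hγ, hb]; ring
    rw [this, abs_le]
    constructor <;> linarith
  have key : 1 - 2 * z * ν - muE ν E * (2 - (1 + ν) * z - ν * z ^ 2) =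
      (-(S * (2 - (1 + ν) * z - ν * z ^ 2)) + (1 + ν) * p3 + ν * p2 + ν * (p3 * z)) * z ^ 4 := by
    unfold muE
    rw [← hα, ← hβ, ← hγ, E2, E3, hE, hS, hp2, hp3, hα, hβ, hγ, hb]
    ring
  rw [key, abs_mul, abs_of_pos (show 0 < z ^ 4 by positivity)]
  gcongr
  have hD : |2 - (1 + ν) * z - ν * z ^ 2| ≤ 2 := by
    have : 0 ≤ (1 + ν) * z := by positivity
    have : 0 ≤ ν * z ^ 2 := by positivity
    have : (1 + ν) * z ≤ 2 * 0.0576 := by gcongr; linarith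
    have : ν * z ^ 2 ≤ 1 * 1 := by
      gcongr
      · linarith
      · nlinarith
    rw [abs_le]; constructor <;> linarith
  have f1 := abs_le.1 (abs_mul_le BS hD)
  have f2 := abs_le.1 (abs_mul_le (show |1 + ν| ≤ 1.15 by rw [abs_le]; constructor <;> linarith) Bp3)
  have f3 := abs_le.1 (abs_mul_le hnu Bp2)
  have f4 := abs_le.1 (abs_mul_le hnu (abs_mul_le Bp3 hza))
  rw [abs_le]; constructor <;> linarith

set_option maxHeartbeats 1600000 in
lemma v_core {ν z R1 b3 E R m1 m2 μ : ℝ} (h0 : 0 ≤ ν) (h1 : ν ≤ 1 / 7) (hz0 : 0 < z) (hz : z ≤ 0.0576)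
    (hR : |R1| ≤ 0.06) (hb : b3 = (1 - ν) / 8 + ν / 2 + ν ^ 2)
    (hE : E = z - (1 / 2 + ν) * z ^ 2 + b3 * z ^ 3 + R1 * z ^ 4) (hRR : |R| ≤ 0.1)
    (hm1 : m1 = (1 - 3 * ν) / 4) (hm2 : m2 = ((1 + ν) * m1 + ν / 2) / 2)
    (hμ : μ = 1 / 2 + m1 * z + m2 * z ^ 2 + R * z ^ 3) :
    |ν * (1 - 4 * z * ν + 4 * μ * z * (1 + z * ν) - μ ^ 2 * (2 - z * ν))
      - μ ^ 2 * z * (1 + z * ν) * (1 + 2 * z * ν)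
      - vE ν E * (2 - (1 + ν) * z - ν * z ^ 2)| ≤ 1.7 * z ^ 3 := by
  obtain ⟨g, hg⟩ : ∃ g, g = -(1 / 2 + ν) + b3 * z + R1 * z ^ 2 := ⟨_, rfl⟩
  obtain ⟨⟨b0, b1⟩, g1, g2⟩ := g_bound h0 h1 hz0 hz hR hb hg
  have hza : |z| ≤ 0.0576 := by rwa [abs_of_pos hz0]
  have hnu : |ν| ≤ 1 / 7 := by rwa [abs_of_nonneg h0]
  have hn2 : 0 ≤ ν ^ 2 := by positivity
  have hn3 : 0 ≤ ν ^ 3 := by positivity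
  have hn2' : ν ^ 2 ≤ 1 / 49 := by nlinarith
  have hn3' : ν ^ 3 ≤ 1 / 343 := by
    calc ν ^ 3 ≤ (1 / 7) ^ 3 := by gcongr
      _ = _ := by norm_num
  obtain ⟨α, hα⟩ : ∃ α, α = (-1 + 7 * ν - 8 * ν ^ 2) / 8 := ⟨_, rfl⟩
  obtain ⟨β, hβ⟩ : ∃ β, β = (-4 + 16 * ν + 7 * ν ^ 2 - 33 * ν ^ 3) / 16 := ⟨_, rfl⟩
  obtain ⟨g3, hg3⟩ : ∃ g3, g3 = b3 + R1 * z := ⟨_, rfl⟩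
  obtain ⟨s, hs⟩ : ∃ s, s = 2 * g + z * g ^ 2 := ⟨_, rfl⟩
  obtain ⟨κ, hκ⟩ : ∃ κ, κ = m2 + R * z := ⟨_, rfl⟩
  obtain ⟨n2, hn⟩ : ∃ n2, n2 = m2 + m1 ^ 2 := ⟨_, rfl⟩
  obtain ⟨ρ, hρ⟩ : ∃ ρ, ρ = R + 2 * (m1 * κ) + κ ^ 2 * z := ⟨_, rfl⟩
  obtain ⟨a2, ha2⟩ : ∃ a2, a2 = β - α * (1 / 2 + ν) := ⟨_, rfl⟩
  obtain ⟨a3, ha3⟩ : ∃ a3, a3 = α * g3 + β * s := ⟨_, rfl⟩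
  have ha : |α| ≤ 0.125 := by rw [hα, abs_le]; constructor <;> nlinarith
  have hbb : |β| ≤ 0.25 := by rw [hβ, abs_le]; constructor <;> nlinarith
  have hm1b : |m1| ≤ 0.25 := by rw [hm1, abs_le]; constructor <;> linarith
  have hm2b : |m2| ≤ 0.126 := by rw [hm2, hm1, abs_le]; constructor <;> nlinarith
  have hg3b : |g3| ≤ 0.21 := by
    have := abs_le.1 (abs_mul_le hR hza)
    rw [hg3, abs_le]; constructor <;> linarith
  have hsb : |s| ≤ 1.3 := by
    have k1 : 0 ≤ z * g ^ 2 := by positivity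
    have k2 : z * g ^ 2 ≤ 0.0576 * 0.65 ^ 2 := by
      have : g ^ 2 ≤ 0.65 ^ 2 := by nlinarith
      gcongr
    rw [hs, abs_le]; constructor <;> linarith
  have hκb : |κ| ≤ 0.132 := by
    have := abs_le.1 (abs_mul_le hRR hza)
    have := abs_le.1 hm2b
    rw [hκ, abs_le]; constructor <;> linarith
  have hn2b : |n2| ≤ 0.19 := by
    have := abs_le.1 (show |m1 ^ 2| ≤ 0.25 ^ 2 by rw [abs_pow]; gcongr)
    have := abs_le.1 hm2b
    rw [hn, abs_le]; constructor <;> linarith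
  have hρb : |ρ| ≤ 0.17 := by
    have := abs_le.1 (abs_mul_le hm1b hκb)
    have := abs_le.1 (abs_mul_le (show |κ ^ 2| ≤ 0.132 ^ 2 by rw [abs_pow]; gcongr) hza)
    have := abs_le.1 hRR
    rw [hρ, abs_le]; constructor <;> linarith
  have ha2b : |a2| ≤ 0.25 := by
    have : a2 = -3 / 16 + 11 / 16 * ν + 1 / 16 * ν ^ 2 - 17 / 16 * ν ^ 3 := by
      rw [ha2, hα, hβ]; ring
    rw [this, abs_le]; constructor <;> linarith
  have ha3b : |a3| ≤ 0.125 * 0.21 + 0.25 * 1.3 := by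
    rw [ha3]
    exact abs_add_le' (abs_mul_le ha hg3b) (abs_mul_le hbb hsb)
  have E1 : E = z - (1 / 2 + ν) * z ^ 2 + g3 * z ^ 3 := by rw [hE, hg3]; ring
  have E2 : E ^ 2 = z ^ 2 + s * z ^ 3 := by
    have : E = z + z ^ 2 * g := by rw [hE, hg]; ring
    rw [this, hs]; ring
  have M2 : μ ^ 2 = 1 / 4 + m1 * z + n2 * z ^ 2 + ρ * z ^ 3 := by
    rw [hμ, hn, hρ, hκ]; ring
  have M1 : μ = 1 / 2 + m1 * z + κ * z ^ 2 := by rw [hμ, hκ]; ring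
  have V1 : vE ν E = ν / 4 + α * z + a2 * z ^ 2 + a3 * z ^ 3 := by
    unfold vE
    rw [← hα, ← hβ, E2, E1, ha2, ha3]; ring
  have key : ν * (1 - 4 * z * ν + 4 * μ * z * (1 + z * ν) - μ ^ 2 * (2 - z * ν))
      - μ ^ 2 * z * (1 + z * ν) * (1 + 2 * z * ν)
      - vE ν E * (2 - (1 + ν) * z - ν * z ^ 2) =
      ((4 * (ν * κ) + 4 * (ν * (ν * (m1 + κ * z)))) + (-2 * (ν * ρ) + ν * (ν * (n2 + ρ * z)))
       - (n2 + ρ * z) - 3 * (ν * (m1 + (n2 + ρ * z) * z))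
       - 2 * (ν * (ν * (1 / 4 + (m1 + (n2 + ρ * z) * z) * z)))
       - 2 * a3 + (1 + ν) * (a2 + a3 * z) + ν * (α + (a2 + a3 * z) * z)) * z ^ 3 := by
    rw [V1, M2, M1, ha2, hα, hn, hκ, hm2, hm1, hβ]
    ring
  rw [key, abs_mul, abs_of_pos (show 0 < z ^ 3 by positivity)]
  gcongr
  have k1 : |m1 + κ * z| ≤ 0.26 := (abs_add_le' hm1b (abs_mul_le hκb hza)).trans (by norm_num)
  have k2 : |n2 + ρ * z| ≤ 0.2 := (abs_add_le' hn2b (abs_mul_le hρb hza)).trans (by norm_num)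
  have k3 : |m1 + (n2 + ρ * z) * z| ≤ 0.262 := (abs_add_le' hm1b (abs_mul_le k2 hza)).trans (by norm_num)
  have k4 : |1 / 4 + (m1 + (n2 + ρ * z) * z) * z| ≤ 0.27 :=
    (abs_add_le' (show |(1 / 4 : ℝ)| ≤ 0.25 by norm_num [abs_le]) (abs_mul_le k3 hza)).trans (by norm_num)
  have k5 : |a2 + a3 * z| ≤ 0.272 := (abs_add_le' ha2b (abs_mul_le ha3b hza)).trans (by norm_num)
  have k6 : |α + (a2 + a3 * z) * z| ≤ 0.142 := (abs_add_le' ha (abs_mul_le k5 hza)).trans (by norm_num)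
  have q1 := abs_le.1 (abs_mul_le hnu hκb)
  have q2 := abs_le.1 (abs_mul_le hnu (abs_mul_le hnu k1))
  have q3 := abs_le.1 (abs_mul_le hnu hρb)
  have q4 := abs_le.1 (abs_mul_le hnu (abs_mul_le hnu k2))
  have q5 := abs_le.1 k2
  have q6 := abs_le.1 (abs_mul_le hnu k3)
  have q7 := abs_le.1 (abs_mul_le hnu (abs_mul_le hnu k4))
  have q8 := abs_le.1 ha3b
  have q9 := abs_le.1 (abs_mul_le (show |1 + ν| ≤ 1.15 by rw [abs_le]; constructor <;> linarith) k5)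
  have q10 := abs_le.1 (abs_mul_le hnu k6)
  clear k1 k2 k3 k4 k5 k6 key V1 M1 M2 E1 E2 hμ hm1 hm2 hE hb
  rw [abs_le]; constructor <;> linarith

lemma bern_le {a : ℝ} (h0 : 0 ≤ a) (h1 : a ≤ 1) (n : ℕ) :
    (1 - a) ^ n ≤ 1 - n * a + n * (n - 1) / 2 * a ^ 2 := by
  induction n with
  | zero => simp
  | succ n ih =>
    rw [pow_succ]
    have h2 : (1 - a) ^ n * (1 - a) ≤ (1 - n * a + n * (n - 1) / 2 * a ^ 2) * (1 - a) :=
      mul_le_mul_of_nonneg_right ih (by linarith)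
    refine h2.trans ?_
    push_cast
    have h3 : (0 : ℝ) ≤ n * (n - 1) := by
      rcases n with _ | n
      · simp
      · push_cast; have : (0 : ℝ) ≤ n := Nat.cast_nonneg n
        nlinarith
    have h4 : 0 ≤ (n * (n - 1) : ℝ) * a ^ 3 := by positivity
    nlinarith

lemma bern_ge {a : ℝ} (h0 : 0 ≤ a) (h1 : a ≤ 1) (n : ℕ) :
    1 - n * a + n * (n - 1) / 2 * a ^ 2 - n * (n - 1) * (n - 2) / 6 * a ^ 3 ≤ (1 - a) ^ n := by
  induction n with
  | zero => simp
  | succ n ih =>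
    rw [pow_succ]
    have h2 := mul_le_mul_of_nonneg_right ih (show 0 ≤ 1 - a by linarith)
    refine le_trans ?_ h2
    push_cast
    have h3 : (0 : ℝ) ≤ n * (n - 1) * (n - 2) := by
      rcases n with _ | _ | n
      · simp
      · simp
      · push_cast; have : (0 : ℝ) ≤ n := Nat.cast_nonneg n
        have e : ((n : ℝ) + 1 + 1) * ((n : ℝ) + 1 + 1 - 1) * ((n : ℝ) + 1 + 1 - 2) = (n + 2) * (n + 1) * n := by ring
        rw [e]; positivity
    have h4 : 0 ≤ (n * (n - 1) * (n - 2) : ℝ) * a ^ 4 := by positivity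
    nlinarith

set_option maxHeartbeats 1600000 in
/-- expansion of `E = n / 2^n` in `z = n p` -/
lemma E_exp {n : ℕ} {ν z p e A E b3 : ℝ} (hn : 7 ≤ n) (hν : ν * n = 1) (hz : z = n * p) (hp : 0 < p)
    (hz1 : z ≤ 0.0576) (he : n * |e| ≤ 0.0001 * z ^ 4) (hA : A = (1 - (p - e) / 2) ^ n)
    (hE : E * (1 + p) = z * A) (hb : b3 = (1 - ν) / 8 + ν / 2 + ν ^ 2) :
    ∃ R1, |R1| ≤ 0.06 ∧ E = z - (1 / 2 + ν) * z ^ 2 + b3 * z ^ 3 + R1 * z ^ 4 := by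
  have hn7 : (7 : ℝ) ≤ n := by exact_mod_cast hn
  have hν0 : 0 < ν := by
    by_contra h
    push Not at h
    nlinarith
  have hν1 : ν ≤ 1 / 7 := by nlinarith
  have hz0 : 0 < z := by rw [hz]; positivity
  obtain ⟨δ, hδ⟩ : ∃ δ, δ = n * e := ⟨_, rfl⟩
  have hδa : |δ| ≤ 0.0001 * z ^ 4 := by
    rw [hδ, abs_mul, abs_of_nonneg (by positivity : (0 : ℝ) ≤ n)]; exact he
  have hz4 : z ^ 4 ≤ 0.0576 * z ^ 3 := by
    have : 0 < z ^ 3 := by positivity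
    nlinarith
  have hz3 : z ^ 3 ≤ 0.0576 ^ 2 * z := by
    have : z ^ 2 ≤ 0.0576 ^ 2 := by gcongr
    nlinarith
  have hz30 : 0 < z ^ 3 := by positivity
  obtain ⟨d1, d2⟩ := abs_le.1 hδa
  have hδ3 : |δ| ≤ 0.00001 * z ^ 3 := by linarith
  have hδ1 : |δ| ≤ 0.0000001 * z := by linarith
  obtain ⟨d3, d4⟩ := abs_le.1 hδ3
  obtain ⟨d5, d6⟩ := abs_le.1 hδ1
  obtain ⟨a, ha⟩ : ∃ a, a = (p - e) / 2 := ⟨_, rfl⟩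
  have hna : n * a = (z - δ) / 2 := by rw [ha, hz, hδ]; ring
  have ha0 : 0 ≤ a := by
    by_contra h
    push Not at h
    have : (n : ℝ) * a < 0 := by nlinarith
    linarith
  have ha1 : a ≤ 1 := by
    by_contra h
    push Not at h
    have : (7 : ℝ) ≤ n * a := by nlinarith
    linarith
  have l1 := bern_le ha0 ha1 n
  have l2 := bern_ge ha0 ha1 n
  rw [← show A = (1 - a) ^ n by rw [hA, ha]] at l1 l2
  have s2 : (n : ℝ) * (n - 1) / 2 * a ^ 2 = (1 - ν) * (z - δ) ^ 2 / 8 := by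
    have : (n : ℝ) * (n - 1) / 2 * a ^ 2 = (n * a) ^ 2 * (1 - ν) / 2 + (ν * n - 1) * n * a ^ 2 / 2 := by ring
    rw [this, hna, hν]; ring
  have s3 : (n : ℝ) * (n - 1) * (n - 2) / 6 * a ^ 3 ≤ (z - δ) ^ 3 / 48 := by
    have h1 : (n : ℝ) * (n - 1) * (n - 2) ≤ n ^ 3 := by nlinarith
    have h2 : (n : ℝ) * (n - 1) * (n - 2) / 6 * a ^ 3 ≤ n ^ 3 / 6 * a ^ 3 := by gcongr
    have h3 : (n : ℝ) ^ 3 / 6 * a ^ 3 = (n * a) ^ 3 / 6 := by ring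
    rw [h3, hna] at h2
    linarith
  have s4 : (z - δ) ^ 3 ≤ 1.001 * z ^ 3 := by
    have : (z - δ) ^ 3 ≤ (1.0001 * z) ^ 3 := by
      gcongr
      · linarith
      · linarith
    nlinarith
  have s5 : |(z - δ) ^ 2 - z ^ 2| ≤ 0.00001 * z ^ 3 := by
    have e1 : (z - δ) ^ 2 - z ^ 2 = δ * (δ - 2 * z) := by ring
    rw [e1]
    have : |δ - 2 * z| ≤ 1 := by rw [abs_le]; constructor <;> linarith
    have := abs_mul_le hδ3 this
    linarith
  have s6 : |(1 - ν) * ((z - δ) ^ 2 - z ^ 2)| ≤ 1 * (0.00001 * z ^ 3) :=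
    abs_mul_le (by rw [abs_le]; constructor <;> linarith) s5
  obtain ⟨s7, s8⟩ := abs_le.1 s6
  obtain ⟨r, hr⟩ : ∃ r, r = (1 - z / 2 + (1 - ν) * z ^ 2 / 8 - A) / z ^ 3 := ⟨_, rfl⟩
  have hr' : A = 1 - z / 2 + (1 - ν) * z ^ 2 / 8 - r * z ^ 3 := by
    rw [hr, div_mul_cancel₀ _ hz30.ne']; ring
  have hrb : |r| ≤ 0.025 := by
    rw [hr, abs_div, abs_of_pos hz30, div_le_iff₀ hz30, abs_le]
    rw [s2, hna] at l1 l2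
    constructor <;> linarith
  have hb0 : 0 ≤ b3 := by rw [hb]; nlinarith
  have hb1 : b3 ≤ 0.2 := by rw [hb]; nlinarith
  have hpz : p = z * ν := by rw [hz]; linear_combination -p * hν
  have h1p : 0 < 1 + z * ν := by positivity
  refine ⟨(-r - b3 * ν) / (1 + z * ν), ?_, ?_⟩
  · rw [abs_div, abs_of_pos h1p, div_le_iff₀ h1p]
    obtain ⟨r1, r2⟩ := abs_le.1 hrb
    have t1 : b3 * ν ≤ 0.2 * (1 / 7) := by gcongr
    have t2 : 0 ≤ b3 * ν := by positivity
    have t3 : 0 ≤ z * ν := by positivity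
    rw [abs_le]; constructor <;> linarith
  · apply mul_right_cancel₀ h1p.ne'
    have : (-r - b3 * ν) / (1 + z * ν) * (1 + z * ν) = -r - b3 * ν := div_mul_cancel₀ _ h1p.ne'
    have h3 : E * (1 + z * ν) = z * A := by rw [← hpz]; exact hE
    rw [h3, hr']
    linear_combination -z ^ 4 * this - z ^ 3 * hb

set_option maxHeartbeats 1600000 in
/-- all the error terms are tiny -/
lemma small_bounds {n H p c C e0 X Y z : ℝ} (hn : 7 ≤ n) (hp0 : 0 < p) (hp1 : p ≤ 0.0083) (hH0 : 0 ≤ H)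
    (hH : H ≤ n ^ 2) (hc0 : 0 ≤ c) (hc : c ≤ 2 * p ^ 6) (hC0 : 0 ≤ C) (hC : C ≤ 1.4 * p ^ 8)
    (he0 : |e0| ≤ 1.03 * C) (hz : z = n * p)
    (hX : X = p * c * (n * (1 + p) + H * (1 + c)))
    (hY : Y = p * c * ((n * (1 + p) + H * (1 + c)) ^ 2 + n ^ 2 * p * (1 + p) + H ^ 2 * c * (1 + c))) :
    (0 ≤ p * c ∧ p * c ≤ 0.0001 * z ^ 4) ∧ (0 ≤ X ∧ X ≤ 0.0001 * z ^ 4) ∧ (0 ≤ Y ∧ Y ≤ 0.0001 * z ^ 4) ∧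
    n * |p * c - e0| ≤ 0.0001 * z ^ 4 ∧ 17 * C * 80 ≤ 0.0001 * z ^ 4 := by
  have hn0 : 0 < n := by linarith
  have hp3 : p ^ 3 ≤ 0.000001 := by
    calc p ^ 3 ≤ 0.0083 ^ 3 := by gcongr
      _ ≤ _ := by norm_num
  have hn4 : (1 : ℝ) ≤ n ^ 4 := one_le_pow₀ (by linarith)
  obtain ⟨W, hW⟩ : ∃ W, W = n ^ 4 * p ^ 7 := ⟨_, rfl⟩
  have hW1 : W ≤ 0.000001 * z ^ 4 := by
    have : W = p ^ 3 * z ^ 4 := by rw [hW, hz]; ring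
    rw [this]; gcongr
  have hpc0 : 0 ≤ p * c := by positivity
  have hpc : p * c ≤ 2 * p ^ 7 := by
    calc p * c ≤ p * (2 * p ^ 6) := by gcongr
      _ = _ := by ring
  have hp7 : 0 < p ^ 7 := by positivity
  have hc1 : c ≤ 1 := by
    have : p ^ 6 ≤ 0.0083 ^ 6 := by gcongr
    norm_num at this
    linarith
  have hnn : n ≤ n ^ 2 := by nlinarith
  have hn24 : n ^ 2 ≤ n ^ 4 := pow_le_pow_right₀ (by linarith) (by norm_num)
  have hS : n * (1 + p) + H * (1 + c) ≤ 4 * n ^ 2 := by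
    have : n * (1 + p) + H * (1 + c) ≤ n ^ 2 * (1 + 1) + n ^ 2 * (1 + 1) := by
      gcongr
      linarith
    linarith
  have hS0 : 0 ≤ n * (1 + p) + H * (1 + c) := by positivity
  have hz4 : 0 ≤ z ^ 4 := by rw [hz]; positivity
  have hp7W : p ^ 7 ≤ W := by rw [hW]; nlinarith
  have hn2W : n ^ 2 * p ^ 7 ≤ W := by rw [hW]; gcongr
  have hp8 : p ^ 8 ≤ 0.0083 * p ^ 7 := by
    have : p ^ 8 = p * p ^ 7 := by ring
    rw [this]; gcongr
  refine ⟨⟨hpc0, by linarith⟩, ⟨?_, ?_⟩, ⟨?_, ?_⟩, ?_, ?_⟩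
  · rw [hX]; positivity
  · rw [hX]
    calc p * c * (n * (1 + p) + H * (1 + c)) ≤ 2 * p ^ 7 * (4 * n ^ 2) := by gcongr
      _ = 8 * (n ^ 2 * p ^ 7) := by ring
      _ ≤ _ := by linarith
  · rw [hY]; positivity
  · have hT : (n * (1 + p) + H * (1 + c)) ^ 2 + n ^ 2 * p * (1 + p) + H ^ 2 * c * (1 + c) ≤ 20 * n ^ 4 := by
      have a1 : (n * (1 + p) + H * (1 + c)) ^ 2 ≤ (4 * n ^ 2) ^ 2 := by gcongr
      have a2 : n ^ 2 * p * (1 + p) ≤ n ^ 4 * 1 * (1 + 1) := by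
        gcongr <;> linarith
      have a3 : H ^ 2 * c * (1 + c) ≤ (n ^ 2) ^ 2 * 1 * (1 + 1) := by gcongr
      have e1 : (4 * n ^ 2) ^ 2 = 16 * n ^ 4 := by ring
      have e2 : (n ^ 2) ^ 2 * 1 * (1 + 1) = 2 * n ^ 4 := by ring
      linarith
    rw [hY]
    calc _ ≤ 2 * p ^ 7 * (20 * n ^ 4) := by gcongr
      _ = 40 * W := by rw [hW]; ring
      _ ≤ _ := by linarith
  · have h1 : |p * c - e0| ≤ 3 * p ^ 7 := by
      have := abs_le.1 he0
      rw [abs_le]; constructor <;> linarith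
    calc n * |p * c - e0| ≤ n ^ 2 * (3 * p ^ 7) := by gcongr
      _ = 3 * (n ^ 2 * p ^ 7) := by ring
      _ ≤ _ := by linarith
  · linarith

/-- size of the denominator and of `E` -/
lemma core_D {ν z p e N X e1 D ε : ℝ} (h0 : 0 < ν) (h1 : ν ≤ 1 / 7) (hν : ν * N = 1)
    (hz : z = N * p) (hz0 : 0 < z) (hz1 : z ≤ 0.0576) (hε : ε = 0.0001 * z ^ 4)
    (he : |e| ≤ ε) (hX0 : 0 ≤ X) (hX1 : X ≤ ε) (he1 : |e1| ≤ ε)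
    (hD : D = 2 - p + e - N * (p * (1 + p)) + X - e1) :
    p = z * ν ∧ D = 2 - (1 + ν) * z - ν * z ^ 2 + (e + X - e1) ∧ |e + X - e1| ≤ 3 * ε ∧
      1.93 ≤ D ∧ D ≤ 2 ∧ ε ≤ 0.0001 * 0.0576 * z ^ 3 := by
  have hpz : p = z * ν := by rw [hz]; linear_combination -p * hν
  have hNz : N * p = z := hz.symm
  have hz3 : z ^ 4 ≤ 0.0576 * z ^ 3 := by
    have : 0 < z ^ 3 := by positivity
    nlinarith
  have hz2 : z ^ 2 ≤ 0.0576 * z := by nlinarith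
  have hz33 : z ^ 3 ≤ 0.0576 * 0.0576 * z := by nlinarith
  have e2 : D = 2 - (1 + ν) * z - ν * z ^ 2 + (e + X - e1) := by
    have : N * (p * (1 + p)) = z * (1 + z * ν) := by rw [← hpz, hz]; ring
    rw [hD, this, hpz]; ring
  obtain ⟨a1, a2⟩ := abs_le.1 he
  obtain ⟨a3, a4⟩ := abs_le.1 he1
  have e3 : |e + X - e1| ≤ 3 * ε := by rw [abs_le]; constructor <;> linarith
  obtain ⟨b1, b2⟩ := abs_le.1 e3
  have k1 : ν * z ≤ 1 / 7 * z := by gcongr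
  have k2 : ν * z ^ 2 ≤ 1 / 7 * z ^ 2 := by gcongr
  have k3 : 0 ≤ ν * z := by positivity
  have k4 : 0 ≤ ν * z ^ 2 := by positivity
  refine ⟨hpz, e2, e3, ?_, ?_, by rw [hε]; linarith⟩
  · rw [e2]; linarith
  · rw [e2]; linarith

lemma abs_muE {ν E : ℝ} (h0 : 0 < ν) (h1 : ν ≤ 1 / 7) (hE0 : 0 ≤ E) (hE1 : E ≤ 0.0576) :
    |muE ν E| ≤ 0.55 := by
  have hn2 : 0 ≤ ν ^ 2 := by positivity
  have hn3 : 0 ≤ ν ^ 3 := by positivity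
  have hn2' : ν ^ 2 ≤ 1 / 49 := by nlinarith
  have hn3' : ν ^ 3 ≤ 1 / 343 := by
    calc ν ^ 3 ≤ (1 / 7) ^ 3 := by gcongr
      _ = _ := by norm_num
  have hE2 : E ^ 2 ≤ 0.0576 ^ 2 := by gcongr
  have hE3 : E ^ 3 ≤ 0.0576 ^ 3 := by gcongr
  have a1 : |(1 - 3 * ν) / 4| ≤ 0.25 := by rw [abs_le]; constructor <;> linarith
  have a2 : |(2 - ν - 9 * ν ^ 2) / 8| ≤ 0.25 := by rw [abs_le]; constructor <;> linarith
  have a3 : |(9 + 18 * ν - 61 * ν ^ 2 - 54 * ν ^ 3) / 32| ≤ 0.37 := by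
    rw [abs_le]; constructor <;> linarith
  have b1 := abs_le.1 (abs_mul_le a1 (show |E| ≤ 0.0576 by rwa [abs_of_nonneg hE0]))
  have b2 := abs_le.1 (abs_mul_le a2 (show |E ^ 2| ≤ 0.0576 ^ 2 by rwa [abs_of_nonneg (by positivity)]))
  have b3 := abs_le.1 (abs_mul_le a3 (show |E ^ 3| ≤ 0.0576 ^ 3 by rwa [abs_of_nonneg (by positivity)]))
  obtain ⟨c1, c2⟩ := b1
  obtain ⟨c3, c4⟩ := b2
  obtain ⟨c5, c6⟩ := b3
  unfold muE
  rw [abs_le]; constructor <;> linarith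

lemma E_bounds {ν z R1 b3 E : ℝ} (h0 : 0 ≤ ν) (h1 : ν ≤ 1 / 7) (hz0 : 0 < z) (hz : z ≤ 0.0576)
    (hR : |R1| ≤ 0.06) (hb : b3 = (1 - ν) / 8 + ν / 2 + ν ^ 2)
    (hE : E = z - (1 / 2 + ν) * z ^ 2 + b3 * z ^ 3 + R1 * z ^ 4) : 0.96 * z ≤ E ∧ E ≤ z := by
  obtain ⟨g, hg⟩ : ∃ g, g = -(1 / 2 + ν) + b3 * z + R1 * z ^ 2 := ⟨_, rfl⟩
  obtain ⟨⟨b0, b1⟩, g1, g2⟩ := g_bound h0 h1 hz0 hz hR hb hg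
  have e : E = z * (1 + g * z) := by rw [hE, hg]; ring
  rw [e]
  constructor
  · have : 0.96 ≤ 1 + g * z := by nlinarith
    nlinarith
  · have : g * z ≤ 0 := by nlinarith
    nlinarith

set_option maxHeartbeats 1600000 in
lemma core_mu {ν z p e N X e1 e2 D ε w R1 b3 E μ : ℝ} (h0 : 0 < ν) (h1 : ν ≤ 1 / 7) (hν : ν * N = 1)
    (hz : z = N * p) (hz0 : 0 < z) (hz1 : z ≤ 0.0576) (hε : ε = 0.0001 * z ^ 4)
    (he : |e| ≤ ε) (hX0 : 0 ≤ X) (hX1 : X ≤ ε) (he1 : |e1| ≤ ε) (he2 : |e2| ≤ ε)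
    (hw0 : 0 ≤ w) (hw1 : w ≤ ε)
    (hR : |R1| ≤ 0.06) (hb : b3 = (1 - ν) / 8 + ν / 2 + ν ^ 2)
    (hE : E = z - (1 / 2 + ν) * z ^ 2 + b3 * z ^ 3 + R1 * z ^ 4)
    (hD : D = 2 - p + e - N * (p * (1 + p)) + X - e1)
    (hμ : μ * D = 1 - 2 * p + 3 * w - e2) : |μ - muE ν E| ≤ 1.4 * z ^ 4 ∧ |μ| ≤ 0.6 ∧
      ∃ R m1 m2, |R| ≤ 0.1 ∧ m1 = (1 - 3 * ν) / 4 ∧ m2 = ((1 + ν) * m1 + ν / 2) / 2 ∧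
        μ = 1 / 2 + m1 * z + m2 * z ^ 2 + R * z ^ 3 := by
  obtain ⟨hpz, hD', hd, D1, D2, hε3⟩ := core_D h0 h1 hν hz hz0 hz1 hε he hX0 hX1 he1 hD
  obtain ⟨d, hdd⟩ : ∃ d, d = e + X - e1 := ⟨_, rfl⟩
  rw [← hdd] at hD' hd
  have hmc := mu_core h0.le h1 hz0 hz1 hR hb hE
  obtain ⟨hE1, hE2⟩ := E_bounds h0.le h1 hz0 hz1 hR hb hE
  have hm := abs_muE h0 h1 (by linarith : 0 ≤ E) (by linarith)
  obtain ⟨n1, hn1⟩ : ∃ n1, n1 = 3 * w - e2 := ⟨_, rfl⟩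
  obtain ⟨a1, a2⟩ := abs_le.1 he2
  have hn1a : |n1| ≤ 4 * ε := by rw [hn1, abs_le]; constructor <;> linarith
  have hD0 : 0 < D := by linarith
  have hz4 : 0 < z ^ 4 := by positivity
  have hz3 : 0 < z ^ 3 := by positivity
  have key : (μ - muE ν E) * D = (1 - 2 * z * ν - muE ν E * (2 - (1 + ν) * z - ν * z ^ 2)) + n1 - muE ν E * d := by
    have : (μ - muE ν E) * D = μ * D - muE ν E * D := by ring
    rw [this, hμ, hD', hpz, hn1]; ring
  have hmd := abs_mul_le hm hd
  have hA : |μ - muE ν E| ≤ 1.4 * z ^ 4 := by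
    have h5 : |μ - muE ν E| * D ≤ 2.7 * z ^ 4 := by
      rw [← abs_of_pos hD0, ← abs_mul, key]
      have := abs_add_le' (abs_add_le' hmc hn1a) ((abs_neg (muE ν E * d)).trans_le hmd)
      rw [← sub_eq_add_neg] at this
      rw [hε] at this
      linarith
    have h6 : |μ - muE ν E| * 1.93 ≤ |μ - muE ν E| * D := by gcongr
    linarith
  have hz4' : z ^ 4 ≤ 0.0576 * z ^ 3 := by nlinarith
  have hz33 : z ^ 3 ≤ 0.001 := by
    calc z ^ 3 ≤ 0.0576 ^ 3 := by gcongr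
      _ ≤ _ := by norm_num
  have hB : |μ| ≤ 0.6 := by
    have := abs_le.1 hA
    have := abs_le.1 hm
    rw [abs_le]; constructor <;> linarith
  refine ⟨hA, hB, ?_⟩
  obtain ⟨m1, hm1⟩ : ∃ m1, m1 = (1 - 3 * ν) / 4 := ⟨_, rfl⟩
  obtain ⟨m2, hm2⟩ : ∃ m2, m2 = ((1 + ν) * m1 + ν / 2) / 2 := ⟨_, rfl⟩
  have m1a : 0 ≤ m1 := by rw [hm1]; linarith
  have m1b : m1 ≤ 1 / 4 - 3 / 4 * ν := by rw [hm1]; linarith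
  have m2e : m2 = (1 / 4 - 3 / 4 * ν ^ 2) / 2 := by rw [hm2, hm1]; ring
  have hn2 : 0 ≤ ν ^ 2 := by positivity
  have hn2' : ν ^ 2 ≤ 1 / 7 * ν := by nlinarith
  have m2a : 0 ≤ m2 := by rw [m2e]; linarith
  have m2b : m2 ≤ 1 / 8 := by rw [m2e]; linarith
  obtain ⟨S, hS⟩ : ∃ S, S = 1 / 2 + m1 * z + m2 * z ^ 2 := ⟨_, rfl⟩
  have hS1 : |S| ≤ 1 := by
    have k1 : m1 * z ≤ 1 / 4 * 0.0576 := by gcongr; linarith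
    have k2 : m2 * z ^ 2 ≤ 1 / 8 * 0.0576 ^ 2 := by gcongr
    have k3 : 0 ≤ m1 * z := by positivity
    have k4 : 0 ≤ m2 * z ^ 2 := by positivity
    rw [hS, abs_le]; constructor <;> linarith
  refine ⟨(μ - S) / z ^ 3, m1, m2, ?_, hm1, hm2, ?_⟩
  · rw [abs_div, abs_of_pos hz3, div_le_iff₀ hz3]
    have key2 : (μ - S) * D = z ^ 3 * ((1 + ν) * m2 + ν * m1 + ν * m2 * z) + n1 - S * d := by
      have : (μ - S) * D = μ * D - S * D := by ring
      rw [this, hμ, hD', hpz, hn1, hS]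
      linear_combination (-2 * z) * hm1 + (-2 * z ^ 2) * hm2
    have hSd := abs_mul_le hS1 hd
    have k5 : |(1 + ν) * m2 + ν * m1 + ν * m2 * z| ≤ 0.18 := by
      have j1 : (1 + ν) * m2 ≤ (1 + 1 / 7) * (1 / 8) := by gcongr
      have j2 : ν * m1 ≤ 1 / 7 * (1 / 4) := by gcongr; linarith
      have j2' : ν * m1 ≤ 1 / 48 := by
        have : ν * m1 = 1 / 48 - 3 / 4 * (ν - 1 / 6) ^ 2 := by rw [hm1]; ring
        rw [this]; nlinarith [sq_nonneg (ν - 1 / 6)]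
      have j3 : ν * m2 * z ≤ 1 / 7 * (1 / 8) * 0.0576 := by gcongr
      have j4 : 0 ≤ (1 + ν) * m2 + ν * m1 + ν * m2 * z := by positivity
      rw [abs_of_nonneg j4]
      linarith
    have k6 := abs_mul_le (show |z ^ 3| ≤ z ^ 3 by rw [abs_of_pos hz3]) k5
    have h5 : |μ - S| * D ≤ 0.19 * z ^ 3 := by
      rw [← abs_of_pos hD0, ← abs_mul, key2]
      have := abs_add_le' (abs_add_le' k6 hn1a) ((abs_neg (S * d)).trans_le hSd)
      rw [← sub_eq_add_neg] at this
      linarith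
    have h6 : |μ - S| * 1.93 ≤ |μ - S| * D := by gcongr
    linarith
  · rw [div_mul_cancel₀ _ hz3.ne', ← hS]; ring

set_option maxHeartbeats 1600000 in
lemma core_v {ν z p e N X Y e1 e2 e3 D ε w R1 b3 E μ v : ℝ} (h0 : 0 < ν) (h1 : ν ≤ 1 / 7) (hν : ν * N = 1)
    (hz : z = N * p) (hz0 : 0 < z) (hz1 : z ≤ 0.0576) (hε : ε = 0.0001 * z ^ 4)
    (he : |e| ≤ ε) (hX0 : 0 ≤ X) (hX1 : X ≤ ε) (hY0 : 0 ≤ Y) (hY1 : Y ≤ ε)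
    (he1 : |e1| ≤ ε) (he2 : |e2| ≤ ε) (he3 : |e3| ≤ ε)
    (hw0 : 0 ≤ w) (hw1 : w ≤ ε)
    (hR : |R1| ≤ 0.06) (hb : b3 = (1 - ν) / 8 + ν / 2 + ν ^ 2)
    (hE : E = z - (1 / 2 + ν) * z ^ 2 + b3 * z ^ 3 + R1 * z ^ 4)
    (hD : D = 2 - p + e - N * (p * (1 + p)) + X - e1)
    (hμ : μ * D = 1 - 2 * p + 3 * w - e2)
    (hv : v * D = 1 - 4 * p + 4 * μ * N * p * (1 + p) - μ ^ 2 * (2 - p + e + N ^ 2 * p * (1 + p) * (1 + 2 * p))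
      + 9 * w - 6 * μ * X + μ ^ 2 * Y - e3) : |ν * v - vE ν E| ≤ 0.91 * z ^ 3 := by
  obtain ⟨hA, hB, R, m1, m2, hRR, hm1, hm2, hμe⟩ :=
    core_mu h0 h1 hν hz hz0 hz1 hε he hX0 hX1 he1 he2 hw0 hw1 hR hb hE hD hμ
  obtain ⟨hpz, hD', hd, D1, D2, hε3⟩ := core_D h0 h1 hν hz hz0 hz1 hε he hX0 hX1 he1 hD
  obtain ⟨d, hdd⟩ : ∃ d, d = e + X - e1 := ⟨_, rfl⟩
  rw [← hdd] at hD' hd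
  have hvc := v_core h0.le h1 hz0 hz1 hR hb hE hRR hm1 hm2 hμe
  obtain ⟨hE1, hE2⟩ := E_bounds h0.le h1 hz0 hz1 hR hb hE
  have hε0 : 0 ≤ ε := by rw [hε]; positivity
  have hμ2 : |μ ^ 2| ≤ 1 := by
    rw [abs_pow]
    calc |μ| ^ 2 ≤ 0.6 ^ 2 := by gcongr
      _ ≤ _ := by norm_num
  have hvE : |vE ν E| ≤ 1 := by
    have hn2 : 0 ≤ ν ^ 2 := by positivity
    have hn3 : 0 ≤ ν ^ 3 := by positivity
    have hn2' : ν ^ 2 ≤ 1 / 49 := by nlinarith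
    have hn3' : ν ^ 3 ≤ 1 / 343 := by
      calc ν ^ 3 ≤ (1 / 7) ^ 3 := by gcongr
        _ = _ := by norm_num
    have hE0 : 0 ≤ E := by linarith
    have a2 : |(-1 + 7 * ν - 8 * ν ^ 2) / 8| ≤ 1 := by rw [abs_le]; constructor <;> linarith
    have a3 : |(-4 + 16 * ν + 7 * ν ^ 2 - 33 * ν ^ 3) / 16| ≤ 1 := by
      rw [abs_le]; constructor <;> linarith
    have hE2' : E ^ 2 ≤ 0.1 := by nlinarith
    obtain ⟨c1, c2⟩ := abs_le.1 (abs_mul_le a2 (show |E| ≤ 0.1 by rw [abs_of_nonneg hE0]; linarith))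
    obtain ⟨c3, c4⟩ := abs_le.1 (abs_mul_le a3 (show |E ^ 2| ≤ 0.1 by rwa [abs_of_nonneg (by positivity)]))
    unfold vE
    rw [abs_le]; constructor <;> linarith
  obtain ⟨s, hs⟩ : ∃ s, s = -(μ ^ 2 * e) + 9 * w - 6 * (μ * X) + μ ^ 2 * Y - e3 := ⟨_, rfl⟩
  have hsa : |s| ≤ 30 * ε := by
    obtain ⟨c1, c2⟩ := abs_le.1 (abs_mul_le hμ2 he)
    obtain ⟨c3, c4⟩ := abs_le.1 (abs_mul_le hB (show |X| ≤ ε by rwa [abs_of_nonneg hX0]))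
    obtain ⟨c5, c6⟩ := abs_le.1 (abs_mul_le hμ2 (show |Y| ≤ ε by rwa [abs_of_nonneg hY0]))
    obtain ⟨c7, c8⟩ := abs_le.1 he3
    rw [hs, abs_le]; constructor <;> linarith
  have hD0 : 0 < D := by linarith
  have hz3 : 0 < z ^ 3 := by positivity
  have key : (ν * v - vE ν E) * D = (ν*(1-4*z*ν+4*μ*z*(1+z*ν)-μ^2*(2-z*ν))-μ^2*z*(1+z*ν)*(1+2*z*ν)-vE ν E*(2-(1+ν)*z-ν*z^2)) + ν * s - vE ν E * d := by
    have f1 : (ν * v - vE ν E) * D = ν * (v * D) - vE ν E * D := by ring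
    have f2 : N * p = z := hz.symm
    have f3 : ν * (N ^ 2 * p) = z := by
      calc ν * (N ^ 2 * p) = (ν * N) * (N * p) := by ring
        _ = z := by rw [hν, f2, one_mul]
    have f4 : v * D = 1 - 4 * p + 4 * μ * (N * p) * (1 + p) - μ ^ 2 * (2 - p) - μ ^ 2 * ((N ^ 2 * p) * (1 + p) * (1 + 2 * p)) + s := by
      rw [hv, hs]; ring
    have f5 : ν * (v * D) = ν * (1 - 4 * p + 4 * μ * (N * p) * (1 + p) - μ ^ 2 * (2 - p)) - μ ^ 2 * ((ν * (N ^ 2 * p)) * (1 + p) * (1 + 2 * p)) + ν * s := by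
      rw [f4]; ring
    rw [f1, f5, f3, f2, hD', hpz]; ring
  have k1 := abs_mul_le (show |ν| ≤ 1 by rw [abs_of_pos h0]; linarith) hsa
  have k2 := abs_mul_le hvE hd
  have h5 : |ν * v - vE ν E| * D ≤ 1.75 * z ^ 3 := by
    rw [← abs_of_pos hD0, ← abs_mul, key]
    have := abs_add_le' (abs_add_le' hvc k1) ((abs_neg (vE ν E * d)).trans_le k2)
    rw [← sub_eq_add_neg] at this
    linarith
  have h6 : |ν * v - vE ν E| * 1.93 ≤ |ν * v - vE ν E| * D := by gcongr
  linarith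

/-- tolerances -/
lemma tol_bounds {ν z E : ℝ} (h1 : ν ≤ 1 / 7) (hz0 : 0 < z) (hE1 : 0.96 * z ≤ E) :
    1.4 * z ^ 4 ≤ 8.8 * (1 - ν) ^ 4 * E ^ 4 ∧ 0.91 * z ^ 3 ≤ 2.08 * (1 - ν) ^ 4 * E ^ 3 := by
  have a : (6 / 7 : ℝ) ^ 4 ≤ (1 - ν) ^ 4 := by
    apply pow_le_pow_left₀ (by norm_num); linarith
  have b : (0.96 * z) ^ 4 ≤ E ^ 4 := pow_le_pow_left₀ (by positivity) hE1 4
  have c : (0.96 * z) ^ 3 ≤ E ^ 3 := pow_le_pow_left₀ (by positivity) hE1 3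
  constructor
  · calc 1.4 * z ^ 4 ≤ 8.8 * (6 / 7 : ℝ) ^ 4 * (0.96 * z) ^ 4 := by
          rw [mul_pow, ← mul_assoc]; gcongr; norm_num
      _ ≤ _ := by gcongr
  · calc 0.91 * z ^ 3 ≤ 2.08 * (6 / 7 : ℝ) ^ 4 * (0.96 * z) ^ 3 := by
          rw [mul_pow, ← mul_assoc]; gcongr; norm_num
      _ ≤ _ := by gcongr

lemma v_pos {ν z E v N : ℝ} (h0 : 0 < ν) (h1 : ν ≤ 1 / 7) (hν : ν * N = 1) (hNz : N * z ≤ 1)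
    (hz0 : 0 < z) (hz1 : z ≤ 0.0576) (hE0 : 0 ≤ E) (hE1 : E ≤ z)
    (h : |ν * v - vE ν E| ≤ 0.91 * z ^ 3) : 0 < v := by
  have hzν : z ≤ ν := by
    have : ν * (N * z) ≤ ν * 1 := by gcongr
    have e : ν * (N * z) = z := by rw [← mul_assoc, hν, one_mul]
    linarith
  have hn2 : 0 ≤ ν ^ 2 := by positivity
  have hn3 : 0 ≤ ν ^ 3 := by positivity
  have hn2' : ν ^ 2 ≤ 1 / 7 * ν := by nlinarith
  have hn3' : ν ^ 3 ≤ 1 / 49 * ν := by nlinarith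
  have hz2 : E ^ 2 ≤ 0.0576 * z := by nlinarith
  have hz3 : z ^ 3 ≤ 0.0576 ^ 2 * z := by
    have : z ^ 2 ≤ 0.0576 ^ 2 := by gcongr
    nlinarith
  have a2 : |(-1 + 7 * ν - 8 * ν ^ 2) / 8| ≤ 0.125 := by rw [abs_le]; constructor <;> linarith
  have a3 : |(-4 + 16 * ν + 7 * ν ^ 2 - 33 * ν ^ 3) / 16| ≤ 0.25 := by
    rw [abs_le]; constructor <;> linarith
  obtain ⟨c1, c2⟩ := abs_le.1 (abs_mul_le a2 (show |E| ≤ z by rwa [abs_of_nonneg hE0]))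
  obtain ⟨c3, c4⟩ := abs_le.1 (abs_mul_le a3 (show |E ^ 2| ≤ 0.0576 * z by rwa [abs_of_nonneg (by positivity)]))
  obtain ⟨d1, d2⟩ := abs_le.1 h
  have : 0 < ν * v := by
    unfold vE at d1
    linarith
  exact (mul_pos_iff_of_pos_left h0).1 this

lemma conv_polys (t : ℕ) {ν E : ℝ} (hν : ν = 1 / ((t : ℝ) + 1)) (hE : E = ((t : ℝ) + 1) / 2 ^ (t + 1)) :
    muPoly t = muE ν E ∧ 0.55 * (t : ℝ) ^ 4 / 2 ^ (4 * t) = 8.8 * (1 - ν) ^ 4 * E ^ 4 ∧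
    ν * vPoly t = vE ν E ∧ ν * (0.26 * (t : ℝ) ^ 4 / 2 ^ (3 * t)) = 2.08 * (1 - ν) ^ 4 * E ^ 3 := by
  obtain ⟨n, hn⟩ : ∃ n : ℝ, n = (t : ℝ) + 1 := ⟨_, rfl⟩
  have hn0 : n ≠ 0 := by rw [hn]; positivity
  have ht : (t : ℝ) = n - 1 := by rw [hn]; ring
  obtain ⟨P, hP⟩ : ∃ P : ℝ, P = 2 ^ t := ⟨_, rfl⟩
  have hP0 : P ≠ 0 := by rw [hP]; positivity
  have p1 : (2 : ℝ) ^ (t + 1) = P * 2 := by rw [hP]; ring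
  have p3 : (2 : ℝ) ^ (t + 3) = P * 8 := by rw [hP]; ring
  have p4 : (2 : ℝ) ^ (t + 4) = P * 16 := by rw [hP]; ring
  have p5 : (2 : ℝ) ^ (2 * t + 5) = P ^ 2 * 32 := by rw [hP]; ring
  have p6 : (2 : ℝ) ^ (2 * t + 6) = P ^ 2 * 64 := by rw [hP]; ring
  have p8 : (2 : ℝ) ^ (3 * t + 8) = P ^ 3 * 256 := by rw [hP]; ring
  have q4 : (2 : ℝ) ^ (4 * t) = P ^ 4 := by rw [hP]; ring
  have q3 : (2 : ℝ) ^ (3 * t) = P ^ 3 := by rw [hP]; ring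
  rw [← hn] at hν hE
  rw [p1] at hE
  subst hν hE
  refine ⟨?_, ?_, ?_, ?_⟩
  · unfold muPoly muE
    rw [p3, p5, p8, ht]; field_simp; ring
  · rw [q4, ht]; field_simp; ring
  · unfold vPoly vE
    rw [p4, p6, ht]; field_simp; ring
  · rw [q3, ht]; field_simp; ring

lemma C4_le_pow {t : ℕ} (ht : 6 ≤ t) : C4 t ≤ 1.4 * ((1 / 2 : ℝ) ^ (t + 1)) ^ 8 := by
  unfold C4
  have h : 12 * (t + 1) ≤ hp t 2 + hp t 3 + hp t 4 := by
    rw [hp_two, hp_three, hp_succ, hp_three]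
    nlinarith
  have h1 : (0.62 : ℝ) ^ (hp t 2 + hp t 3 + hp t 4) ≤ 0.62 ^ (12 * (t + 1)) :=
    pow_le_pow_of_le_one (by norm_num) (by norm_num) h
  have h2 : (0.62 : ℝ) ^ (12 * (t + 1)) ≤ ((1 / 2 : ℝ) ^ (t + 1)) ^ 8 := by
    rw [pow_mul, ← pow_mul (1 / 2 : ℝ), mul_comm (t + 1) 8, pow_mul (1 / 2 : ℝ)]
    apply pow_le_pow_left₀ (by positivity)
    norm_num
  linarith

lemma n503 {n : ℕ} (hn : 7 ≤ n) : (n : ℝ) * 0.503 ^ n ≤ 7 * 0.503 ^ 7 ∧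
    (n : ℝ) ^ 2 * 0.503 ^ n ≤ 49 * 0.503 ^ 7 ∧ (0.503 : ℝ) ^ n ≤ 0.503 ^ 7 := by
  refine ⟨?_, ?_, pow_le_pow_of_le_one (by norm_num) (by norm_num) hn⟩
  · induction n, hn using Nat.le_induction with
    | base => norm_num
    | succ n hn ih =>
      refine le_trans ?_ ih
      have h7 : (7 : ℝ) ≤ n := by exact_mod_cast hn
      rw [pow_succ]
      have : ((n + 1 : ℕ) : ℝ) * 0.503 ≤ n := by push_cast; linarith
      calc _ = (((n + 1 : ℕ) : ℝ) * 0.503) * 0.503 ^ n := by ring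
        _ ≤ _ := by gcongr
  · induction n, hn using Nat.le_induction with
    | base => norm_num
    | succ n hn ih =>
      refine le_trans ?_ ih
      have h7 : (7 : ℝ) ≤ n := by exact_mod_cast hn
      rw [pow_succ]
      have : ((n + 1 : ℕ) : ℝ) ^ 2 * 0.503 ≤ n ^ 2 := by push_cast; nlinarith
      calc _ = (((n + 1 : ℕ) : ℝ) ^ 2 * 0.503) * 0.503 ^ n := by ring
        _ ≤ _ := by gcongr

/-- basic facts on `p`, `c` for `x` close to `1/2` -/
lemma pc_facts {t : ℕ} (ht : 6 ≤ t) {x p c : ℝ} (hx0 : 1 / 2 ≤ x) (hx1 : x ≤ 0.503)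
    (hp : p = pR (t + 1) x) (hc : c = pR (1 + t + t ^ 2) x) :
    (1 / 2 : ℝ) ^ (t + 1) ≤ p ∧ p ≤ 0.0083 ∧ ((t + 1 : ℕ) : ℝ) * p ≤ 0.0576 ∧
    ((t + 1 : ℕ) : ℝ) * (((t + 1 : ℕ) : ℝ) * p) ≤ 1 ∧ 0 ≤ c ∧ c ≤ 2 * p ^ 6 ∧ C4 t ≤ 1.4 * p ^ 8 ∧
    x ^ (t + 1) * (1 + p) = p := by
  obtain ⟨k1, k2, k3⟩ := n503 (show 7 ≤ t + 1 by omega)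
  obtain ⟨q, hq⟩ : ∃ q, q = x ^ (t + 1) := ⟨_, rfl⟩
  have hx00 : 0 ≤ x := by linarith
  have q1 : (1 / 2 : ℝ) ^ (t + 1) ≤ q := by rw [hq]; gcongr
  have q2 : q ≤ 0.503 ^ (t + 1) := by rw [hq]; gcongr
  have q0 : 0 < q := lt_of_lt_of_le (by positivity) q1
  have h57 : (0.503 : ℝ) ^ 7 ≤ 0.00815 := by norm_num
  have q3 : q ≤ 0.00815 := by linarith
  have hpq : p = q / (1 - q) := by rw [hp, hq]; rfl
  have hpq' : p * (1 - q) = q := by rw [hpq]; exact div_mul_cancel₀ _ (by linarith)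
  have p0 : 0 < p := by rw [hpq]; apply div_pos <;> linarith
  have hqp : q ≤ p := by nlinarith
  have hp1 : p ≤ 1.0083 * q := by
    rw [hpq, div_le_iff₀ (by linarith)]; nlinarith
  obtain ⟨n, hn⟩ : ∃ n : ℝ, n = ((t + 1 : ℕ) : ℝ) := ⟨_, rfl⟩
  have hn0 : 0 ≤ n := by rw [hn]; positivity
  rw [← hn] at k1 k2 ⊢
  have z1 : n * p ≤ 0.0576 := by
    calc n * p ≤ n * (1.0083 * 0.503 ^ (t + 1)) := by
          gcongr; linarith
      _ = 1.0083 * (n * 0.503 ^ (t + 1)) := by ring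
      _ ≤ 1.0083 * (7 * 0.503 ^ 7) := by gcongr
      _ ≤ _ := by norm_num
  have z2 : n * (n * p) ≤ 1 := by
    calc n * (n * p) ≤ n * (n * (1.0083 * 0.503 ^ (t + 1))) := by
          gcongr; linarith
      _ = 1.0083 * (n ^ 2 * 0.503 ^ (t + 1)) := by ring
      _ ≤ 1.0083 * (49 * 0.503 ^ 7) := by gcongr
      _ ≤ _ := by norm_num
  have hH : 6 * (t + 1) ≤ 1 + t + t ^ 2 := by nlinarith
  obtain ⟨r, hr⟩ : ∃ r, r = x ^ (1 + t + t ^ 2) := ⟨_, rfl⟩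
  have r0 : 0 ≤ r := by rw [hr]; positivity
  have r1 : r ≤ q ^ 6 := by
    rw [hr, hq, ← pow_mul, mul_comm]
    exact pow_le_pow_of_le_one hx00 (by linarith) hH
  have q61 : q ^ 6 ≤ 1 / 2 := by
    calc q ^ 6 ≤ 0.00815 ^ 6 := by gcongr
      _ ≤ _ := by norm_num
  have hcr : c = r / (1 - r) := by rw [hc, hr]; rfl
  have hqp6 : q ^ 6 ≤ p ^ 6 := by gcongr
  refine ⟨q1.trans hqp, by linarith, z1, z2, ?_, ?_, ?_, ?_⟩
  · rw [hcr]; apply div_nonneg <;> linarith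
  · have : c ≤ 2 * r := by
      rw [hcr, div_le_iff₀ (by linarith)]; nlinarith
    linarith
  · refine (C4_le_pow ht).trans ?_
    have : ((1 / 2 : ℝ) ^ (t + 1)) ^ 8 ≤ p ^ 8 := by
      gcongr; exact q1.trans hqp
    linarith
  · rw [← hq]; linarith

set_option maxHeartbeats 1600000 in
lemma num_ge6 {t : ℕ} (ht : 6 ≤ t) {x : ℝ} (hx0 : 1 / 2 ≤ x) (hx1 : x ≤ 0.503) : NumOK t x := by
  intro N H p c X Y e0 e1 e2 D hS
  obtain ⟨f1, f2, f3, f4, f5, f6, f7, f8⟩ := pc_facts ht hx0 hx1 hS.hp hS.hc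
  obtain ⟨n, hn⟩ : ∃ n : ℕ, n = t + 1 := ⟨_, rfl⟩
  rw [← hn] at f1 f3 f4 f8
  have hNn : N = (n : ℝ) := by rw [hS.hN, hn]; push_cast; ring
  have hn7 : 7 ≤ n := by omega
  have hn7' : (7 : ℝ) ≤ n := by exact_mod_cast hn7
  have p0 : 0 < p := lt_of_lt_of_le (by positivity) f1
  have ht0 : (0 : ℝ) ≤ t := Nat.cast_nonneg t
  have hH0 : 0 ≤ H := by rw [hS.hH]; positivity
  have hH1 : H ≤ N ^ 2 := by rw [hS.hH, hS.hN]; nlinarith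
  obtain ⟨z, hz⟩ : ∃ z, z = N * p := ⟨_, rfl⟩
  obtain ⟨⟨w0, w1⟩, ⟨X0, X1⟩, ⟨Y0, Y1⟩, he, hC⟩ := small_bounds (by rw [hNn]; exact hn7') p0 f2 hH0 hH1 f5 f6
    (C4_pos t).le f7 hS.b0 hz hS.hX hS.hY
  obtain ⟨e, hee⟩ : ∃ e, e = p * c - e0 := ⟨_, rfl⟩
  rw [← hee] at he
  obtain ⟨ν, hνd⟩ : ∃ ν : ℝ, ν = 1 / ((t : ℝ) + 1) := ⟨_, rfl⟩
  have hν : ν * N = 1 := by rw [hνd, hS.hN]; field_simp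
  have ν0 : 0 < ν := by rw [hνd]; positivity
  have ν1 : ν ≤ 1 / 7 := by
    have : ν * 7 ≤ ν * N := by rw [hNn]; gcongr
    linarith
  have z0 : 0 < z := by rw [hz, hNn]; positivity
  have z1 : z ≤ 0.0576 := by rw [hz, hNn]; exact f3
  have hea : |e| ≤ 0.0001 * z ^ 4 := by
    have : 1 * |e| ≤ N * |e| := by gcongr; rw [hNn]; linarith
    linarith
  have hB : Bt t = 17 * C4 t := rfl
  have hC0 := C4_pos t
  have hx00 : x ≠ 0 := by linarith
  have hy : 1 / x = 2 - p + e := by rw [hS.h0, hee]; ring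
  obtain ⟨E, hE⟩ : ∃ E : ℝ, E = ((t : ℝ) + 1) / 2 ^ (t + 1) := ⟨_, rfl⟩
  have hEA : E * (1 + p) = z * (1 - (p - e) / 2) ^ n := by
    have g1 : 1 - (p - e) / 2 = (1 / x) * (1 / 2) := by rw [hy]; ring
    have g2 : p * (1 / x) ^ n = 1 + p := by
      rw [← f8, one_div, inv_pow]
      have : x ^ n ≠ 0 := pow_ne_zero _ hx00
      field_simp
      rw [f8]
    rw [g1, mul_pow, hz, hE, hS.hN, ← hn]
    have : ((t : ℝ) + 1) * p * ((1 / x) ^ n * (1 / 2) ^ n) = ((t : ℝ) + 1) * (p * (1 / x) ^ n) * (1 / 2) ^ n := by ring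
    rw [this, g2, one_div, inv_pow]; ring
  obtain ⟨b3, hb⟩ : ∃ b3, b3 = (1 - ν) / 8 + ν / 2 + ν ^ 2 := ⟨_, rfl⟩
  obtain ⟨R1, hR, hEe⟩ := E_exp hn7 (by rw [← hNn]; exact hν) (by rw [← hNn]; exact hz) p0 z1
    (by rw [← hNn]; exact he) rfl hEA hb
  obtain ⟨E1, E2⟩ := E_bounds ν0.le ν1 z0 z1 hR hb hEe
  have he1 : |e1| ≤ 0.0001 * z ^ 4 := hS.b1.trans (by rw [hB]; linarith)
  have he2 : |e2| ≤ 0.0001 * z ^ 4 := hS.b2.trans (by rw [hB]; linarith)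
  have hD : D = 2 - p + e - N * (p * (1 + p)) + X - e1 := by rw [hS.hD, hy]
  obtain ⟨-, -, -, D1, -, -⟩ := core_D ν0 ν1 hν hz z0 z1 rfl hea X0 X1 he1 hD
  refine ⟨by linarith, ?_⟩
  intro μ v e3 hμ he3 hv
  obtain ⟨m1, m2, -⟩ := core_mu ν0 ν1 hν hz z0 z1 rfl hea X0 X1 he1 he2 w0 w1 hR hb hEe hD hμ
  have he3' : |e3| ≤ 0.0001 * z ^ 4 := (he3 m2).trans (by rw [hB]; linarith)
  rw [hy] at hv
  have hvv := core_v ν0 ν1 hν hz z0 z1 rfl hea X0 X1 Y0 Y1 he1 he2 he3' w0 w1 hR hb hEe hD hμ hv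
  obtain ⟨c1, c2, c3, c4⟩ := conv_polys t hνd hE
  obtain ⟨t1, t2⟩ := tol_bounds ν1 z0 E1
  refine ⟨?_, ?_, ?_⟩
  · rw [c1, c2]; exact m1.trans t1
  · refine v_pos ν0 ν1 hν ?_ z0 z1 (by linarith) E2 hvv
    rw [hz, hNn]; exact f4
  · have : ν * |v - vPoly t| ≤ ν * (0.26 * (t : ℝ) ^ 4 / 2 ^ (3 * t)) := by
      rw [c4]
      refine le_trans (le_of_eq ?_) (hvv.trans t2)
      rw [← c3, ← mul_sub, abs_mul, abs_of_pos ν0]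
    exact le_of_mul_le_mul_left this ν0

lemma loc_ge6 {t : ℕ} (ht : 6 ≤ t) {x : ℝ}
    (hu : ∀ q : ℂ, ‖q‖ < 1 - 0.72 / (t : ℝ) → bGF t q 1 1 1 = 1 → q = (x : ℂ)) : 1 / 2 ≤ x ∧ x ≤ 0.503 := by
  have hC : 0 < C4 t := C4_pos t
  refine locate t (by omega) (by norm_num) (by norm_num) (by norm_num) hu ?_ ?_
  · obtain ⟨f1, f2, f3, f4, f5, f6, f7, f8⟩ := pc_facts ht (le_refl (1 / 2 : ℝ)) (by norm_num) rfl rfl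
    rw [hp_two, hp_three, Nat.add_comm 1 t]
    obtain ⟨p, hp⟩ : ∃ p, p = pR (t + 1) (1 / 2) := ⟨_, rfl⟩
    obtain ⟨c, hc⟩ : ∃ c, c = pR (1 + t + t ^ 2) (1 / 2) := ⟨_, rfl⟩
    rw [← hp] at f1 f2 f6 f7
    rw [← hc] at f5 f6
    rw [Nat.add_comm 1 t] at hc
    rw [← hp, ← hc]
    have p0 : 0 < p := lt_of_lt_of_le (by positivity) f1
    have a1 : p ^ 6 ≤ 0.0083 ^ 6 := by gcongr
    have a2 : p ^ 7 ≤ 0.0083 ^ 7 := by gcongr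
    have a3 : p ^ 8 ≤ 0.0083 ^ 7 * p := by
      have : p ^ 8 = p ^ 7 * p := by ring
      rw [this]; gcongr
    have a4 : c ≤ 1 / 4 := by
      refine f6.trans ?_
      calc 2 * p ^ 6 ≤ 2 * 0.0083 ^ 6 := by gcongr
        _ ≤ _ := by norm_num
    have a5 : p * c ≤ p * (1 / 4) := by gcongr
    have a6 : (0.0083 : ℝ) ^ 7 * p ≤ 0.1 * p := by gcongr; norm_num
    norm_num
    linarith
  · obtain ⟨f1, f2, f3, f4, f5, f6, f7, f8⟩ := pc_facts ht (by norm_num : (1 / 2 : ℝ) ≤ 0.503) (le_refl _) rfl rfl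
    rw [hp_two, hp_three, Nat.add_comm 1 t]
    obtain ⟨p, hp⟩ : ∃ p, p = pR (t + 1) 0.503 := ⟨_, rfl⟩
    obtain ⟨c, hc⟩ : ∃ c, c = pR (1 + t + t ^ 2) 0.503 := ⟨_, rfl⟩
    rw [← hp] at f1 f2 f6 f7
    rw [← hc] at f5 f6
    rw [Nat.add_comm 1 t] at hc
    rw [← hp, ← hc]
    have p0 : 0 < p := lt_of_lt_of_le (by positivity) f1
    have a5 : 0 ≤ p * c := by positivity
    have a3 : p ^ 8 ≤ 0.0001 := by
      calc p ^ 8 ≤ 0.0083 ^ 8 := by gcongr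
        _ ≤ _ := by norm_num
    have a6 : (1 : ℝ) / 0.503 - 2 ≤ -0.0119 := by norm_num
    linarith

/-- everything except the probabilistic conclusion -/
theorem all_cases (t : ℕ) (ht : 2 ≤ t) (x : ℝ) (hx0 : 0 < x)
    (hr : bGF t (x : ℂ) 1 1 1 = 1)
    (hu : ∀ q : ℂ, ‖q‖ < 1 - 0.72 / (t : ℝ) → bGF t q 1 1 1 = 1 → q = (x : ℂ)) :
    x ≤ 0.558 ∧ NumOK t x := by
  rcases Nat.lt_or_ge t 6 with h | h
  · interval_cases t
    · obtain ⟨h1, h2⟩ := loc_2 hu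
      exact ⟨by linarith, num_2 h1 h2⟩
    · obtain ⟨h1, h2⟩ := loc_3 hu
      exact ⟨by linarith, num_3 h1 h2⟩
    · obtain ⟨h1, h2⟩ := loc_4 hu
      exact ⟨by linarith, num_4 h1 h2⟩
    · obtain ⟨h1, h2⟩ := loc_5 hu
      exact ⟨by linarith, num_5 h1 h2⟩
  · obtain ⟨h1, h2⟩ := loc_ge6 h hu
    exact ⟨by linarith, num_ge6 h h1 h2⟩

/-- For a uniformly random canonical `t`-ary tree with `n` internal
vertices the height `h(T)` is asymptotically normal with mean `μ_h n + O(1)` and variance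
`σ_h² n + O(1)`, a local limit theorem holds, `μ_h` is the stated ratio of derivatives of
`b` at the dominant singularity `q₀`, and `μ_h`, `σ_h²` satisfy the stated estimates in
`t` for all `t ≥ 2`. -/
theorem height_asymptotically_normal (t : ℕ) (ht : 2 ≤ t)
    (q₀ : ℝ) (hq₀pos : 0 < q₀) (hq₀lt : q₀ < 1 - 0.72 / t)
    (hq₀root : bGF t (q₀ : ℂ) 1 1 1 = 1)
    (hq₀uniq : ∀ q : ℂ, ‖q‖ < 1 - 0.72 / t → bGF t q 1 1 1 = 1 → q = (q₀ : ℂ)) :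
    ∃ μh σh : ℝ, 0 < σh ∧
      (μh : ℂ) = deriv (fun w : ℂ => bGF t (q₀ : ℂ) 1 1 w) 1 /
          ((q₀ : ℂ) * deriv (fun q : ℂ => bGF t q 1 1 1) (q₀ : ℂ)) ∧
      |μh - (1/2 + ((t : ℝ) - 2)/2^(t+3) + (2*(t : ℝ)^2 + 3*t - 8)/2^(2*t+5)
          + (9*(t : ℝ)^3 + 45*t^2 + 2*t - 88)/2^(3*t+8))|
        ≤ 0.55 * (t : ℝ)^4 / 2^(4*t) ∧
      |σh^2 - (1/4 + (-(t : ℝ)^2 + 5*t - 2)/2^(t+4)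
          + (-4*(t : ℝ)^3 + 4*t^2 + 27*t - 14)/2^(2*t+6))|
        ≤ 0.26 * (t : ℝ)^4 / 2^(3*t) ∧
      (∃ C : ℝ, ∀ n : ℕ, 1 ≤ n →
        |forestExp t 1 n (fun T => (T.height : ℝ)) - μh * n| ≤ C) ∧
      (∃ C : ℝ, ∀ n : ℕ, 1 ≤ n →
        |forestVar t 1 n (fun T => (T.height : ℝ)) - σh^2 * n| ≤ C) ∧
      (∀ x : ℝ, Filter.Tendsto
        (fun n : ℕ => forestProb t 1 n
          {T | ((T.height : ℝ) - μh * n) / (σh * Real.sqrt n) ≤ x})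
        Filter.atTop (nhds (stdGaussCDF x))) ∧
      (∀ ε : ℝ, 0 < ε → ∃ N : ℕ, ∀ n : ℕ, N ≤ n → ∀ k : ℤ,
        |σh * Real.sqrt n * forestProb t 1 n {T | (T.height : ℤ) = k}
            - stdGaussPDF (((k : ℝ) - μh * n) / (σh * Real.sqrt n))| ≤ ε) := by
  obtain ⟨hx, hnum⟩ := all_cases t ht q₀ hq₀pos hq₀root hq₀uniq
  obtain ⟨μ, σ, L, δ, K, hσ, hμ, h1, h2, hQ, hL1, hL2⟩ :=
    final_of_num t ht q₀ hq₀pos hx hq₀root hq₀uniq hnum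
  exact ⟨μ, σ, hσ, hμ, h1, h2, forest_asymp hQ hσ hL1 hL2⟩

end
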